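/- Let S ⊂ SL₂(ℤ) be a finite symmetric set with |S| ≥ 4 which freely generates a free subgroup of rank |S|/2. Let Δ = max_{s∈S} ‖s‖ and γ = log((2/√3)·√|S|)/log Δ. Then there exists p₀ such that for every prime p ≥ p₀ for which the reduction of S modulo p generates SL₂(𝔽_p), the spectral gap of the normalized Laplace operator of the Cayley graph of SL₂(𝔽_p) with respect to S mod p is at least 2^(−2^35·γ^(−1)); concretely, for every function f : SL₂(𝔽_p) → ℝ with Σ_{g∈SL₂(𝔽_p)} f(g) = 0, one has Σ_{g∈SL₂(𝔽_p)} Σ_{s∈S} f(g)·(f(g) − f(g·(s mod p))) ≥ 2^(−2^35·γ^(−1)) · |S| · Σ_{g∈SL₂(𝔽_p)} f(g)². -/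

import Mathlib

open Pointwise

instance {n : Type*} [DecidableEq n] [Fintype n] {R : Type*} [CommRing R] [DecidableEq R] :
    DecidableEq (Matrix.SpecialLinearGroup n R) := Subtype.instDecidableEq

/-- The ℓ² operator norm of an integer matrix in `SL₂(ℤ)`, i.e. the norm of the induced
linear operator on Euclidean `ℝ²`. -/
noncomputable def sl2zOpNorm (g : Matrix.SpecialLinearGroup (Fin 2) ℤ) : ℝ :=
  ‖Matrix.toEuclideanCLM (𝕜 := ℝ)
    ((g : Matrix (Fin 2) (Fin 2) ℤ).map (Int.cast : ℤ → ℝ))‖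


namespace BG

open Finset

/-- Graph-theoretic Balog-Szemerédi-Gowers lemma (paths of length four). -/
lemma bsg_graph {α : Type*} [DecidableEq α] (A : Finset α) (R : α → α → Prop) [DecidableRel R]
    (K : ℝ) (hK : 1 ≤ K) (hA : A.Nonempty)
    (hE : (A.card : ℝ) ^ 2 / K ≤ (((A ×ˢ A).filter (fun q => R q.1 q.2)).card : ℝ)) :
    ∃ X ⊆ A, (A.card : ℝ) / (4 * K) ≤ X.card ∧ ∀ x ∈ X, ∀ x' ∈ X,
      (A.card : ℝ) ^ 3 / (1024 * K ^ 5) ≤ (((A ×ˢ A ×ˢ A).filter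
        (fun q => R x q.1 ∧ R q.2.1 q.1 ∧ R q.2.1 q.2.2 ∧ R x' q.2.2)).card : ℝ) := by
  classical
  set n : ℝ := (A.card : ℝ) with hn
  have hn0 : 0 < n := by simpa [hn] using hA
  have hK0 : 0 < K := by linarith
  set N : α → Finset α := fun y => A.filter (fun x => R x y) with hN
  set cd : α → α → Finset α := fun x x' => A.filter (fun y => R x y ∧ R x' y) with hcd
  set δ : ℝ := 1 / (16 * K ^ 2) with hδ
  have hδ0 : 0 < δ := by positivity
  set bad : α → α → Prop := fun x x' => ((cd x x').card : ℝ) < δ * n with hbad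
  set B : α → Finset (α × α) := fun y => ((N y) ×ˢ (N y)).filter (fun q => bad q.1 q.2) with hB
  have h1 : ∑ y ∈ A, ((N y).card : ℝ) = (((A ×ˢ A).filter (fun q => R q.1 q.2)).card : ℝ) := by
    rw [card_filter, sum_product_right]
    push_cast
    refine sum_congr rfl fun y _ => ?_
    simp [hN]
  have h2 : n ^ 3 / K ^ 2 ≤ ∑ y ∈ A, ((N y).card : ℝ) ^ 2 := by
    have := sq_sum_le_card_mul_sum_sq (s := A) (f := fun y => ((N y).card : ℝ))
    rw [h1] at this
    have h3 : (n ^ 2 / K) ^ 2 ≤ n * ∑ y ∈ A, ((N y).card : ℝ) ^ 2 := by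
      refine le_trans ?_ this
      gcongr
    have : (n ^ 2 / K) ^ 2 = n * (n ^ 3 / K ^ 2) := by field_simp
    rw [this] at h3
    exact le_of_mul_le_mul_left h3 hn0
  have h3 : ∑ y ∈ A, ((B y).card : ℝ) ≤ δ * n ^ 3 := by
    have e1 : ∑ y ∈ A, ((B y).card : ℝ) = ∑ q ∈ (A ×ˢ A).filter (fun q => bad q.1 q.2),
        ((cd q.1 q.2).card : ℝ) := by
      have : ∀ y ∈ A, ((B y).card : ℝ) = ∑ q ∈ (A ×ˢ A).filter (fun q => bad q.1 q.2),
          (if R q.1 y ∧ R q.2 y then (1 : ℝ) else 0) := by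
        intro y _
        rw [← sum_filter, sum_const, nsmul_eq_mul, mul_one]
        congr 2
        ext ⟨a, b⟩
        simp only [hB, hN, mem_filter, mem_product]
        tauto
      rw [sum_congr rfl this, sum_comm]
      refine sum_congr rfl fun q _ => ?_
      simp [hcd]
    rw [e1]
    calc _ ≤ ∑ q ∈ (A ×ˢ A).filter (fun q => bad q.1 q.2), δ * n := by
          refine sum_le_sum fun q hq => ?_
          exact (mem_filter.1 hq).2.le
      _ = (((A ×ˢ A).filter (fun q => bad q.1 q.2)).card : ℝ) * (δ * n) := by simp
      _ ≤ (n ^ 2) * (δ * n) := by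
          gcongr
          have := card_filter_le (A ×ˢ A) (fun q => bad q.1 q.2)
          rw [card_product] at this
          have h' : (((A ×ˢ A).filter (fun q => bad q.1 q.2)).card : ℝ) ≤ (A.card : ℝ) * A.card := by
            exact_mod_cast this
          rwa [← hn, ← sq] at h'
      _ = _ := by ring
  obtain ⟨y, hyA, hy⟩ : ∃ y ∈ A, n ^ 2 / (2 * K ^ 2) ≤
      ((N y).card : ℝ) ^ 2 - 8 * ((B y).card : ℝ) := by
    by_contra hcon
    push Not at hcon
    have := sum_lt_sum_of_nonempty hA hcon
    rw [sum_sub_distrib, ← mul_sum, sum_const, nsmul_eq_mul] at this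
    have h4 : 8 * (δ * n ^ 3) = n ^ 3 / (2 * K ^ 2) := by rw [hδ]; field_simp; norm_num
    have h5 : (A.card : ℝ) * (n ^ 2 / (2 * K ^ 2)) = n ^ 3 / (2 * K ^ 2) := by
      rw [← hn]; ring
    have h6 : n ^ 3 / K ^ 2 = n ^ 3 / (2 * K ^ 2) + n ^ 3 / (2 * K ^ 2) := by field_simp; norm_num
    linarith
  set m : ℝ := ((N y).card : ℝ) with hm
  have hBnn : (0 : ℝ) ≤ ((B y).card : ℝ) := by positivity
  have hm0 : 0 ≤ m := by positivity
  have hm1 : n / (2 * K) ≤ m := by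
    have : (n / (2 * K)) ^ 2 ≤ m ^ 2 := by
      have e : (n / (2 * K)) ^ 2 = n ^ 2 / (2 * K ^ 2) / 2 := by field_simp
      have : 0 ≤ n ^ 2 / (2 * K ^ 2) := by positivity
      rw [e]; linarith
    exact le_of_sq_le_sq this hm0
  have hBm : ((B y).card : ℝ) ≤ m ^ 2 / 8 := by
    have : 0 ≤ n ^ 2 / (2 * K ^ 2) := by positivity
    linarith
  have hmpos : 0 < m := lt_of_lt_of_le (by positivity) hm1
  set X := (N y).filter (fun x => (((N y).filter (fun x' => bad x x')).card : ℝ) ≤ m / 4) with hX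
  have hXc : m / 2 ≤ (X.card : ℝ) := by
    have hsum : ∑ x ∈ N y, (((N y).filter (fun x' => bad x x')).card : ℝ) = ((B y).card : ℝ) := by
      simp only [hB]
      rw [card_filter, sum_product]
      push_cast
      refine sum_congr rfl fun x _ => ?_
      simp
    have h7 : ((N y) \ X).card * (m / 4) ≤ ((B y).card : ℝ) := by
      rw [← hsum]
      calc (((N y) \ X).card : ℝ) * (m / 4) = ∑ x ∈ (N y) \ X, m / 4 := by simp
        _ ≤ ∑ x ∈ (N y) \ X, (((N y).filter (fun x' => bad x x')).card : ℝ) := by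
            refine sum_le_sum fun x hx => ?_
            simp only [hX, mem_sdiff, mem_filter, not_and, not_le] at hx
            exact (hx.2 hx.1).le
        _ ≤ _ := sum_le_sum_of_subset_of_nonneg sdiff_subset (fun _ _ _ => by positivity)
    have h8 : (((N y) \ X).card : ℝ) ≤ m / 2 := by
      have : (((N y) \ X).card : ℝ) * (m / 4) ≤ (m / 2) * (m / 4) := by nlinarith
      exact le_of_mul_le_mul_right this (by positivity)
    have h9 : (((N y) \ X).card : ℝ) + X.card = m := by
      rw [hm]
      exact_mod_cast card_sdiff_add_card_eq_card (filter_subset _ _)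
    linarith
  refine ⟨X, (filter_subset _ _).trans (filter_subset _ _), ?_, ?_⟩
  · refine le_trans ?_ hXc
    have : n / (4 * K) = n / (2 * K) / 2 := by field_simp; norm_num
    linarith
  intro x hx x' hx'
  have hbs : ∀ a b, bad a b ↔ bad b a := by
    intro a b
    simp only [hbad, hcd]
    have : A.filter (fun y => R a y ∧ R b y) = A.filter (fun y => R b y ∧ R a y) := by
      ext z; simp only [mem_filter]; tauto
    rw [this]
  set Z := (N y).filter (fun z => ¬ bad x z ∧ ¬ bad x' z) with hZ
  have hZc : m / 2 ≤ (Z.card : ℝ) := by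
    have hx2 := (mem_filter.1 hx).2
    have hx2' := (mem_filter.1 hx').2
    have hsub : N y ⊆ Z ∪ ((N y).filter (fun z => bad x z) ∪ (N y).filter (fun z => bad x' z)) := by
      intro z hz
      simp only [hZ, mem_union, mem_filter]
      tauto
    have h10 := (card_le_card hsub).trans ((card_union_le _ _).trans
      (Nat.add_le_add_left (card_union_le _ _) _))
    have h11 : m ≤ (Z.card : ℝ) + (((N y).filter (fun z => bad x z)).card +
      ((N y).filter (fun z => bad x' z)).card) := by
      rw [hm]; exact_mod_cast h10
    linarith
  have hsub : (Z.sigma (fun z => (cd x z) ×ˢ (cd x' z))).card ≤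
      ((A ×ˢ A ×ˢ A).filter
        (fun q => R x q.1 ∧ R q.2.1 q.1 ∧ R q.2.1 q.2.2 ∧ R x' q.2.2)).card := by
    refine card_le_card_of_injOn (fun s => (s.2.1, s.1, s.2.2)) ?_ ?_
    · rintro ⟨z, a, b⟩ hs
      simp only [coe_sigma, Set.mem_sigma_iff, mem_coe, mem_product, hcd, mem_filter, hZ, hN,
        coe_filter, Set.mem_ofPred_eq] at hs ⊢
      tauto
    · rintro ⟨z, a, b⟩ _ ⟨z', a', b'⟩ _ h
      simp only [Prod.mk.injEq] at h
      obtain ⟨rfl, rfl, rfl⟩ := h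
      rfl
  refine le_trans ?_ (Nat.cast_le.2 hsub)
  rw [card_sigma]
  push_cast
  calc n ^ 3 / (1024 * K ^ 5) = (n / (2 * K)) / 2 * (δ * n) ^ 2 := by
        rw [hδ]; field_simp; norm_num
    _ ≤ m / 2 * (δ * n) ^ 2 := by gcongr
    _ ≤ (Z.card : ℝ) * (δ * n) ^ 2 := by gcongr
    _ = ∑ z ∈ Z, (δ * n) ^ 2 := by simp
    _ ≤ _ := by
        refine sum_le_sum fun z hz => ?_
        have hz2 := (mem_filter.1 hz).2
        simp only [hbad, not_lt] at hz2
        rw [card_product, sq]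
        push_cast
        gcongr
        · exact hz2.1
        · exact hz2.2

end BG


namespace BG

open Finset Pointwise

section
variable {G : Type*} [Group G] [Fintype G] [DecidableEq G]

lemma level_set (f : G → ℝ) (E K : ℝ) (hK : 1 ≤ K) (hE : 0 < E) (hf0 : ∀ x, 0 ≤ f x)
    (hf1 : ∑ x, f x = 1) (hfE : ∀ x, f x ≤ E) (hfs : ∀ x, f x⁻¹ = f x)
    (hT : E / K ≤ ∑ x, ∑ y, f x * f y * f (x * y)) :
    ∃ A : Finset G, A⁻¹ = A ∧ (∀ x ∈ A, E / (6 * K) ≤ f x) ∧ (A.card : ℝ) ≤ 6 * K / E ∧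
      1 / (2 * K * E) ≤ (A.card : ℝ) ∧
      (A.card : ℝ) ^ 2 / (72 * K ^ 3) ≤
        (((A ×ˢ A).filter (fun q => q.1⁻¹ * q.2 ∈ A)).card : ℝ) := by
  classical
  have hK0 : 0 < K := by linarith
  set θ : ℝ := E / (6 * K) with hθ
  have hθ0 : 0 < θ := by positivity
  set A : Finset G := univ.filter (fun x => θ ≤ f x) with hA
  have hmem : ∀ x, x ∈ A ↔ θ ≤ f x := fun x => by simp [hA]
  have hAs : A⁻¹ = A := by
    ext x
    rw [mem_inv', hmem, hmem, hfs]
  have hAc : (A.card : ℝ) ≤ 6 * K / E := by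
    have : (A.card : ℝ) * θ ≤ 1 := by
      calc (A.card : ℝ) * θ = ∑ x ∈ A, θ := by simp
        _ ≤ ∑ x ∈ A, f x := sum_le_sum fun x hx => (hmem x).1 hx
        _ ≤ ∑ x, f x := sum_le_sum_of_subset_of_nonneg (subset_univ _) fun x _ _ => hf0 x
        _ = 1 := hf1
    rw [← le_div_iff₀ hθ0] at this
    refine this.trans (le_of_eq ?_)
    rw [hθ]; field_simp
  set P := ((A ×ˢ A).filter (fun q => q.1 * q.2 ∈ A)) with hP
  have key : E / (2 * K) ≤ E ^ 3 * (P.card : ℝ) := by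
    have hpt : ∀ x y, f x * f y * f (x * y) ≤ (if (x, y) ∈ P then E ^ 3 else 0)
        + (θ * (f y * f (x * y)) + θ * (f x * f (x * y)) + θ * (f x * f y)) := by
      intro x y
      have a1 := hf0 x
      have a2 := hf0 y
      have a3 := hf0 (x * y)
      have b1 := mul_nonneg a1 a2
      have b2 := mul_nonneg a1 a3
      have b3 := mul_nonneg a2 a3
      have c1 := mul_nonneg hθ0.le b1
      have c2 := mul_nonneg hθ0.le b2
      have c3 := mul_nonneg hθ0.le b3
      split_ifs with h
      · have : f x * f y * f (x * y) ≤ E * E * E := by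
          gcongr
          · exact hfE x
          · exact hfE y
          · exact hfE _
        nlinarith
      · simp only [hP, mem_filter, mem_product, hmem, not_and_or, not_le] at h
        rcases h with (h | h) | h
        · nlinarith
        · nlinarith
        · nlinarith
    have hs := sum_le_sum (s := univ) fun x _ => sum_le_sum (s := univ) fun y _ => hpt x y
    have e0 : ∑ x : G, ∑ y : G, (if (x, y) ∈ P then E ^ 3 else 0) = E ^ 3 * (P.card : ℝ) := by
      rw [← sum_product' (f := fun x y => if (x, y) ∈ P then E ^ 3 else 0)]
      simp [mul_comm]
    have tr1 : ∀ x, ∑ y, f (x * y) = 1 := fun x => by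
      rw [← hf1]; exact Fintype.sum_equiv (Equiv.mulLeft x) _ _ (fun _ => rfl)
    have tr2 : ∀ y, ∑ x, f (x * y) = 1 := fun y => by
      rw [← hf1]; exact Fintype.sum_equiv (Equiv.mulRight y) _ _ (fun _ => rfl)
    have e1 : ∑ x : G, ∑ y : G, θ * (f y * f (x * y)) = θ := by
      rw [sum_comm]
      simp_rw [← mul_sum, tr2, mul_one, hf1, mul_one]
    have e2 : ∑ x : G, ∑ y : G, θ * (f x * f (x * y)) = θ := by
      simp_rw [← mul_sum, tr1, mul_one, hf1, mul_one]
    have e3 : ∑ x : G, ∑ y : G, θ * (f x * f y) = θ := by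
      simp_rw [← mul_sum, hf1, mul_one, hf1, mul_one]
    simp_rw [sum_add_distrib] at hs
    rw [e0, e1, e2, e3] at hs
    have : θ + θ + θ = E / (2 * K) := by rw [hθ]; field_simp; norm_num
    have h2 : E / K = E / (2 * K) + E / (2 * K) := by field_simp; norm_num
    linarith
  have key2 : 1 / (2 * K * E ^ 2) ≤ (P.card : ℝ) := by
    rw [div_le_iff₀ (by positivity)]
    rw [div_le_iff₀ (by positivity)] at key
    have : E * 1 ≤ E * ((P.card : ℝ) * (2 * K * E ^ 2)) := by linarith
    exact le_of_mul_le_mul_left this hE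
  have hPA : (P.card : ℝ) ≤ (A.card : ℝ) ^ 2 := by
    have := card_filter_le (A ×ˢ A) (fun q => q.1 * q.2 ∈ A)
    rw [card_product, ← sq] at this
    exact_mod_cast this
  refine ⟨A, hAs, fun x hx => (hmem x).1 hx, hAc, ?_, ?_⟩
  · refine le_of_sq_le_sq ?_ (by positivity)
    refine le_trans ?_ (key2.trans hPA)
    rw [div_pow, one_pow, mul_pow]
    gcongr
    nlinarith
  · have hbij : ((A ×ˢ A).filter (fun q => q.1⁻¹ * q.2 ∈ A)).card = P.card := by
      refine card_bij' (fun q _ => (q.1⁻¹, q.2)) (fun q _ => (q.1⁻¹, q.2)) ?_ ?_ ?_ ?_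
      · rintro ⟨a, b⟩ h
        simp only [mem_filter, mem_product, hP] at h ⊢
        refine ⟨⟨?_, h.1.2⟩, h.2⟩
        rw [← hAs, mem_inv', inv_inv]; exact h.1.1
      · rintro ⟨a, b⟩ h
        simp only [mem_filter, mem_product, hP, inv_inv] at h ⊢
        refine ⟨⟨?_, h.1.2⟩, h.2⟩
        rw [← hAs, mem_inv', inv_inv]; exact h.1.1
      · intro a _; simp
      · intro a _; simp
    rw [hbij]
    refine le_trans ?_ key2
    calc (A.card : ℝ) ^ 2 / (72 * K ^ 3) ≤ (6 * K / E) ^ 2 / (72 * K ^ 3) := by gcongr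
      _ = _ := by field_simp; norm_num

/-- Balog-Szemerédi-Gowers in a group. -/
lemma bsg_group (A : Finset G) (hAs : A⁻¹ = A) (hA : A.Nonempty) (K : ℝ) (hK : 1 ≤ K)
    (hE : (A.card : ℝ) ^ 2 / K ≤ (((A ×ˢ A).filter (fun q => q.1⁻¹ * q.2 ∈ A)).card : ℝ)) :
    ∃ X ⊆ A, (A.card : ℝ) / (4 * K) ≤ X.card ∧
      ((X⁻¹ * X).card : ℝ) ≤ 1024 * K ^ 5 * A.card := by
  classical
  obtain ⟨X, hXA, hXc, hX⟩ := bsg_graph A (fun x y => x⁻¹ * y ∈ A) K hK hA hE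
  refine ⟨X, hXA, hXc, ?_⟩
  have hinv : ∀ a, a ∈ A → a⁻¹ ∈ A := fun a ha => by rw [← hAs, mem_inv', inv_inv]; exact ha
  set Q := A ×ˢ A ×ˢ A ×ˢ A with hQ
  set pr : G × G × G × G → G := fun q => q.1 * q.2.1 * q.2.2.1 * q.2.2.2 with hpr
  have hn0 : (0 : ℝ) < A.card := by simpa using hA
  have hfib : ∀ w ∈ X⁻¹ * X, (A.card : ℝ) ^ 3 / (1024 * K ^ 5) ≤
      ((Q.filter (fun q => pr q = w)).card : ℝ) := by
    intro w hw
    obtain ⟨a, ha, x', hx', rfl⟩ := mem_mul.1 hw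
    rw [mem_inv'] at ha
    obtain ⟨x, rfl⟩ : ∃ x, a = x⁻¹ := ⟨a⁻¹, by simp⟩
    rw [inv_inv] at ha
    refine (hX x ha x' hx').trans (Nat.cast_le.2 ?_)
    refine card_le_card_of_injOn
      (fun q => (x⁻¹ * q.1, q.1⁻¹ * q.2.1, q.2.1⁻¹ * q.2.2, q.2.2⁻¹ * x')) ?_ ?_
    · rintro ⟨a, b, c⟩ h
      simp only [coe_filter, Set.mem_ofPred_eq, mem_product, hQ, hpr] at h ⊢
      refine ⟨⟨h.2.1, ?_, h.2.2.2.1, ?_⟩, by group⟩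
      · have := hinv _ h.2.2.1; simpa using this
      · have := hinv _ h.2.2.2.2; simpa using this
    · rintro ⟨a, b, c⟩ _ ⟨a', b', c'⟩ _ h
      simp only [Prod.mk.injEq, mul_right_inj, mul_left_inj, inv_inj] at h
      obtain ⟨rfl, h2, h3, rfl⟩ := h
      simp only [mul_right_inj] at h2
      rw [h2]
  have hsum : ((X⁻¹ * X).card : ℝ) * ((A.card : ℝ) ^ 3 / (1024 * K ^ 5)) ≤ (A.card : ℝ) ^ 4 := by
    calc ((X⁻¹ * X).card : ℝ) * ((A.card : ℝ) ^ 3 / (1024 * K ^ 5))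
        = ∑ w ∈ X⁻¹ * X, ((A.card : ℝ) ^ 3 / (1024 * K ^ 5)) := by simp
      _ ≤ ∑ w ∈ X⁻¹ * X, ((Q.filter (fun q => pr q = w)).card : ℝ) := sum_le_sum hfib
      _ ≤ ∑ w, ((Q.filter (fun q => pr q = w)).card : ℝ) :=
          sum_le_sum_of_subset_of_nonneg (subset_univ _) fun _ _ _ => by positivity
      _ = (Q.card : ℝ) := by
          rw [card_eq_sum_card_fiberwise (f := pr) (t := univ) (fun _ _ => by simp)]
          push_cast; rfl
      _ = (A.card : ℝ) ^ 4 := by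
          simp only [hQ, card_product]; push_cast; ring
  rw [← le_div_iff₀ (by positivity)] at hsum
  refine hsum.trans (le_of_eq ?_)
  field_simp

set_option maxHeartbeats 400000 in
/-- From small `X⁻¹ X` to an approximate group. -/
lemma approx_of_doubling (X : Finset G) (hX : X.Nonempty) (K : ℝ) (hK : 1 ≤ K)
    (hd : ((X⁻¹ * X).card : ℝ) ≤ K * X.card) :
    ∃ H : Finset G, 1 ∈ H ∧ H⁻¹ = H ∧ (X.card : ℝ) / (2 * K) ≤ H.card ∧
      (H.card : ℝ) ≤ 2 * K * X.card ∧
      ((H ^ 3).card : ℝ) ≤ 8 * K ^ 7 * X.card ∧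
      ∃ d : G, (X.card : ℝ) / (2 * K) ≤ ((X.filter (fun x => x * d ∈ H)).card : ℝ) := by
  classical
  have hK0 : 0 < K := by linarith
  set n : ℝ := (X.card : ℝ) with hn
  have hn0 : 0 < n := by simpa [hn] using hX
  -- representation sets
  set r : G → Finset G := fun g => X.filter (fun c => g⁻¹ * c ∈ X) with hr
  have hrn : ∀ g, ((r g).card : ℝ) ≤ n := fun g => by
    rw [hn]; exact_mod_cast card_filter_le _ _
  set H : Finset G := univ.filter (fun g => n / (2 * K) ≤ ((r g).card : ℝ)) with hH
  have hmem : ∀ g, g ∈ H ↔ n / (2 * K) ≤ ((r g).card : ℝ) := fun g => by simp [hH]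
  have hrinv : ∀ g, (r g⁻¹).card = (r g).card := by
    intro g
    refine card_bij' (fun c _ => g * c) (fun c _ => g⁻¹ * c) ?_ ?_ ?_ ?_
    · intro c hc; simp only [hr, mem_filter, inv_inv] at hc ⊢; simpa using hc.symm
    · intro c hc; simp only [hr, mem_filter, inv_inv] at hc ⊢; simpa using hc.symm
    · intro c _; simp
    · intro c _; simp
  -- sum of r
  have hsumr : ∑ g, ((r g).card : ℝ) = n ^ 2 := by
    have h1 : ∀ g, ((r g).card : ℝ) = ∑ c ∈ X, (if g⁻¹ * c ∈ X then (1 : ℝ) else 0) := by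
      intro g; simp [hr]
    simp_rw [h1]
    rw [sum_comm]
    have h2 : ∀ c ∈ X, ∑ g : G, (if g⁻¹ * c ∈ X then (1 : ℝ) else 0) = n := by
      intro c _
      have : ∑ g : G, (if g⁻¹ * c ∈ X then (1 : ℝ) else 0)
          = ∑ g : G, (if g ∈ X then (1 : ℝ) else 0) := by
        refine Fintype.sum_equiv ((Equiv.inv G).trans (Equiv.mulRight c)) _ _ (fun g => ?_)
        simp
      rw [this]; simp [hn]
    rw [sum_congr rfl h2]; simp [hn, sq]
  -- energy
  have hen : n ^ 3 / K ≤ ∑ g, ((r g).card : ℝ) ^ 2 := by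
    -- r' for X⁻¹ X
    set r' : G → Finset (G × G) := fun g => (X ×ˢ X).filter (fun q => q.1⁻¹ * q.2 = g) with hr'
    have h1 : ∑ g ∈ X⁻¹ * X, ((r' g).card : ℝ) = n ^ 2 := by
      have := card_eq_sum_card_fiberwise (f := fun q : G × G => q.1⁻¹ * q.2) (s := X ×ˢ X)
        (t := X⁻¹ * X) (fun q hq => by
          simp only [coe_product, Set.mem_prod, mem_coe] at hq
          exact mem_coe.2 (mul_mem_mul (inv_mem_inv hq.1) hq.2))
      rw [card_product] at this
      rw [hn, sq]
      exact_mod_cast this.symm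
    have h2 : (n ^ 2) ^ 2 ≤ (K * n) * ∑ g ∈ X⁻¹ * X, ((r' g).card : ℝ) ^ 2 := by
      rw [← h1]
      refine (sq_sum_le_card_mul_sum_sq (s := X⁻¹ * X) (f := fun g => ((r' g).card : ℝ))).trans ?_
      exact mul_le_mul_of_nonneg_right hd (sum_nonneg fun _ _ => sq_nonneg _)
    have h3 : ∑ g ∈ X⁻¹ * X, ((r' g).card : ℝ) ^ 2 ≤ ∑ g, ((r g).card : ℝ) ^ 2 := by
      refine (sum_le_sum_of_subset_of_nonneg (subset_univ _)
        fun _ _ _ => by positivity).trans (le_of_eq ?_)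
      -- both count quadruples
      have q1 : ∑ g, ((r' g).card : ℝ) ^ 2 =
          (((((X ×ˢ X) ×ˢ (X ×ˢ X)).filter
            (fun q => q.1.1⁻¹ * q.1.2 = q.2.1⁻¹ * q.2.2)).card : ℕ) : ℝ) := by
        rw [card_eq_sum_card_fiberwise (f := fun q : (G × G) × (G × G) => q.1.1⁻¹ * q.1.2)
          (t := univ) (fun _ _ => by simp)]
        push_cast
        refine sum_congr rfl fun g _ => ?_
        rw [sq, ← Nat.cast_mul, ← card_product]
        congr 2
        ext ⟨⟨a, b⟩, c, d⟩
        simp only [hr', mem_product, mem_filter]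
        constructor
        · rintro ⟨⟨h1, h2⟩, h3, h4⟩; exact ⟨⟨⟨h1, h3⟩, by rw [h2, h4]⟩, h2⟩
        · rintro ⟨⟨⟨h1, h3⟩, h5⟩, h2⟩; exact ⟨⟨h1, h2⟩, h3, by rw [← h5, h2]⟩
      have q2 : ∑ g, ((r g).card : ℝ) ^ 2 =
          (((((X ×ˢ X) ×ˢ (X ×ˢ X)).filter
            (fun q => q.1.1 * q.1.2⁻¹ = q.2.1 * q.2.2⁻¹)).card : ℕ) : ℝ) := by
        rw [card_eq_sum_card_fiberwise (f := fun q : (G × G) × (G × G) => q.1.1 * q.1.2⁻¹)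
          (t := univ) (fun _ _ => by simp)]
        push_cast
        refine sum_congr rfl fun g _ => ?_
        rw [sq, ← Nat.cast_mul, ← card_product]
        congr 1
        refine card_bij' (fun q _ => ((q.1, g⁻¹ * q.1), (q.2, g⁻¹ * q.2)))
          (fun q _ => (q.1.1, q.2.1)) ?_ ?_ ?_ ?_
        · rintro ⟨a, b⟩ h
          simp only [hr, mem_product, mem_filter] at h ⊢
          refine ⟨⟨h, by group⟩, by group⟩
        · rintro ⟨⟨a, b⟩, c, d⟩ h
          simp only [hr, mem_product, mem_filter] at h ⊢
          obtain ⟨⟨⟨h1, h2⟩, h3⟩, h4⟩ := h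
          have e1 : g⁻¹ * a = b := by rw [← h4]; group
          have e2 : g⁻¹ * c = d := by rw [← h4, h3]; group
          rw [e1, e2]; tauto
        · rintro ⟨a, b⟩ h; rfl
        · rintro ⟨⟨a, b⟩, c, d⟩ h
          simp only [mem_product, mem_filter] at h ⊢
          obtain ⟨⟨⟨h1, h2⟩, h3⟩, h4⟩ := h
          have e1 : g⁻¹ * a = b := by rw [← h4]; group
          have e2 : g⁻¹ * c = d := by rw [← h4, h3]; group
          rw [e1, e2]
      rw [q1, q2]
      congr 1
      -- (a,b),(c,d) : a⁻¹ b = c⁻¹ d  ↔ c a⁻¹ = d b⁻¹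
      refine card_bij' (fun q _ => ((q.2.1, q.1.1), (q.2.2, q.1.2)))
        (fun q _ => ((q.1.2, q.2.2), (q.1.1, q.2.1))) ?_ ?_ (fun _ _ => rfl) (fun _ _ => rfl)
      · rintro ⟨⟨a, b⟩, c, d⟩ h
        simp only [mem_product, mem_filter] at h ⊢
        refine ⟨by tauto, ?_⟩
        have : b = a * (c⁻¹ * d) := by rw [← h.2]; group
        rw [this]; group
      · rintro ⟨⟨a, b⟩, c, d⟩ h
        simp only [mem_product, mem_filter] at h ⊢
        refine ⟨by tauto, ?_⟩
        have : a = c * d⁻¹ * b := by rw [← h.2]; group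
        rw [this]; group
    have h4 : (n ^ 2) ^ 2 ≤ (K * n) * ∑ g, ((r g).card : ℝ) ^ 2 := by
      exact h2.trans (mul_le_mul_of_nonneg_left h3 (mul_nonneg hK0.le hn0.le))
    rw [div_le_iff₀ hK0]
    have : n * n ^ 3 ≤ n * ((∑ g, ((r g).card : ℝ) ^ 2) * K) := by linarith
    exact le_of_mul_le_mul_left this hn0
  have hHsum : n ^ 2 / (2 * K) ≤ ∑ g ∈ H, ((r g).card : ℝ) := by
    have hsplit : ∑ g, ((r g).card : ℝ) ^ 2 ≤ n * ∑ g ∈ H, ((r g).card : ℝ)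
        + n / (2 * K) * ∑ g, ((r g).card : ℝ) := by
      rw [mul_sum, mul_sum, ← sum_filter_add_sum_filter_not univ (fun g => g ∈ H)]
      refine add_le_add ?_ ?_
      · rw [filter_mem_eq_inter, univ_inter]
        refine sum_le_sum fun g _ => ?_
        rw [sq]
        exact mul_le_mul_of_nonneg_right (hrn g) (by positivity)
      · refine (sum_le_sum fun g hg => ?_).trans
          (sum_le_sum_of_subset_of_nonneg (filter_subset (fun g => g ∉ H) univ)
            fun g _ _ => by positivity)
        rw [sq]
        have := (mem_filter.1 hg).2
        rw [hmem, not_le] at this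
        exact mul_le_mul_of_nonneg_right this.le (by positivity)
    rw [hsumr] at hsplit
    have e1 : n ^ 3 / K = n * (n ^ 2 / (2 * K)) + n / (2 * K) * n ^ 2 := by field_simp; norm_num
    have : n * (n ^ 2 / (2 * K)) ≤ n * ∑ g ∈ H, ((r g).card : ℝ) := by linarith
    exact le_of_mul_le_mul_left this hn0
  refine ⟨H, ?_, ?_, ?_, ?_, ?_, ?_⟩
  · rw [hmem]
    have : r 1 = X := by ext c; simp [hr]
    rw [this, ← hn]
    exact div_le_self hn0.le (by linarith)
  · ext g
    rw [mem_inv', hmem, hmem, hrinv]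
  · have h1 : ∑ g ∈ H, ((r g).card : ℝ) ≤ (H.card : ℝ) * n := by
      calc _ ≤ ∑ g ∈ H, n := sum_le_sum fun g _ => hrn g
        _ = _ := by simp
    have h2 := hHsum.trans h1
    have : n * (n / (2 * K)) ≤ n * H.card := by
      calc n * (n / (2 * K)) = n ^ 2 / (2 * K) := by ring
        _ ≤ _ := by linarith
    exact le_of_mul_le_mul_left this hn0
  · have h1 : (H.card : ℝ) * (n / (2 * K)) ≤ n ^ 2 := by
      rw [← hsumr]
      calc (H.card : ℝ) * (n / (2 * K)) = ∑ g ∈ H, n / (2 * K) := by simp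
        _ ≤ ∑ g ∈ H, ((r g).card : ℝ) := sum_le_sum fun g hg => (hmem g).1 hg
        _ ≤ _ := sum_le_sum_of_subset_of_nonneg (subset_univ _) fun _ _ _ => by positivity
    rw [← le_div_iff₀ (by positivity)] at h1
    refine h1.trans (le_of_eq ?_)
    field_simp
  · -- tripling
    obtain ⟨x₀, hx₀⟩ := hX
    set W := X⁻¹ * X with hW
    set Q := W ×ˢ W ×ˢ W ×ˢ W with hQ
    set pr : G × G × G × G → G := fun q => x₀ * (q.1 * q.2.1 * q.2.2.1 * q.2.2.2) * x₀⁻¹ with hpr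
    have hwm : ∀ a ∈ X, ∀ b ∈ X, a⁻¹ * b ∈ W := fun a ha b hb =>
      mul_mem_mul (inv_mem_inv ha) hb
    have hfib : ∀ g ∈ H ^ 3, (n / (2 * K)) ^ 3 ≤ ((Q.filter (fun q => pr q = g)).card : ℝ) := by
      intro g hg
      rw [pow_succ, pow_two] at hg
      obtain ⟨ab, hab, h3, hh3, rfl⟩ := mem_mul.1 hg
      obtain ⟨h1, hh1, h2, hh2, rfl⟩ := mem_mul.1 hab
      have hle : ((r h1 ×ˢ r h2 ×ˢ r h3).card : ℝ) ≤
          ((Q.filter (fun q => pr q = h1 * h2 * h3)).card : ℝ) := by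
        refine Nat.cast_le.2 (card_le_card_of_injOn (fun c => (x₀⁻¹ * c.1,
          (h1⁻¹ * c.1)⁻¹ * c.2.1, (h2⁻¹ * c.2.1)⁻¹ * c.2.2, (h3⁻¹ * c.2.2)⁻¹ * x₀)) ?_ ?_)
        · rintro ⟨a, b, c⟩ h
          simp only [coe_product, Set.mem_prod, mem_coe, hr, mem_filter] at h
          simp only [coe_filter, Set.mem_ofPred_eq, mem_product, hQ, hpr]
          refine ⟨⟨hwm _ hx₀ _ h.1.1, hwm _ h.1.2 _ h.2.1.1, hwm _ h.2.1.2 _ h.2.2.1,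
            hwm _ h.2.2.2 _ hx₀⟩, by group⟩
        · rintro ⟨a, b, c⟩ _ ⟨a', b', c'⟩ _ h
          simp only [Prod.mk.injEq, mul_right_inj, mul_left_inj, inv_inj] at h
          obtain ⟨rfl, h2, h3, rfl⟩ := h
          simp only [mul_right_inj] at h2
          rw [h2]
      refine le_trans ?_ hle
      rw [card_product, card_product]
      push_cast
      calc (n / (2 * K)) ^ 3 = (n / (2 * K)) * ((n / (2 * K)) * (n / (2 * K))) := by ring
        _ ≤ _ := by
          gcongr
          · exact (hmem _).1 hh1
          · exact (hmem _).1 hh2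
          · exact (hmem _).1 hh3
    have hsum : ((H ^ 3).card : ℝ) * (n / (2 * K)) ^ 3 ≤ (K * n) ^ 4 := by
      calc ((H ^ 3).card : ℝ) * (n / (2 * K)) ^ 3
          = ∑ w ∈ H ^ 3, (n / (2 * K)) ^ 3 := by simp
        _ ≤ ∑ w ∈ H ^ 3, ((Q.filter (fun q => pr q = w)).card : ℝ) := sum_le_sum hfib
        _ ≤ ∑ w, ((Q.filter (fun q => pr q = w)).card : ℝ) :=
            sum_le_sum_of_subset_of_nonneg (subset_univ _) fun _ _ _ => by positivity
        _ = (Q.card : ℝ) := by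
            rw [card_eq_sum_card_fiberwise (f := pr) (t := univ) (fun _ _ => by simp)]
            push_cast; rfl
        _ = (W.card : ℝ) ^ 4 := by
            simp only [hQ, card_product]; push_cast; ring
        _ ≤ (K * n) ^ 4 := by gcongr
    rw [← le_div_iff₀ (by positivity)] at hsum
    refine hsum.trans (le_of_eq ?_)
    field_simp
    norm_num
  · -- a good translate
    have hcomm : ∑ g ∈ H, ((r g).card : ℝ) =
        ∑ e ∈ X, ((X.filter (fun x => x * e⁻¹ ∈ H)).card : ℝ) := by
      have h1 : ∀ g ∈ H, ((r g).card : ℝ) = ∑ e ∈ X, (if g * e ∈ X then (1 : ℝ) else 0) := by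
        intro g _
        rw [← hrinv]
        simp [hr]
      rw [sum_congr rfl h1, sum_comm]
      refine sum_congr rfl fun e _ => ?_
      rw [← sum_filter, sum_const, nsmul_eq_mul, mul_one]
      congr 1
      refine card_bij' (fun g _ => g * e) (fun x _ => x * e⁻¹) ?_ ?_ ?_ ?_
      · intro g hg; simp only [mem_filter] at hg ⊢; simpa using hg.symm
      · intro g hg; simp only [mem_filter] at hg ⊢; simpa using hg.symm
      · intro g _; simp
      · intro g _; simp
    by_contra hcon
    push Not at hcon
    have h2 : ∑ e ∈ X, ((X.filter (fun x => x * e⁻¹ ∈ H)).card : ℝ) < ∑ e ∈ X, n / (2 * K) :=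
      sum_lt_sum_of_nonempty hX fun e _ => hcon e⁻¹
    rw [← hcomm, sum_const, nsmul_eq_mul, ← hn] at h2
    have : n * (n / (2 * K)) = n ^ 2 / (2 * K) := by ring
    linarith

end

end BG


namespace BG

open Finset Pointwise

section walk
variable {ι G : Type*} [Group G]

/-- The averaging operator. -/
noncomputable def avg (S : Finset ι) (σ : ι → G) : Module.End ℝ (G → ℝ) where
  toFun f := fun x => (∑ s ∈ S, f (x * σ s)) / (S.card : ℝ)
  map_add' f g := by
    funext x
    simp [sum_add_distrib, add_div]
  map_smul' c f := by
    funext x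
    simp [← mul_sum, mul_div_assoc]

lemma avg_apply (S : Finset ι) (σ : ι → G) (f : G → ℝ) (x : G) :
    avg S σ f x = (∑ s ∈ S, f (x * σ s)) / (S.card : ℝ) := rfl

lemma avg_pow_succ (S : Finset ι) (σ : ι → G) (n : ℕ) (f : G → ℝ) :
    (avg S σ ^ (n + 1)) f = avg S σ ((avg S σ ^ n) f) := by
  rw [pow_succ']; rfl

lemma avg_mono (S : Finset ι) (σ : ι → G) {f g : G → ℝ} (h : ∀ x, f x ≤ g x) (x : G) :
    avg S σ f x ≤ avg S σ g x := by
  rw [avg_apply, avg_apply]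
  gcongr
  exact h _

lemma avg_pow_mono (S : Finset ι) (σ : ι → G) (n : ℕ) {f g : G → ℝ} (h : ∀ x, f x ≤ g x) (x : G) :
    (avg S σ ^ n) f x ≤ (avg S σ ^ n) g x := by
  induction n generalizing x with
  | zero => simpa using h x
  | succ n ih =>
    rw [avg_pow_succ, avg_pow_succ]
    exact avg_mono S σ ih x

lemma avg_pow_nonneg (S : Finset ι) (σ : ι → G) (n : ℕ) {f : G → ℝ} (h : ∀ x, 0 ≤ f x) (x : G) :
    0 ≤ (avg S σ ^ n) f x := by
  have := avg_pow_mono S σ n (f := 0) (g := f) h x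
  simpa using this

lemma avg_pow_map {G' : Type*} [Group G'] (φ : G →* G') (S : Finset ι) (σ : ι → G) (n : ℕ)
    (f : G' → ℝ) (x : G) :
    (avg S σ ^ n) (fun y => f (φ y)) x = (avg S (fun s => φ (σ s)) ^ n) f (φ x) := by
  induction n generalizing x with
  | zero => simp
  | succ n ih =>
    rw [avg_pow_succ, avg_pow_succ, avg_apply, avg_apply]
    congr 1
    refine sum_congr rfl fun s _ => ?_
    rw [ih, map_mul]

lemma avg_pow_left (S : Finset ι) (σ : ι → G) (n : ℕ) (f : G → ℝ) (g x : G) :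
    (avg S σ ^ n) (fun y => f (g * y)) x = (avg S σ ^ n) f (g * x) := by
  induction n generalizing x with
  | zero => simp
  | succ n ih =>
    rw [avg_pow_succ, avg_pow_succ, avg_apply, avg_apply]
    congr 1
    refine sum_congr rfl fun s _ => ?_
    rw [ih, mul_assoc]

lemma avg_pow_const (S : Finset ι) (hS : S.Nonempty) (σ : ι → G) (n : ℕ) (c : ℝ) (x : G) :
    (avg S σ ^ n) (fun _ => c) x = c := by
  induction n generalizing x with
  | zero => simp
  | succ n ih =>
    rw [avg_pow_succ, avg_apply]
    have : (0 : ℝ) < S.card := by exact_mod_cast hS.card_pos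
    simp_rw [ih]
    simp
    field_simp

end walk

section fin
variable {ι G : Type*} [Group G] [Fintype G] [DecidableEq G]

/-- Distribution of the walk at time `n`. -/
noncomputable def wk (S : Finset ι) (σ : ι → G) (n : ℕ) (x : G) : ℝ :=
  (avg S σ ^ n) (Pi.single x 1) 1

variable (S : Finset ι) (σ : ι → G)

lemma avg_pow_eq_one (n : ℕ) (f : G → ℝ) : (avg S σ ^ n) f 1 = ∑ x, wk S σ n x * f x := by
  have : f = ∑ x, f x • (Pi.single x 1 : G → ℝ) := by
    funext y
    simp [Finset.sum_apply, Pi.single_apply]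
  conv_lhs => rw [this]
  rw [map_sum, Finset.sum_apply]
  refine sum_congr rfl fun x _ => ?_
  rw [map_smul]
  simp [wk, mul_comm]

lemma avg_pow_eq (n : ℕ) (f : G → ℝ) (g : G) :
    (avg S σ ^ n) f g = ∑ x, wk S σ n x * f (g * x) := by
  have := avg_pow_left S σ n f g 1
  rw [mul_one] at this
  rw [← this, avg_pow_eq_one]

lemma single_mul_left (x g : G) : (fun y => (Pi.single x 1 : G → ℝ) (g * y)) =
    (Pi.single (g⁻¹ * x) 1 : G → ℝ) := by
  funext y
  simp only [Pi.single_apply, eq_inv_mul_iff_mul_eq]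

lemma avg_pow_single (n : ℕ) (x g : G) :
    (avg S σ ^ n) (Pi.single x 1) g = wk S σ n (g⁻¹ * x) := by
  have := avg_pow_left S σ n (Pi.single x 1) g 1
  rw [mul_one, single_mul_left] at this
  rw [← this]; rfl

lemma wk_add (a b : ℕ) (x : G) :
    wk S σ (a + b) x = ∑ y, wk S σ a y * wk S σ b (y⁻¹ * x) := by
  rw [wk, pow_add, Module.End.mul_apply, avg_pow_eq_one]
  exact sum_congr rfl fun y _ => by rw [avg_pow_single]

lemma wk_nonneg (n : ℕ) (x : G) : 0 ≤ wk S σ n x :=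
  avg_pow_nonneg S σ n (fun y => by by_cases h : y = x <;> simp [Pi.single_apply, h]) 1

lemma wk_sum (hS : S.Nonempty) (n : ℕ) : ∑ x, wk S σ n x = 1 := by
  have h := avg_pow_eq_one S σ n (fun _ => 1)
  rw [avg_pow_const S hS] at h
  simpa using h.symm

lemma avg_symm (hsym : ∀ f : G → ℝ, ∑ s ∈ S, f (σ s) = ∑ s ∈ S, f (σ s)⁻¹) (f g : G → ℝ) :
    ∑ x, avg S σ f x * g x = ∑ x, f x * avg S σ g x := by
  simp only [avg_apply, div_mul_eq_mul_div, mul_div_assoc', ← sum_div, sum_mul, mul_sum]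
  congr 1
  have h1 : ∀ x, ∑ s ∈ S, f x * g (x * σ s) = ∑ s ∈ S, f x * g (x * (σ s)⁻¹) := fun x =>
    hsym (fun t => f x * g (x * t))
  simp_rw [h1]
  rw [sum_comm, sum_comm (s := univ) (t := S)]
  refine sum_congr rfl fun s _ => ?_
  refine Fintype.sum_equiv (Equiv.mulRight (σ s)) _ _ (fun x => ?_)
  simp

lemma avg_pow_symm (hsym : ∀ f : G → ℝ, ∑ s ∈ S, f (σ s) = ∑ s ∈ S, f (σ s)⁻¹) (n : ℕ)
    (f g : G → ℝ) :
    ∑ x, (avg S σ ^ n) f x * g x = ∑ x, f x * (avg S σ ^ n) g x := by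
  induction n generalizing g with
  | zero => simp
  | succ n ih =>
    rw [avg_pow_succ, avg_symm S σ hsym, ih, pow_succ]; rfl

lemma wk_inv (hsym : ∀ f : G → ℝ, ∑ s ∈ S, f (σ s) = ∑ s ∈ S, f (σ s)⁻¹) (n : ℕ) (x : G) :
    wk S σ n x⁻¹ = wk S σ n x := by
  have h := avg_pow_symm S σ hsym n (Pi.single x 1) (Pi.single 1 1)
  simp only [Pi.single_apply, mul_ite, mul_one, mul_zero, ite_mul, one_mul, zero_mul,
    sum_ite_eq', mem_univ, if_true] at h
  have e : (fun i => if i = x then (1 : ℝ) else 0) = Pi.single x 1 := by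
    funext i; simp [Pi.single_apply]
  have h1 := avg_pow_single S σ n x 1
  have h2 := avg_pow_single S σ n 1 x
  rw [inv_one, one_mul] at h1
  rw [mul_one] at h2
  rw [← h1, ← h2]
  exact h.symm


lemma wk_two (hsym : ∀ f : G → ℝ, ∑ s ∈ S, f (σ s) = ∑ s ∈ S, f (σ s)⁻¹)
    (n : ℕ) : wk S σ (2 * n) 1 = ∑ y, wk S σ n y ^ 2 := by
  rw [two_mul, wk_add]
  refine sum_congr rfl fun y _ => ?_
  rw [mul_one, wk_inv S σ hsym, sq]

lemma wk_le (hsym : ∀ f : G → ℝ, ∑ s ∈ S, f (σ s) = ∑ s ∈ S, f (σ s)⁻¹)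
    (n : ℕ) (x : G) : wk S σ (2 * n) x ≤ wk S σ (2 * n) 1 := by
  rw [wk_two S σ hsym, two_mul, wk_add]
  have h : ∀ y, wk S σ n y * wk S σ n (y⁻¹ * x) ≤
      (wk S σ n y ^ 2 + wk S σ n (y⁻¹ * x) ^ 2) / 2 := fun y => by
    nlinarith [sq_nonneg (wk S σ n y - wk S σ n (y⁻¹ * x))]
  refine (sum_le_sum fun y _ => h y).trans ?_
  rw [← sum_div, sum_add_distrib]
  have : ∑ y, wk S σ n (y⁻¹ * x) ^ 2 = ∑ y, wk S σ n y ^ 2 :=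
    Fintype.sum_equiv ((Equiv.inv G).trans (Equiv.mulRight x)) _ _ (fun y => by simp)
  rw [this]; linarith

lemma wk_anti (hsym : ∀ f : G → ℝ, ∑ s ∈ S, f (σ s) = ∑ s ∈ S, f (σ s)⁻¹)
    (hS : S.Nonempty) (a b : ℕ) : wk S σ (2 * (a + b)) 1 ≤ wk S σ (2 * a) 1 := by
  rw [mul_add, add_comm, wk_add]
  calc _ ≤ ∑ y, wk S σ (2 * b) y * wk S σ (2 * a) 1 :=
        sum_le_sum fun y _ => mul_le_mul_of_nonneg_left (wk_le S σ hsym _ _) (wk_nonneg _ _ _ _)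
    _ = _ := by rw [← sum_mul, wk_sum S σ hS, one_mul]

lemma wk_pos (hsym : ∀ f : G → ℝ, ∑ s ∈ S, f (σ s) = ∑ s ∈ S, f (σ s)⁻¹)
    (hS : S.Nonempty) (n : ℕ) : 0 < wk S σ (2 * n) 1 := by
  rw [wk_two S σ hsym]
  by_contra hcon
  have h0 : ∑ y, wk S σ n y ^ 2 = 0 :=
    le_antisymm (not_lt.1 hcon) (sum_nonneg fun _ _ => sq_nonneg _)
  rw [sum_eq_zero_iff_of_nonneg (fun _ _ => sq_nonneg _)] at h0
  have h1 := wk_sum S σ hS n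
  rw [sum_eq_zero fun y hy => by simpa using h0 y hy] at h1
  norm_num at h1

lemma wk_six (hsym : ∀ f : G → ℝ, ∑ s ∈ S, f (σ s) = ∑ s ∈ S, f (σ s)⁻¹)
    (m : ℕ) : wk S σ (6 * m) 1 =
    ∑ x, ∑ y, wk S σ (2 * m) x * wk S σ (2 * m) y * wk S σ (2 * m) (x * y) := by
  have e : 6 * m = 2 * m + (2 * m + 2 * m) := by ring
  rw [e, wk_add]
  refine sum_congr rfl fun x _ => ?_
  rw [wk_add, mul_sum]
  refine sum_congr rfl fun y _ => ?_
  rw [mul_one, ← wk_inv S σ hsym (2 * m) (x * y), mul_inv_rev, mul_assoc]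

/-- Failure of flattening produces an approximate subgroup. -/
theorem walk_approx (hsym : ∀ f : G → ℝ, ∑ s ∈ S, f (σ s) = ∑ s ∈ S, f (σ s)⁻¹)
    (hS : S.Nonempty) (m : ℕ) (K : ℝ) (hK : 4096 ≤ K)
    (hT : wk S σ (2 * m) 1 / K ≤ wk S σ (2 * (4 * m)) 1) :
    ∃ H : Finset G, 1 ∈ H ∧ H⁻¹ = H ∧
      ((H ^ 38).card : ℝ) ≤ K ^ 7236 * H.card ∧
      1 ≤ (H.card : ℝ) * (K ^ 32 * wk S σ (2 * m) 1) ∧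
      (H.card : ℝ) * wk S σ (2 * m) 1 ≤ K ^ 28 ∧
      ∃ d : G, ∀ H0 : Subgroup G, (H : Set G) ⊆ H0 → ∀ h : G → ℝ, (∀ x, 0 ≤ h x) →
        (∀ x, d * x ∈ H0 → 1 ≤ h x) → 1 ≤ K ^ 34 * ∑ x, wk S σ (2 * m) x * h x := by
  have hK0 : 0 < K := by linarith
  have hK1 : 1 ≤ K := by linarith
  set E := wk S σ (2 * m) 1 with hE
  have hE0 : 0 < E := wk_pos S σ hsym hS m
  have hT' : E / K ≤ ∑ x, ∑ y, wk S σ (2 * m) x * wk S σ (2 * m) y * wk S σ (2 * m) (x * y) := by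
    rw [← wk_six S σ hsym]
    refine hT.trans ?_
    have := wk_anti S σ hsym hS (3 * m) m
    rw [show 2 * (4 * m) = 2 * (3 * m + m) by ring, show 6 * m = 2 * (3 * m) by ring]
    exact this
  obtain ⟨A, hAs, hAf, hAu, hAl, hAe⟩ := level_set (wk S σ (2 * m)) E K hK1 hE0
    (wk_nonneg S σ _) (wk_sum S σ hS _) (wk_le S σ hsym m) (wk_inv S σ hsym _) hT'
  have hAne : A.Nonempty := by
    rw [← card_pos]
    have : (0 : ℝ) < A.card := lt_of_lt_of_le (by positivity) hAl
    exact_mod_cast this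
  have hA0 : (0 : ℝ) < A.card := by exact_mod_cast hAne.card_pos
  have hb1 : 72 * K ^ 3 ≤ K ^ 4 := by
    rw [pow_succ K 3, mul_comm]; gcongr; linarith
  have hAe' : (A.card : ℝ) ^ 2 / (K ^ 4) ≤
      (((A ×ˢ A).filter (fun q => q.1⁻¹ * q.2 ∈ A)).card : ℝ) := by
    refine le_trans ?_ hAe
    gcongr
  obtain ⟨X, hXA, hXc, hXd⟩ := bsg_group A hAs hAne (K ^ 4) (one_le_pow₀ hK1) hAe'
  have hX0 : (0 : ℝ) < X.card := lt_of_lt_of_le (by positivity) hXc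
  have hXne : X.Nonempty := by
    rw [← card_pos]
    exact_mod_cast hX0
  have hAX : (A.card : ℝ) ≤ 4 * K ^ 4 * X.card := by
    rw [div_le_iff₀ (by positivity)] at hXc
    linarith
  have hd : ((X⁻¹ * X).card : ℝ) ≤ K ^ 25 * X.card := by
    calc ((X⁻¹ * X).card : ℝ) ≤ 1024 * (K ^ 4) ^ 5 * A.card := hXd
      _ ≤ 1024 * (K ^ 4) ^ 5 * (4 * K ^ 4 * X.card) := by gcongr
      _ = 4096 * (K ^ 24 * X.card) := by ring
      _ ≤ K * (K ^ 24 * X.card) := by gcongr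
      _ = _ := by ring
  obtain ⟨H, h1, hHs, hHl, hHu, hH3, d, hd'⟩ :=
    approx_of_doubling X hXne (K ^ 25) (one_le_pow₀ hK1) hd
  have hXH : (X.card : ℝ) ≤ 2 * K ^ 25 * H.card := by
    rw [div_le_iff₀ (by positivity)] at hHl
    linarith
  have hAl' : 1 ≤ A.card * (2 * K * E) := by
    rwa [div_le_iff₀ (by positivity)] at hAl
  have hAu' : A.card * E ≤ 6 * K := by
    rwa [le_div_iff₀ hE0] at hAu
  refine ⟨H, h1, hHs, ?_, ?_, ?_, d⁻¹, ?_⟩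
  · have h3 : ((H ^ 3).card : ℝ) ≤ K ^ 201 * H.card := by
      calc ((H ^ 3).card : ℝ) ≤ 8 * (K ^ 25) ^ 7 * X.card := hH3
        _ ≤ 8 * (K ^ 25) ^ 7 * (2 * K ^ 25 * H.card) := by gcongr
        _ = 16 * (K ^ 200 * H.card) := by ring
        _ ≤ K * (K ^ 200 * H.card) := by gcongr; linarith
        _ = _ := by ring
    have := Finset.small_pow_of_small_tripling (A := H) (m := 38) (K := K ^ 201) (by norm_num) h3 hHs
    rw [← pow_mul] at this
    exact this
  · calc 1 ≤ A.card * (2 * K * E) := hAl'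
      _ ≤ (4 * K ^ 4 * (2 * K ^ 25 * H.card)) * (2 * K * E) := by gcongr; exact hAX.trans (by gcongr)
      _ = 16 * (H.card * (K ^ 30 * E)) := by ring
      _ ≤ K ^ 2 * (H.card * (K ^ 30 * E)) := by gcongr; nlinarith
      _ = _ := by ring
  · calc (H.card : ℝ) * E ≤ 2 * K ^ 25 * A.card * E := by
          gcongr
          refine hHu.trans ?_
          gcongr
      _ = 2 * K ^ 25 * (A.card * E) := by ring
      _ ≤ 2 * K ^ 25 * (6 * K) := by gcongr
      _ = 12 * K ^ 26 := by ring
      _ ≤ K ^ 2 * K ^ 26 := by gcongr; nlinarith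
      _ = _ := by ring
  · intro H0 hH0 h h0 hh
    set X' := X.filter (fun x => x * d ∈ H) with hX'
    have hXX' : (X.card : ℝ) ≤ 2 * K ^ 25 * X'.card := by
      rw [div_le_iff₀ (by positivity)] at hd'
      linarith
    have hs : (X'.card : ℝ) * (E / (6 * K)) ≤ ∑ x, wk S σ (2 * m) x * h x := by
      calc (X'.card : ℝ) * (E / (6 * K)) = ∑ x ∈ X', E / (6 * K) := by simp
        _ ≤ ∑ x ∈ X', wk S σ (2 * m) x⁻¹ * h x⁻¹ := by
            refine sum_le_sum fun x hx => ?_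
            have hx1 := mem_filter.1 hx
            have e1 := hAf x (hXA hx1.1)
            have e2 := hh x⁻¹ (by
              have := H0.inv_mem (hH0 (mem_coe.2 hx1.2))
              simpa using this)
            rw [wk_inv S σ hsym]
            exact e1.trans (le_mul_of_one_le_right (wk_nonneg _ _ _ _) e2)
        _ ≤ ∑ x, wk S σ (2 * m) x⁻¹ * h x⁻¹ :=
            sum_le_sum_of_subset_of_nonneg (subset_univ _)
              fun _ _ _ => mul_nonneg (wk_nonneg _ _ _ _) (h0 _)
        _ = _ := Fintype.sum_equiv (Equiv.inv G) _ _ (fun x => by simp)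
    calc 1 ≤ A.card * (2 * K * E) := hAl'
      _ ≤ (4 * K ^ 4 * (2 * K ^ 25 * X'.card)) * (2 * K * E) := by
          gcongr; exact hAX.trans (by gcongr)
      _ = 96 * K ^ 31 * (X'.card * (E / (6 * K))) := by field_simp; ring
      _ ≤ K ^ 34 * (X'.card * (E / (6 * K))) := by
          gcongr
          calc 96 * K ^ 31 ≤ K ^ 3 * K ^ 31 := by
                gcongr
                exact (by linarith : (96 : ℝ) ≤ K).trans (le_self_pow₀ hK1 (by norm_num))
            _ = _ := by ring
      _ ≤ _ := by gcongr

end fin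

end BG


namespace BG

open Finset Pointwise

section sl2
variable {F : Type*} [Field F]

local notation "SL" => Matrix.SpecialLinearGroup (Fin 2) F

/-- trace -/
def tr (x : Matrix.SpecialLinearGroup (Fin 2) F) : F := x.1 0 0 + x.1 1 1

lemma sl_ext {x y : SL} (h1 : x.1 0 0 = y.1 0 0) (h2 : x.1 0 1 = y.1 0 1)
    (h3 : x.1 1 0 = y.1 1 0) (h4 : x.1 1 1 = y.1 1 1) : x = y := by
  apply Subtype.ext
  ext i j
  fin_cases i <;> fin_cases j <;> assumption

lemma sl_det (x : SL) : x.1 0 0 * x.1 1 1 - x.1 0 1 * x.1 1 0 = 1 := by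
  have := x.2
  rwa [Matrix.det_fin_two] at this

lemma mul00 (x y : SL) : (x * y).1 0 0 = x.1 0 0 * y.1 0 0 + x.1 0 1 * y.1 1 0 := by
  rw [Matrix.SpecialLinearGroup.coe_mul, Matrix.mul_apply, Fin.sum_univ_two]
lemma mul01 (x y : SL) : (x * y).1 0 1 = x.1 0 0 * y.1 0 1 + x.1 0 1 * y.1 1 1 := by
  rw [Matrix.SpecialLinearGroup.coe_mul, Matrix.mul_apply, Fin.sum_univ_two]
lemma mul10 (x y : SL) : (x * y).1 1 0 = x.1 1 0 * y.1 0 0 + x.1 1 1 * y.1 1 0 := by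
  rw [Matrix.SpecialLinearGroup.coe_mul, Matrix.mul_apply, Fin.sum_univ_two]
lemma mul11 (x y : SL) : (x * y).1 1 1 = x.1 1 0 * y.1 0 1 + x.1 1 1 * y.1 1 1 := by
  rw [Matrix.SpecialLinearGroup.coe_mul, Matrix.mul_apply, Fin.sum_univ_two]
lemma inv00 (x : SL) : (x⁻¹).1 0 0 = x.1 1 1 := by
  rw [Matrix.SpecialLinearGroup.SL2_inv_expl]; rfl
lemma inv01 (x : SL) : (x⁻¹).1 0 1 = - x.1 0 1 := by
  rw [Matrix.SpecialLinearGroup.SL2_inv_expl]; rfl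
lemma inv10 (x : SL) : (x⁻¹).1 1 0 = - x.1 1 0 := by
  rw [Matrix.SpecialLinearGroup.SL2_inv_expl]; rfl
lemma inv11 (x : SL) : (x⁻¹).1 1 1 = x.1 0 0 := by
  rw [Matrix.SpecialLinearGroup.SL2_inv_expl]; rfl
lemma one00 : (1 : SL).1 0 0 = 1 := rfl
lemma one01 : (1 : SL).1 0 1 = 0 := rfl
lemma one10 : (1 : SL).1 1 0 = 0 := rfl
lemma one11 : (1 : SL).1 1 1 = 1 := rfl

lemma tr_inv (x : SL) : tr x⁻¹ = tr x := by
  simp only [tr, inv00, inv11]; ring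

lemma tr_mul_comm (x y : SL) : tr (x * y) = tr (y * x) := by
  simp only [tr, mul00, mul11]; ring

lemma tr_conj (g x : SL) : tr (g * x * g⁻¹) = tr x := by
  rw [tr_mul_comm]; congr 1; group

/-- constructor -/
def mk2 (a b c d : F) (h : a * d - b * c = 1) : Matrix.SpecialLinearGroup (Fin 2) F :=
  ⟨!![a, b; c, d], by rw [Matrix.det_fin_two_of]; exact h⟩

@[simp] lemma mk2_00 (a b c d : F) (h : a * d - b * c = 1) : (mk2 a b c d h).1 0 0 = a := rfl
@[simp] lemma mk2_01 (a b c d : F) (h : a * d - b * c = 1) : (mk2 a b c d h).1 0 1 = b := rfl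
@[simp] lemma mk2_10 (a b c d : F) (h : a * d - b * c = 1) : (mk2 a b c d h).1 1 0 = c := rfl
@[simp] lemma mk2_11 (a b c d : F) (h : a * d - b * c = 1) : (mk2 a b c d h).1 1 1 = d := rfl

/-- If `b` is not scalar, elements commuting with `b` have proportional traceless part. -/
lemma comm_param {b x : SL} (hb : ¬ (b.1 0 1 = 0 ∧ b.1 1 0 = 0 ∧ b.1 0 0 = b.1 1 1))
    (h : x * b = b * x) : ∃ β : F, x.1 0 1 = β * b.1 0 1 ∧ x.1 1 0 = β * b.1 1 0 ∧
      x.1 0 0 - x.1 1 1 = β * (b.1 0 0 - b.1 1 1) := by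
  have e1 : (x * b).1 0 0 = (b * x).1 0 0 := by rw [h]
  have e2 : (x * b).1 0 1 = (b * x).1 0 1 := by rw [h]
  have e3 : (x * b).1 1 0 = (b * x).1 1 0 := by rw [h]
  rw [mul00, mul00] at e1
  rw [mul01, mul01] at e2
  rw [mul10, mul10] at e3
  by_cases h1 : b.1 0 1 = 0
  · by_cases h2 : b.1 1 0 = 0
    · have h3 : b.1 0 0 - b.1 1 1 ≠ 0 := fun h3 => hb ⟨h1, h2, sub_eq_zero.1 h3⟩
      refine ⟨(x.1 0 0 - x.1 1 1) / (b.1 0 0 - b.1 1 1), ?_, ?_, ?_⟩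
      · rw [h1, mul_zero]
        refine (mul_eq_zero.1 ?_).resolve_right h3
        rw [h1] at e2; linear_combination -e2
      · rw [h2, mul_zero]
        refine (mul_eq_zero.1 ?_).resolve_right h3
        rw [h2] at e3; linear_combination e3
      · field_simp
    · refine ⟨x.1 1 0 / b.1 1 0, ?_, ?_, ?_⟩
      · field_simp; linear_combination e1
      · field_simp
      · field_simp; linear_combination -e3
  · refine ⟨x.1 0 1 / b.1 0 1, ?_, ?_, ?_⟩
    · field_simp
    · field_simp; linear_combination -e1
    · field_simp; linear_combination e2

lemma nonscalar_of_tr {b : SL} (hb : tr b ^ 2 ≠ 4) :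
    ¬ (b.1 0 1 = 0 ∧ b.1 1 0 = 0 ∧ b.1 0 0 = b.1 1 1) := by
  rintro ⟨h1, h2, h3⟩
  apply hb
  have := sl_det b
  rw [tr, h3]
  rw [h1, h3] at this
  linear_combination 4 * this

lemma comm_trans {b x y : SL} (hb : ¬ (b.1 0 1 = 0 ∧ b.1 1 0 = 0 ∧ b.1 0 0 = b.1 1 1))
    (hx : x * b = b * x) (hy : y * b = b * y) : x * y = y * x := by
  obtain ⟨β, h1, h2, h3⟩ := comm_param hb hx
  obtain ⟨δ, k1, k2, k3⟩ := comm_param hb hy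
  have h3' : x.1 0 0 = x.1 1 1 + β * (b.1 0 0 - b.1 1 1) := by linear_combination h3
  have k3' : y.1 0 0 = y.1 1 1 + δ * (b.1 0 0 - b.1 1 1) := by linear_combination k3
  apply sl_ext <;> simp only [mul00, mul01, mul10, mul11, h1, h2, h3', k1, k2, k3'] <;> ring

lemma disc (x : SL) : (x.1 0 0 - x.1 1 1) ^ 2 + 4 * (x.1 0 1 * x.1 1 0) = tr x ^ 2 - 4 := by
  have := sl_det x
  rw [tr]; linear_combination -4 * this

lemma comm_same_tr (h2 : (2 : F) ≠ 0) {b x y : SL} (hb : tr b ^ 2 ≠ 4)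
    (hx : x * b = b * x) (hy : y * b = b * y) (ht : tr x = tr y) : y = x ∨ y = x⁻¹ := by
  obtain ⟨β, p1, p2, p3⟩ := comm_param (nonscalar_of_tr hb) hx
  obtain ⟨δ, k1, k2, k3⟩ := comm_param (nonscalar_of_tr hb) hy
  have dx := disc x
  have dy := disc y
  have db := disc b
  rw [p1, p2, p3] at dx
  rw [k1, k2, k3] at dy
  have hD : tr b ^ 2 - 4 ≠ 0 := sub_ne_zero.2 hb
  have e : (δ - β) * (δ + β) = 0 := by
    have : (tr b ^ 2 - 4) * ((δ - β) * (δ + β)) = 0 := by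
      rw [← db]; rw [ht] at dx; linear_combination dy - dx
    exact (mul_eq_zero.1 this).resolve_left hD
  have htt : x.1 0 0 + x.1 1 1 = y.1 0 0 + y.1 1 1 := ht
  rcases mul_eq_zero.1 e with e | e
  · left
    have : δ = β := sub_eq_zero.1 e
    subst this
    apply sl_ext
    · apply mul_left_cancel₀ h2; linear_combination k3 - p3 - htt
    · rw [k1, p1]
    · rw [k2, p2]
    · apply mul_left_cancel₀ h2; linear_combination p3 - k3 - htt
  · right
    have : δ = -β := eq_neg_of_add_eq_zero_left e
    subst this
    apply sl_ext
    · rw [inv00]; apply mul_left_cancel₀ h2; linear_combination k3 + p3 - htt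
    · rw [inv01, k1, p1]; ring
    · rw [inv10, k2, p2]; ring
    · rw [inv11]; apply mul_left_cancel₀ h2; linear_combination - p3 - k3 - htt

/-- `v` spans a line fixed by `g`. -/
def fixl (v : F × F) (g : Matrix.SpecialLinearGroup (Fin 2) F) : Prop :=
  v.1 * (g.1 1 0 * v.1 + g.1 1 1 * v.2) = v.2 * (g.1 0 0 * v.1 + g.1 0 1 * v.2)

lemma fixl_iff {v : F × F} (hv : v ≠ 0) (g : SL) :
    fixl v g ↔ ∃ c : F, g.1 0 0 * v.1 + g.1 0 1 * v.2 = c * v.1 ∧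
      g.1 1 0 * v.1 + g.1 1 1 * v.2 = c * v.2 := by
  constructor
  · intro h
    unfold fixl at h
    by_cases h1 : v.1 = 0
    · have h2 : v.2 ≠ 0 := fun h2 => hv (Prod.ext h1 h2)
      refine ⟨(g.1 1 0 * v.1 + g.1 1 1 * v.2) / v.2, ?_, ?_⟩
      · rw [h1] at h ⊢
        rw [zero_mul] at h
        have := (mul_eq_zero.1 h.symm).resolve_left h2
        rw [this, mul_zero]
      · field_simp
    · refine ⟨(g.1 0 0 * v.1 + g.1 0 1 * v.2) / v.1, ?_, ?_⟩
      · field_simp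
      · field_simp; linear_combination h
  · rintro ⟨c, h1, h2⟩
    unfold fixl
    rw [h1, h2]; ring

/-- stabiliser of a line -/
def bor (v : F × F) (hv : v ≠ 0) : Subgroup (Matrix.SpecialLinearGroup (Fin 2) F) where
  carrier := {g | fixl v g}
  one_mem' := by
    change fixl v 1
    simp only [fixl, one00, one01, one10, one11]; ring
  mul_mem' := by
    intro a b ha hb
    change fixl v (a * b)
    obtain ⟨c, h1, h2⟩ := (fixl_iff hv a).1 ha
    obtain ⟨d, k1, k2⟩ := (fixl_iff hv b).1 hb
    refine (fixl_iff hv _).2 ⟨c * d, ?_, ?_⟩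
    · simp only [mul00, mul01]
      linear_combination a.1 0 0 * k1 + a.1 0 1 * k2 + d * h1
    · simp only [mul10, mul11]
      linear_combination a.1 1 0 * k1 + a.1 1 1 * k2 + d * h2
  inv_mem' := by
    intro a ha
    change fixl v a⁻¹
    replace ha : fixl v a := ha
    unfold fixl at ha ⊢
    simp only [inv00, inv01, inv10, inv11]
    linear_combination -ha

lemma mem_bor {v : F × F} {hv : v ≠ 0} {g : SL} : g ∈ bor v hv ↔ fixl v g := Iff.rfl

lemma exists_col {v : F × F} (hv : v ≠ 0) : ∃ k : SL, k.1 0 0 = v.1 ∧ k.1 1 0 = v.2 := by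
  by_cases h1 : v.1 = 0
  · have h2 : v.2 ≠ 0 := fun h2 => hv (Prod.ext h1 h2)
    exact ⟨mk2 v.1 (-v.2⁻¹) v.2 0 (by field_simp; ring), rfl, rfl⟩
  · exact ⟨mk2 v.1 0 v.2 v.1⁻¹ (by field_simp; ring), rfl, rfl⟩

lemma bor_ne_top (v : F × F) (hv : v ≠ 0) : bor v hv ≠ ⊤ := by
  intro h
  obtain ⟨k, h0, h1⟩ := exists_col hv
  have hm : k * mk2 1 0 1 1 (by ring) * k⁻¹ ∈ bor v hv := by rw [h]; trivial
  rw [mem_bor, fixl, ← h0, ← h1] at hm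
  simp only [mul00, mul01, mul10, mul11, inv00, inv01, inv10, inv11, mk2_00, mk2_01, mk2_10,
    mk2_11] at hm
  have hd := sl_det k
  have : (1 : F) = 0 := by
    have e1 : (k.1 0 0 * k.1 1 1 - k.1 0 1 * k.1 1 0) ^ 2 = 0 := by linear_combination hm
    rw [hd] at e1
    simpa using e1
  exact one_ne_zero this

/-- The nilpotent lemma. -/
lemma nilp (a b c : F) (h : a * a + b * c = 0) (hne : ¬ (a = 0 ∧ b = 0 ∧ c = 0)) :
    ∃ v : F × F, v ≠ 0 ∧ ∀ y : SL,
      a * y.1 0 0 + b * y.1 1 0 + c * y.1 0 1 - a * y.1 1 1 = 0 → fixl v y := by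
  by_cases hac : a = 0 ∧ c = 0
  · obtain ⟨rfl, rfl⟩ := hac
    have hb : b ≠ 0 := fun hb => hne ⟨rfl, hb, rfl⟩
    refine ⟨(1, 0), by simp, fun y hy => ?_⟩
    have : y.1 1 0 = 0 := by
      refine (mul_eq_zero.1 ?_).resolve_left hb
      linear_combination hy
    simp [fixl, this]
  · refine ⟨(a, c), fun h0 => hac ⟨congrArg Prod.fst h0, congrArg Prod.snd h0⟩, fun y hy => ?_⟩
    simp only [fixl]
    linear_combination (-c) * hy + y.1 1 0 * h

end sl2

end BG


namespace BG

open Finset Pointwise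

section sl2
variable {F : Type*} [Field F]

local notation "SL" => Matrix.SpecialLinearGroup (Fin 2) F

lemma fixl_mul {v : F × F} (hv : v ≠ 0) {a b : SL} (ha : fixl v a) (hb : fixl v b) :
    fixl v (a * b) := (bor v hv).mul_mem ha hb

lemma fiber_dep (t : F) (ht : t ≠ 0) (A y z : SL) (hA : tr A = t) (hAy : tr (A * y) = t)
    (hAz : tr (A * z) = t) (hy : y ≠ 1) (hz : z ≠ 1) (hyz : z ≠ y) (β γ : F)
    (hne : ¬ (β = 0 ∧ γ = 0))
    (h0 : β * (y.1 0 0 - y.1 1 1) + γ * (z.1 0 0 - z.1 1 1) = 0)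
    (h1 : β * y.1 1 0 + γ * z.1 1 0 = 0) (h2 : β * y.1 0 1 + γ * z.1 0 1 = 0) :
    ∃ v : F × F, v ≠ 0 ∧ fixl v A ∧ fixl v y ∧ fixl v z := by
  simp only [tr, mul00, mul11] at hA hAy hAz
  have dA := sl_det A
  have dy := sl_det y
  have dz := sl_det z
  have hγ : γ ≠ 0 := by
    intro hγ
    have hβ : β ≠ 0 := fun h => hne ⟨h, hγ⟩
    rw [hγ] at h0 h1 h2
    have g0 : y.1 0 0 = y.1 1 1 := by
      apply mul_left_cancel₀ hβ; linear_combination h0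
    have g1 : y.1 1 0 = 0 := by apply mul_left_cancel₀ hβ; linear_combination h1
    have g2 : y.1 0 1 = 0 := by apply mul_left_cancel₀ hβ; linear_combination h2
    have g3 : y.1 1 1 = 1 := by
      apply mul_left_cancel₀ ht
      rw [g0, g1, g2] at hAy
      linear_combination hAy - y.1 1 1 * hA
    exact hy (sl_ext (by rw [g0, g3]; rfl) (by rw [g2]; rfl) (by rw [g1]; rfl) (by rw [g3]; rfl))
  obtain ⟨b, hb⟩ : ∃ b, β = -b * γ := ⟨-β / γ, by field_simp⟩
  subst hb
  have g0 : z.1 0 0 - z.1 1 1 = b * (y.1 0 0 - y.1 1 1) := by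
    apply mul_left_cancel₀ hγ; linear_combination h0
  have g1 : z.1 1 0 = b * y.1 1 0 := by apply mul_left_cancel₀ hγ; linear_combination h1
  have g2 : z.1 0 1 = b * y.1 0 1 := by apply mul_left_cancel₀ hγ; linear_combination h2
  have g3 : z.1 1 1 = b * y.1 1 1 + (1 - b) := by
    apply mul_left_cancel₀ ht
    have g0' : z.1 0 0 = z.1 1 1 + b * (y.1 0 0 - y.1 1 1) := by linear_combination g0
    rw [g0', g1, g2] at hAz
    linear_combination hAz - b * hAy + (- z.1 1 1 + b * y.1 1 1) * hA
  have g4 : z.1 0 0 = b * y.1 0 0 + (1 - b) := by linear_combination g0 + g3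
  have hb1 : b ≠ 1 := by
    rintro rfl
    exact hyz (sl_ext (by rw [g4]; ring) (by rw [g2]; ring) (by rw [g1]; ring) (by rw [g3]; ring))
  have hb0 : b ≠ 0 := by
    rintro rfl
    exact hz (sl_ext (by rw [g4, one00]; ring) (by rw [g2, one01]; ring)
      (by rw [g1, one10]; ring) (by rw [g3, one11]; ring))
  have htr : y.1 0 0 + y.1 1 1 = 2 := by
    have h1b : 1 - b ≠ 0 := sub_ne_zero.2 hb1.symm
    apply mul_left_cancel₀ (mul_ne_zero hb0 h1b)
    rw [g1, g2, g3, g4] at dz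
    linear_combination dz - b ^ 2 * dy
  obtain ⟨v, hv, hv'⟩ := nilp (y.1 0 0 - 1) (y.1 0 1) (y.1 1 0)
    (by linear_combination y.1 0 0 * htr - dy) (by
      rintro ⟨k1, k2, k3⟩
      refine hy (sl_ext ?_ k2 k3 ?_)
      · rw [one00]; linear_combination k1
      · rw [one11]; linear_combination htr - k1)
  have fA : fixl v A := hv' A (by linear_combination hAy - hA - A.1 1 1 * htr)
  have fy : fixl v y := hv' y (by linear_combination (y.1 0 0 + 1) * htr - 2 * dy)
  refine ⟨v, hv, fA, fy, ?_⟩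
  unfold fixl at fy ⊢
  rw [g1, g2, g3, g4]
  linear_combination b * fy

lemma fiber_two (t : F) (ht : t ≠ 0) (A B D y z : SL) (hA : tr A = t) (hAy : tr (A * y) = t)
    (hAz : tr (A * z) = t) (hB : tr B = t) (hBy : tr (B * y) = t)
    (hBz : tr (B * z) = t) (hD : tr D = t) (hDy : tr (D * y) = t)
    (hDz : tr (D * z) = t) (hAB : A ≠ B) (hAD : A ≠ D) (hBD : B ≠ D)
    (hy : y ≠ 1) (hz : z ≠ 1) (hyz : z ≠ y) :
    ∃ v : F × F, v ≠ 0 ∧ fixl v A ∧ fixl v y ∧ fixl v z := by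
  obtain ⟨p0, hp0⟩ : ∃ p, p = y.1 0 0 - y.1 1 1 := ⟨_, rfl⟩
  obtain ⟨p1, hp1⟩ : ∃ p, p = y.1 1 0 := ⟨_, rfl⟩
  obtain ⟨p2, hp2⟩ : ∃ p, p = y.1 0 1 := ⟨_, rfl⟩
  obtain ⟨q0, hq0⟩ : ∃ p, p = z.1 0 0 - z.1 1 1 := ⟨_, rfl⟩
  obtain ⟨q1, hq1⟩ : ∃ p, p = z.1 1 0 := ⟨_, rfl⟩
  obtain ⟨q2, hq2⟩ : ∃ p, p = z.1 0 1 := ⟨_, rfl⟩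
  obtain ⟨w0, hw0⟩ : ∃ w, w = p1 * q2 - p2 * q1 := ⟨_, rfl⟩
  obtain ⟨w1, hw1⟩ : ∃ w, w = p2 * q0 - p0 * q2 := ⟨_, rfl⟩
  obtain ⟨w2, hw2⟩ : ∃ w, w = p0 * q1 - p1 * q0 := ⟨_, rfl⟩
  by_cases hw : w0 = 0 ∧ w1 = 0 ∧ w2 = 0
  · obtain ⟨k0, k1, k2⟩ := hw
    rw [k0] at hw0; rw [k1] at hw1; rw [k2] at hw2
    by_cases hp : p0 = 0 ∧ p1 = 0 ∧ p2 = 0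
    · refine fiber_dep t ht A y z hA hAy hAz hy hz hyz 1 0 (by simp) ?_ ?_ ?_
      · rw [← hp0, hp.1]; ring
      · rw [← hp1, hp.2.1]; ring
      · rw [← hp2, hp.2.2]; ring
    · by_cases r0 : p0 = 0
      · by_cases r1 : p1 = 0
        · have r2 : p2 ≠ 0 := fun h => hp ⟨r0, r1, h⟩
          refine fiber_dep t ht A y z hA hAy hAz hy hz hyz q2 (-p2) (by simp [r2]) ?_ ?_ ?_
          · rw [← hp0, ← hq0]; linear_combination hw1
          · rw [← hp1, ← hq1]; linear_combination -hw0
          · rw [← hp2, ← hq2]; ring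
        · refine fiber_dep t ht A y z hA hAy hAz hy hz hyz q1 (-p1) (by simp [r1]) ?_ ?_ ?_
          · rw [← hp0, ← hq0]; linear_combination -hw2
          · rw [← hp1, ← hq1]; ring
          · rw [← hp2, ← hq2]; linear_combination hw0
      · refine fiber_dep t ht A y z hA hAy hAz hy hz hyz q0 (-p0) (by simp [r0]) ?_ ?_ ?_
        · rw [← hp0, ← hq0]; ring
        · rw [← hp1, ← hq1]; linear_combination hw2
        · rw [← hp2, ← hq2]; linear_combination -hw1
  · -- every solution is `A + l w`
    have key : ∀ B : SL, tr B = t → tr (B * y) = t → tr (B * z) = t → ∃ l : F,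
        B.1 0 0 = A.1 0 0 + l * w0 ∧ B.1 0 1 = A.1 0 1 + l * w1 ∧ B.1 1 0 = A.1 1 0 + l * w2 ∧
        B.1 1 1 = A.1 1 1 - l * w0 := by
      intro B hB hBy hBz
      simp only [tr, mul00, mul11] at hA hAy hAz hB hBy hBz
      obtain ⟨n0, hn0⟩ : ∃ n, n = B.1 0 0 - A.1 0 0 := ⟨_, rfl⟩
      obtain ⟨n1, hn1⟩ : ∃ n, n = B.1 0 1 - A.1 0 1 := ⟨_, rfl⟩
      obtain ⟨n2, hn2⟩ : ∃ n, n = B.1 1 0 - A.1 1 0 := ⟨_, rfl⟩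
      have b11 : B.1 1 1 = A.1 1 1 - n0 := by rw [hn0]; linear_combination hB - hA
      have b00 : B.1 0 0 = A.1 0 0 + n0 := by rw [hn0]; ring
      have b01 : B.1 0 1 = A.1 0 1 + n1 := by rw [hn1]; ring
      have b10 : B.1 1 0 = A.1 1 0 + n2 := by rw [hn2]; ring
      have o1 : n0 * p0 + n1 * p1 + n2 * p2 = 0 := by
        rw [b00, b01, b10, b11] at hBy
        rw [hp0, hp1, hp2]; linear_combination hBy - hAy
      have o2 : n0 * q0 + n1 * q1 + n2 * q2 = 0 := by
        rw [b00, b01, b10, b11] at hBz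
        rw [hq0, hq1, hq2]; linear_combination hBz - hAz
      -- N × w = 0
      have c0 : n1 * w2 = n2 * w1 := by
        rw [hw1, hw2]; linear_combination p0 * o2 - q0 * o1
      have c1 : n2 * w0 = n0 * w2 := by
        rw [hw0, hw2]; linear_combination p1 * o2 - q1 * o1
      have c2 : n0 * w1 = n1 * w0 := by
        rw [hw0, hw1]; linear_combination p2 * o2 - q2 * o1
      have : ∃ l, n0 = l * w0 ∧ n1 = l * w1 ∧ n2 = l * w2 := by
        by_cases r0 : w0 = 0
        · by_cases r1 : w1 = 0
          · have r2 : w2 ≠ 0 := fun h => hw ⟨r0, r1, h⟩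
            refine ⟨n2 / w2, ?_, ?_, ?_⟩ <;> field_simp
            · exact c1.symm
            · exact c0
          · refine ⟨n1 / w1, ?_, ?_, ?_⟩ <;> field_simp
            · exact c2
            · exact c0.symm
        · refine ⟨n0 / w0, ?_, ?_, ?_⟩ <;> field_simp
          · exact c2.symm
          · exact c1
      obtain ⟨l, l0, l1, l2⟩ := this
      exact ⟨l, by rw [b00, l0], by rw [b01, l1], by rw [b10, l2], by rw [b11, l0]⟩
    obtain ⟨l, l0, l1, l2, l3⟩ := key B hB hBy hBz
    obtain ⟨m, m0, m1, m2, m3⟩ := key D hD hDy hDz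
    have hl : l ≠ 0 := by
      rintro rfl
      exact hAB (sl_ext (by rw [l0]; ring) (by rw [l1]; ring) (by rw [l2]; ring) (by rw [l3]; ring))
    have hm : m ≠ 0 := by
      rintro rfl
      exact hAD (sl_ext (by rw [m0]; ring) (by rw [m1]; ring) (by rw [m2]; ring) (by rw [m3]; ring))
    have hlm : l - m ≠ 0 := by
      intro h
      have : l = m := sub_eq_zero.1 h
      subst this
      exact hBD (sl_ext (by rw [l0, m0]) (by rw [l1, m1]) (by rw [l2, m2]) (by rw [l3, m3]))
    have dA := sl_det A
    have dB := sl_det B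
    have dD := sl_det D
    rw [l0, l1, l2, l3] at dB
    rw [m0, m1, m2, m3] at dD
    obtain ⟨L, hL⟩ : ∃ L, L = w0 * A.1 0 0 + w1 * A.1 1 0 + w2 * A.1 0 1 - w0 * A.1 1 1 := ⟨_, rfl⟩
    obtain ⟨W, hW⟩ : ∃ W, W = w0 * w0 + w1 * w2 := ⟨_, rfl⟩
    have e1 : L + l * W = 0 := by
      apply mul_left_cancel₀ hl; rw [hL, hW]; linear_combination dA - dB
    have e2 : L + m * W = 0 := by
      apply mul_left_cancel₀ hm; rw [hL, hW]; linear_combination dA - dD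
    have eW : W = 0 := by
      apply mul_left_cancel₀ hlm; linear_combination e1 - e2
    have eL : L = 0 := by rw [eW] at e1; linear_combination e1
    obtain ⟨v, hv, hv'⟩ := nilp w0 w1 w2 (by rw [← hW, eW]) hw
    refine ⟨v, hv, hv' A (by rw [← hL, eL]), hv' y ?_, hv' z ?_⟩
    · rw [hw0, hw1, hw2, hp0, hp1, hp2]; ring
    · rw [hw0, hw1, hw2, hq0, hq1, hq2]; ring

end sl2

end BG


namespace BG

open Finset Pointwise

section sl2
variable {F : Type*} [Field F]

local notation "SL" => Matrix.SpecialLinearGroup (Fin 2) F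

/-- `u` fixes the vector `v`. -/
def fixv (v : F × F) (u : Matrix.SpecialLinearGroup (Fin 2) F) : Prop :=
  u.1 0 0 * v.1 + u.1 0 1 * v.2 = v.1 ∧ u.1 1 0 * v.1 + u.1 1 1 * v.2 = v.2

lemma unip_inj {g u1 u2 u3 w1 w2 w3 : SL} (hg : g.1 1 0 ≠ 0)
    (h1 : fixv (1, 0) u1) (h2 : fixv (1, 0) u2) (h3 : fixv (1, 0) u3)
    (k1 : fixv (1, 0) w1) (k2 : fixv (1, 0) w2) (k3 : fixv (1, 0) w3)
    (hb : g.1 0 0 + g.1 1 0 * u2.1 0 1 + g.1 1 1 ≠ 0)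
    (h : u1 * g * u2 * g * u3 = w1 * g * w2 * g * w3) : u1 = w1 ∧ u2 = w2 ∧ u3 = w3 := by
  have aux : ∀ u : SL, fixv (1, 0) u → u.1 0 0 = 1 ∧ u.1 1 0 = 0 ∧ u.1 1 1 = 1 := by
    rintro u ⟨e1, e2⟩
    have e1' : u.1 0 0 = 1 := by simpa using e1
    have e2' : u.1 1 0 = 0 := by simpa using e2
    have := sl_det u
    rw [e1', e2'] at this
    exact ⟨e1', e2', by linear_combination this⟩
  obtain ⟨a1, a2, a3⟩ := aux u1 h1
  obtain ⟨b1, b2, b3⟩ := aux u2 h2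
  obtain ⟨c1, c2, c3⟩ := aux u3 h3
  obtain ⟨d1, d2, d3⟩ := aux w1 k1
  obtain ⟨e1, e2, e3⟩ := aux w2 k2
  obtain ⟨f1, f2, f3⟩ := aux w3 k3
  have E10 : (u1 * g * u2 * g * u3).1 1 0 = (w1 * g * w2 * g * w3).1 1 0 := by rw [h]
  have E11 : (u1 * g * u2 * g * u3).1 1 1 = (w1 * g * w2 * g * w3).1 1 1 := by rw [h]
  have E00 : (u1 * g * u2 * g * u3).1 0 0 = (w1 * g * w2 * g * w3).1 0 0 := by rw [h]
  simp only [mul00, mul01, mul10, mul11, a1, a2, a3, b1, b2, b3, c1, c2, c3, d1, d2, d3, e1, e2, e3,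
    f1, f2, f3] at E10 E11 E00
  have r2 : u2.1 0 1 = w2.1 0 1 := by
    apply mul_left_cancel₀ hg
    apply mul_left_cancel₀ hg
    linear_combination E10
  rw [← r2] at E11 E00
  have r3 : u3.1 0 1 = w3.1 0 1 := by
    apply mul_left_cancel₀ hg
    apply mul_left_cancel₀ hb
    linear_combination E11
  have r1 : u1.1 0 1 = w1.1 0 1 := by
    apply mul_left_cancel₀ hg
    apply mul_left_cancel₀ hb
    linear_combination E00
  exact ⟨sl_ext (by rw [a1, d1]) r1 (by rw [a2, d2]) (by rw [a3, d3]),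
    sl_ext (by rw [b1, e1]) r2 (by rw [b2, e2]) (by rw [b3, e3]),
    sl_ext (by rw [c1, f1]) r3 (by rw [c2, f2]) (by rw [c3, f3])⟩

lemma fixv_conj {k u : SL} {v : F × F} (h0 : k.1 0 0 = v.1) (h1 : k.1 1 0 = v.2) (hu : fixv v u) :
    fixv (1, 0) (k⁻¹ * u * k) := by
  obtain ⟨e1, e2⟩ := hu
  rw [← h0, ← h1] at e1 e2
  have hd := sl_det k
  constructor
  · simp only [mul00, mul01, mul10, mul11, inv00, inv01, inv10, inv11]
    linear_combination k.1 1 1 * e1 - k.1 0 1 * e2 + hd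
  · simp only [mul00, mul01, mul10, mul11, inv00, inv01, inv10, inv11]
    linear_combination -k.1 1 0 * e1 + k.1 0 0 * e2

lemma fixv_inv_mul {u w : SL} {v : F × F} {c : F} (hc : c ≠ 0)
    (h1 : u.1 0 0 * v.1 + u.1 0 1 * v.2 = c * v.1) (h2 : u.1 1 0 * v.1 + u.1 1 1 * v.2 = c * v.2)
    (h3 : w.1 0 0 * v.1 + w.1 0 1 * v.2 = c * v.1) (h4 : w.1 1 0 * v.1 + w.1 1 1 * v.2 = c * v.2) :
    fixv v (u⁻¹ * w) := by
  have hd := sl_det u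
  constructor
  · simp only [mul00, mul01, mul10, mul11, inv00, inv01, inv10, inv11]
    linear_combination u.1 1 1 * (h3 - h1) - u.1 0 1 * (h4 - h2) + v.1 * hd
  · simp only [mul00, mul01, mul10, mul11, inv00, inv01, inv10, inv11]
    linear_combination - u.1 1 0 * (h3 - h1) + u.1 0 0 * (h4 - h2) + v.2 * hd

lemma eig_root {x : SL} {v : F × F} (hv : v ≠ 0) {c : F}
    (h1 : x.1 0 0 * v.1 + x.1 0 1 * v.2 = c * v.1) (h2 : x.1 1 0 * v.1 + x.1 1 1 * v.2 = c * v.2) :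
    c ^ 2 - tr x * c + 1 = 0 := by
  have hd := sl_det x
  rw [tr]
  by_cases k : v.1 = 0
  · have k2 : v.2 ≠ 0 := fun k2 => hv (Prod.ext k k2)
    apply mul_left_cancel₀ k2
    linear_combination -x.1 1 0 * h1 - (c - x.1 0 0) * h2 - v.2 * hd
  · apply mul_left_cancel₀ k
    linear_combination -(c - x.1 1 1) * h1 - x.1 0 1 * h2 - v.1 * hd

/-- A non-scalar element fixes at most two lines. -/
lemma eig_lines {x : SL} (hx : ¬ (x.1 0 1 = 0 ∧ x.1 1 0 = 0 ∧ x.1 0 0 = x.1 1 1)) :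
    ∃ v1 v2 : F × F, v1 ≠ 0 ∧ v2 ≠ 0 ∧ ∀ v, v ≠ 0 → fixl v x →
      (∀ g : SL, fixl v g → fixl v1 g) ∨ (∀ g : SL, fixl v g → fixl v2 g) := by
  have par : ∀ u v : F × F, u ≠ 0 → u.1 * v.2 - u.2 * v.1 = 0 →
      ∀ g : SL, fixl u g → fixl v g := by
    intro u v hu h g hg
    unfold fixl at hg ⊢
    obtain ⟨l, h1, h2⟩ : ∃ l, v.1 = l * u.1 ∧ v.2 = l * u.2 := by
      by_cases k : u.1 = 0
      · have k2 : u.2 ≠ 0 := fun k2 => hu (Prod.ext k k2)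
        refine ⟨v.2 / u.2, ?_, by field_simp⟩
        field_simp; linear_combination -h
      · refine ⟨v.1 / u.1, by field_simp, ?_⟩
        field_simp; linear_combination h
    rw [h1, h2]; linear_combination l ^ 2 * hg
  by_cases hex : ∃ u : F × F, u ≠ 0 ∧ fixl u x
  · obtain ⟨u, hu, fu⟩ := hex
    by_cases hex2 : ∃ w : F × F, w ≠ 0 ∧ fixl w x ∧ w.1 * u.2 - w.2 * u.1 ≠ 0
    · obtain ⟨w, hw, fw, hwu⟩ := hex2
      refine ⟨u, w, hu, hw, fun v hv fv => ?_⟩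
      by_cases h1 : v.1 * u.2 - v.2 * u.1 = 0
      · exact Or.inl (par v u hv h1)
      · by_cases h2 : v.1 * w.2 - v.2 * w.1 = 0
        · exact Or.inr (par v w hv h2)
        · exfalso
          unfold fixl at fu fw fv
          have hV := mul_ne_zero (mul_ne_zero h1 h2) hwu
          apply hx
          refine ⟨?_, ?_, ?_⟩
          · apply mul_left_cancel₀ hV
            linear_combination (- u.1 * w.1 * (w.1 * u.2 - w.2 * u.1)) * fv + (v.1 * u.1 * (v.1 * u.2 - v.2 * u.1)) * fw - (v.1 * w.1 * (v.1 * w.2 - v.2 * w.1)) * fu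
          · apply mul_left_cancel₀ hV
            linear_combination (u.2 * w.2 * (w.1 * u.2 - w.2 * u.1)) * fv - (v.2 * u.2 * (v.1 * u.2 - v.2 * u.1)) * fw + (v.2 * w.2 * (v.1 * w.2 - v.2 * w.1)) * fu
          · apply mul_left_cancel₀ hV
            linear_combination ((u.1 * w.2 + u.2 * w.1) * (w.1 * u.2 - w.2 * u.1)) * fv - ((v.1 * u.2 + v.2 * u.1) * (v.1 * u.2 - v.2 * u.1)) * fw + ((v.1 * w.2 + v.2 * w.1) * (v.1 * w.2 - v.2 * w.1)) * fu
    · push Not at hex2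
      exact ⟨u, u, hu, hu, fun v hv fv => Or.inl (par v u hv (hex2 v hv fv))⟩
  · push Not at hex
    exact ⟨(1, 0), (1, 0), by simp, by simp, fun v hv fv => absurd fv (hex v hv)⟩

end sl2

end BG


namespace BG

open Finset Pointwise

section sl2
variable {F : Type*} [Field F] [Fintype F] [DecidableEq F]

local notation "SL" => Matrix.SpecialLinearGroup (Fin 2) F

open Classical in
lemma unip_count {v : F × F} (hv : v ≠ 0) (U P : Finset SL) (hU : ∀ u ∈ U, fixv v u) (g : SL)
    (hg : ¬ fixl v g) (hP : ∀ u1 ∈ U, ∀ u2 ∈ U, ∀ u3 ∈ U, u1 * g * u2 * g * u3 ∈ P) :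
    U.card ^ 2 * (U.card - 1) ≤ P.card := by
  obtain ⟨k, k0, k1⟩ := exists_col hv
  set g' := k⁻¹ * g * k with hg'
  have hg10 : g'.1 1 0 ≠ 0 := by
    intro h
    apply hg
    rw [hg'] at h
    simp only [mul00, mul01, mul10, mul11, inv00, inv01, inv10, inv11] at h
    unfold fixl
    rw [← k0, ← k1]
    linear_combination h
  set bad : SL → Prop := fun u => g'.1 0 0 + g'.1 1 0 * (k⁻¹ * u * k).1 0 1 + g'.1 1 1 = 0 with hbad
  set U' := U.filter (fun u => ¬ bad u) with hU'
  have hc : U.card - 1 ≤ U'.card := by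
    have h1 : (U.filter bad).card + U'.card = U.card := by
      rw [hU']; convert card_filter_add_card_filter_not (s := U) bad
    have h2 : (U.filter bad).card ≤ 1 := by
      rw [card_le_one]
      intro a ha b hb
      rw [mem_filter] at ha hb
      have fa := fixv_conj k0 k1 (hU a ha.1)
      have fb := fixv_conj k0 k1 (hU b hb.1)
      have e : (k⁻¹ * a * k).1 0 1 = (k⁻¹ * b * k).1 0 1 := by
        apply mul_left_cancel₀ hg10
        have h3 : g'.1 0 0 + g'.1 1 0 * (k⁻¹ * a * k).1 0 1 + g'.1 1 1 = 0 := ha.2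
        have h4 : g'.1 0 0 + g'.1 1 0 * (k⁻¹ * b * k).1 0 1 + g'.1 1 1 = 0 := hb.2
        linear_combination h3 - h4
      have e' : k⁻¹ * a * k = k⁻¹ * b * k := by
        obtain ⟨a1, a2⟩ := fa
        obtain ⟨b1, b2⟩ := fb
        simp only [mul_one, mul_zero, add_zero] at a1 a2 b1 b2
        have da := sl_det (k⁻¹ * a * k)
        have db := sl_det (k⁻¹ * b * k)
        rw [a1, a2] at da
        rw [b1, b2] at db
        exact sl_ext (by rw [a1, b1]) e (by rw [a2, b2]) (by linear_combination da - db)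
      simpa using e'
    omega
  calc U.card ^ 2 * (U.card - 1) ≤ U.card ^ 2 * U'.card := by gcongr
    _ = (U ×ˢ U' ×ˢ U).card := by rw [card_product, card_product]; ring
    _ ≤ P.card := by
      refine card_le_card_of_injOn (fun q => q.1 * g * q.2.1 * g * q.2.2) ?_ ?_
      · rintro ⟨a, b, c⟩ h
        simp only [coe_product, Set.mem_prod, mem_coe] at h
        exact mem_coe.2 (hP a h.1 b (mem_filter.1 h.2.1).1 c h.2.2)
      · rintro ⟨a, b, c⟩ h ⟨a', b', c'⟩ h' he
        simp only [coe_product, Set.mem_prod, mem_coe] at h h'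
        have hb := mem_filter.1 h.2.1
        have hb' := mem_filter.1 h'.2.1
        have := unip_inj hg10 (fixv_conj k0 k1 (hU a h.1)) (fixv_conj k0 k1 (hU b hb.1))
          (fixv_conj k0 k1 (hU c h.2.2)) (fixv_conj k0 k1 (hU a' h'.1))
          (fixv_conj k0 k1 (hU b' hb'.1)) (fixv_conj k0 k1 (hU c' h'.2.2)) hb.2 (by
            have he' : a * g * b * g * c = a' * g * b' * g * c' := he
            have : ∀ x y z : SL, k⁻¹ * x * k * g' * (k⁻¹ * y * k) * g' * (k⁻¹ * z * k) =
                k⁻¹ * (x * g * y * g * z) * k := fun x y z => by rw [hg']; group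
            rw [this, this, he'])
        simpa using this

open Classical in
lemma borel_count {t : F} (C W : Finset SL) (hC : ∀ x ∈ C, tr x = t)
    (hCi : ∀ x ∈ C, x⁻¹ ∈ C) (hCW : ∀ x ∈ C, ∀ y ∈ C, x * y ∈ W) {v : F × F} (hv : v ≠ 0)
    (M : ℕ) (hM : (W.filter (fixv v)).card ≤ M) : (C.filter (fixl v)).card ≤ 2 * M := by
  have hex : ∀ x : SL, ∃ c : F, fixl v x → x.1 0 0 * v.1 + x.1 0 1 * v.2 = c * v.1 ∧
      x.1 1 0 * v.1 + x.1 1 1 * v.2 = c * v.2 := by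
    intro x
    by_cases h : fixl v x
    · obtain ⟨c, hc⟩ := (fixl_iff hv x).1 h
      exact ⟨c, fun _ => hc⟩
    · exact ⟨0, fun h' => absurd h' h⟩
  choose c hc using hex
  have hroots : (univ.filter (fun c : F => c ^ 2 - t * c + 1 = 0)).card ≤ 2 := by
    by_contra hcon
    rw [not_le, two_lt_card] at hcon
    obtain ⟨a, ha, b, hb, d, hd, hab, had, hbd⟩ := hcon
    simp only [mem_filter, mem_univ, true_and] at ha hb hd
    have e1 : a + b - t = 0 := by
      apply mul_left_cancel₀ (sub_ne_zero.2 hab); linear_combination ha - hb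
    have e2 : a + d - t = 0 := by
      apply mul_left_cancel₀ (sub_ne_zero.2 had); linear_combination ha - hd
    exact hbd (by linear_combination e1 - e2)
  calc (C.filter (fixl v)).card ≤ M * (univ.filter (fun c : F => c ^ 2 - t * c + 1 = 0)).card := by
        refine card_le_mul_card_image_of_maps_to (f := c) ?_ M ?_
        · intro x hx
          rw [mem_filter] at hx
          have := eig_root hv (hc x hx.2).1 (hc x hx.2).2
          rw [hC x hx.1] at this
          simpa using this
        · intro a ha
          by_cases hne : ((C.filter (fixl v)).filter (fun x => c x = a)).Nonempty
          · obtain ⟨x0, hx0⟩ := hne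
            refine le_trans ?_ hM
            rw [mem_filter, mem_filter] at hx0
            have ha0 : a ≠ 0 := by
              rintro rfl
              simp at ha
            refine card_le_card_of_injOn (fun x => x0⁻¹ * x) ?_ ?_
            · intro x hx
              rw [mem_coe, mem_filter, mem_filter] at hx
              rw [mem_coe, mem_filter]
              refine ⟨hCW _ (hCi _ hx0.1.1) _ hx.1.1, ?_⟩
              have e1 := hc x0 hx0.1.2
              have e2 := hc x hx.1.2
              rw [hx0.2] at e1
              rw [hx.2] at e2
              exact fixv_inv_mul ha0 e1.1 e1.2 e2.1 e2.2
            · intro x _ y _ h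
              simpa using h
          · rw [not_nonempty_iff_eq_empty] at hne
            rw [hne]; simp
    _ ≤ M * 2 := by gcongr
    _ = _ := by ring

open Classical in
lemma class_count {t : F} (ht : t ≠ 0) (ht2 : t ^ 2 ≠ 4) (C W : Finset SL)
    (hC : ∀ x ∈ C, tr x = t)
    (hCi : ∀ x ∈ C, x⁻¹ ∈ C) (hCW : ∀ x ∈ C, ∀ y ∈ C, x * y ∈ W)
    (M : ℕ) (hM : ∀ v : F × F, v ≠ 0 → (W.filter (fixv v)).card ≤ M) :
    C.card ^ 3 ≤ 2 * W.card ^ 2 + 3 * C.card ^ 2 + 8 * C.card * M ^ 2 := by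
  set T := C ×ˢ C ×ˢ C with hT
  set com : SL × SL × SL → Prop := fun q =>
    ∃ v : F × F, v ≠ 0 ∧ fixl v q.1 ∧ fixl v q.2.1 ∧ fixl v q.2.2 with hcom
  set T1 := T.filter (fun q => q.2.2 = q.1⁻¹) with hT1
  set T2 := T.filter (fun q => q.2.2 = q.2.1) with hT2
  set T3 := T.filter (fun q => q.2.1 = q.1⁻¹) with hT3
  set T4 := T.filter com with hT4
  set Gd := T.filter (fun q => q.2.2 ≠ q.1⁻¹ ∧ q.2.2 ≠ q.2.1 ∧ q.2.1 ≠ q.1⁻¹ ∧ ¬ com q) with hGd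
  have hcov : T ⊆ Gd ∪ (T1 ∪ T2 ∪ T3 ∪ T4) := by
    intro q hq
    simp only [mem_union, hGd, hT1, hT2, hT3, hT4, mem_filter, hq, true_and]
    tauto
  have hTc : T.card = C.card ^ 3 := by rw [hT, card_product, card_product]; ring
  have c1 : T1.card ≤ C.card ^ 2 := by
    rw [sq, ← card_product]
    refine card_le_card_of_injOn (fun q => (q.1, q.2.1)) ?_ ?_
    · rintro ⟨a, b, c⟩ h
      simp only [hT1, hT, coe_filter, mem_product, Set.mem_ofPred_eq] at h
      simp [h.1.1, h.1.2.1]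
    · rintro ⟨a, b, c⟩ h ⟨a', b', c'⟩ h' he
      simp only [hT1, coe_filter, Set.mem_ofPred_eq] at h h'
      simp only [Prod.mk.injEq] at he ⊢
      refine ⟨he.1, he.2, ?_⟩
      rw [h.2, h'.2, he.1]
  have c2 : T2.card ≤ C.card ^ 2 := by
    rw [sq, ← card_product]
    refine card_le_card_of_injOn (fun q => (q.1, q.2.1)) ?_ ?_
    · rintro ⟨a, b, c⟩ h
      simp only [hT2, hT, coe_filter, mem_product, Set.mem_ofPred_eq] at h
      simp [h.1.1, h.1.2.1]
    · rintro ⟨a, b, c⟩ h ⟨a', b', c'⟩ h' he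
      simp only [hT2, coe_filter, Set.mem_ofPred_eq] at h h'
      simp only [Prod.mk.injEq] at he ⊢
      refine ⟨he.1, he.2, ?_⟩
      rw [h.2, h'.2, he.2]
  have c3 : T3.card ≤ C.card ^ 2 := by
    rw [sq, ← card_product]
    refine card_le_card_of_injOn (fun q => (q.1, q.2.2)) ?_ ?_
    · rintro ⟨a, b, c⟩ h
      simp only [hT3, hT, coe_filter, mem_product, Set.mem_ofPred_eq] at h
      simp [h.1.1, h.1.2.2]
    · rintro ⟨a, b, c⟩ h ⟨a', b', c'⟩ h' he
      simp only [hT3, coe_filter, Set.mem_ofPred_eq] at h h'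
      simp only [Prod.mk.injEq] at he ⊢
      refine ⟨he.1, ?_, he.2⟩
      rw [h.2, h'.2, he.1]
  have c4 : T4.card ≤ (8 * M ^ 2) * C.card := by
    refine card_le_mul_card_image_of_maps_to (f := fun q => q.1) ?_ _ ?_
    · rintro ⟨a, b, c⟩ h
      simp only [hT4, hT, mem_filter, mem_product] at h
      exact h.1.1
    · intro x hx
      obtain ⟨v1, v2, hv1, hv2, hv⟩ := eig_lines (nonscalar_of_tr (b := x) (by rw [hC x hx]; exact ht2))
      have b1 := borel_count C W hC hCi hCW hv1 M (hM v1 hv1)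
      have b2 := borel_count C W hC hCi hCW hv2 M (hM v2 hv2)
      set D1 := C.filter (fixl v1)
      set D2 := C.filter (fixl v2)
      calc (T4.filter (fun q => q.1 = x)).card ≤ ((D1 ×ˢ D1) ∪ (D2 ×ˢ D2)).card := by
            refine card_le_card_of_injOn (fun q => q.2) ?_ ?_
            · rintro ⟨a, b, c⟩ h
              rw [mem_coe, mem_filter, hT4, mem_filter] at h
              obtain ⟨⟨h1, v, hv0, g1, g2, g3⟩, rfl⟩ := h
              simp only [hT, mem_product] at h1
              simp only [coe_union, coe_product, Set.mem_union, Set.mem_prod, mem_coe, D1, D2,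
                mem_filter]
              rcases hv v hv0 g1 with h | h
              · exact Or.inl ⟨⟨h1.2.1, h _ g2⟩, h1.2.2, h _ g3⟩
              · exact Or.inr ⟨⟨h1.2.1, h _ g2⟩, h1.2.2, h _ g3⟩
            · rintro ⟨a, b⟩ h ⟨a', b'⟩ h' he
              rw [mem_coe, mem_filter] at h h'
              exact Prod.ext (h.2.trans h'.2.symm) he
        _ ≤ (D1 ×ˢ D1).card + (D2 ×ˢ D2).card := card_union_le _ _
        _ ≤ (2 * M) * (2 * M) + (2 * M) * (2 * M) := by
            rw [card_product, card_product]; gcongr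
        _ = 8 * M ^ 2 := by ring
  have c5 : Gd.card ≤ 2 * (W ×ˢ W).card := by
    refine card_le_mul_card_image_of_maps_to (f := fun q => (q.1 * q.2.1, q.1 * q.2.2)) ?_ _ ?_
    · rintro ⟨a, b, c⟩ h
      rw [hGd, mem_filter] at h
      simp only [hT, mem_product] at h ⊢
      exact ⟨hCW _ h.1.1 _ h.1.2.1, hCW _ h.1.1 _ h.1.2.2⟩
    · rintro ⟨y, z⟩ _
      by_contra hcon
      rw [not_le, two_lt_card] at hcon
      obtain ⟨⟨a1, a2, a3⟩, ha, ⟨b1, b2, b3⟩, hb, ⟨d1, d2, d3⟩, hd, hab, had, hbd⟩ := hcon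
      simp only [hGd, hT, mem_filter, mem_product, Prod.mk.injEq] at ha hb hd
      obtain ⟨⟨⟨A1, A2, A3⟩, n1, n2, n3, n4⟩, rfl, rfl⟩ := ha
      obtain ⟨⟨⟨B1, B2, B3⟩, -⟩, Be1, Be2⟩ := hb
      obtain ⟨⟨⟨D1, D2, D3⟩, -⟩, De1, De2⟩ := hd
      have B2e : b2 = b1⁻¹ * (a1 * a2) := by rw [← Be1]; group
      have B3e : b3 = b1⁻¹ * (a1 * a3) := by rw [← Be2]; group
      have D2e : d2 = d1⁻¹ * (a1 * a2) := by rw [← De1]; group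
      have D3e : d3 = d1⁻¹ * (a1 * a3) := by rw [← De2]; group
      obtain ⟨v, hv0, f1, f2, f3⟩ := fiber_two t ht a1⁻¹ b1⁻¹ d1⁻¹ (a1 * a2) (a1 * a3)
        (by rw [tr_inv, hC _ A1]) (by rw [inv_mul_cancel_left, hC _ A2])
        (by rw [inv_mul_cancel_left, hC _ A3])
        (by rw [tr_inv, hC _ B1]) (by rw [← B2e, hC _ B2]) (by rw [← B3e, hC _ B3])
        (by rw [tr_inv, hC _ D1]) (by rw [← D2e, hC _ D2]) (by rw [← D3e, hC _ D3])
        (by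
          intro h; rw [inv_inj] at h; apply hab; subst h
          rw [inv_mul_cancel_left] at B2e B3e; rw [B2e, B3e])
        (by
          intro h; rw [inv_inj] at h; apply had; subst h
          rw [inv_mul_cancel_left] at D2e D3e; rw [D2e, D3e])
        (by
          intro h; rw [inv_inj] at h; apply hbd; subst h
          rw [B2e, B3e, D2e, D3e])
        (fun h => n3 (eq_inv_of_mul_eq_one_right h)) (fun h => n1 (eq_inv_of_mul_eq_one_right h))
        (fun h => n2 (mul_left_cancel h))
      apply n4
      have f0 : fixl v a1 := by
        have := (bor v hv0).inv_mem f1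
        rwa [inv_inv] at this
      refine ⟨v, hv0, f0, ?_, ?_⟩
      · have := fixl_mul hv0 f1 f2
        rwa [inv_mul_cancel_left] at this
      · have := fixl_mul hv0 f1 f3
        rwa [inv_mul_cancel_left] at this
  have h1 := card_le_card hcov
  have h2 := card_union_le Gd (T1 ∪ T2 ∪ T3 ∪ T4)
  have h3 := card_union_le (T1 ∪ T2 ∪ T3) T4
  have h4 := card_union_le (T1 ∪ T2) T3
  have h5 := card_union_le T1 T2
  rw [card_product] at c5
  rw [← hTc]
  nlinarith

end sl2

end BG


namespace BG

open Finset Pointwise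

section sl2
variable {F : Type*} [Field F] [Fintype F] [DecidableEq F]

local notation "SL" => Matrix.SpecialLinearGroup (Fin 2) F

lemma escape_span (H : Finset SL) (h1 : 1 ∈ H) (hinv : H⁻¹ = H)
    (hgen : Subgroup.closure (H : Set SL) = ⊤) (g : SL) :
    g.1 ∈ Submodule.span F ((fun x : SL => x.1) '' ((H ^ 3 : Finset SL) : Set SL)) := by
  set V : ℕ → Submodule F (Matrix (Fin 2) (Fin 2) F) := fun i =>
    Submodule.span F ((fun x : SL => x.1) '' ((H ^ i : Finset SL) : Set SL)) with hV
  have hmono : ∀ i j, i ≤ j → V i ≤ V j := fun i j hij =>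
    Submodule.span_mono (Set.image_mono (coe_subset.2 (pow_subset_pow_right h1 hij)))
  have hmul : ∀ i, ∀ s ∈ H, ∀ m ∈ V i, s.1 * m ∈ V (i + 1) := by
    intro i s hs m hm
    induction hm using Submodule.span_induction with
    | mem x hx =>
      obtain ⟨y, hy, rfl⟩ := hx
      refine Submodule.subset_span ⟨s * y, ?_, rfl⟩
      rw [pow_succ']
      exact mem_coe.2 (mul_mem_mul hs (mem_coe.1 hy))
    | zero => rw [mul_zero]; exact Submodule.zero_mem _
    | add x y _ _ hx hy => rw [mul_add]; exact Submodule.add_mem _ hx hy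
    | smul a x _ hx => rw [mul_smul_comm]; exact Submodule.smul_mem _ _ hx
  have hone : (1 : Matrix (Fin 2) (Fin 2) F) ∈ V 0 :=
    Submodule.subset_span ⟨1, by simp, rfl⟩
  have key : ∀ i, i ≤ 3 → V i = V (i + 1) → g.1 ∈ V 3 := by
    intro i hi he
    apply hmono i 3 hi
    have hcl : ∀ x : SL, ∀ m ∈ V i, x.1 * m ∈ V i := by
      intro x
      have hx : x ∈ Subgroup.closure (H : Set SL) := by rw [hgen]; trivial
      induction hx using Subgroup.closure_induction'' with
      | mem x hx => intro m hm; rw [he]; exact hmul i x hx m hm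
      | inv_mem x hx =>
        intro m hm; rw [he]
        refine hmul i _ ?_ m hm
        rw [← hinv]; exact inv_mem_inv hx
      | one => intro m hm; simpa using hm
      | mul x y _ _ hx hy =>
        intro m hm
        rw [Matrix.SpecialLinearGroup.coe_mul, mul_assoc]
        exact hx _ (hy _ hm)
    simpa using hcl g 1 (hmono 0 i (Nat.zero_le _) hone)
  by_contra hcon
  have hlt : ∀ i, i ≤ 3 → Module.finrank F (V i) < Module.finrank F (V (i + 1)) := by
    intro i hi
    apply Submodule.finrank_lt_finrank_of_lt
    exact lt_of_le_of_ne (hmono _ _ (Nat.le_succ i)) (fun h => hcon (key i hi h))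
  have h0 : 0 < Module.finrank F (V 0) := by
    rw [Module.finrank_pos_iff_exists_ne_zero]
    exact ⟨⟨1, hone⟩, fun h => one_ne_zero (congrArg Subtype.val h)⟩
  have h4 : Module.finrank F (V 4) ≤ 4 := by
    refine (Submodule.finrank_le _).trans ?_
    rw [Module.finrank_matrix]; simp
  have a0 := hlt 0 (by norm_num)
  have a1 := hlt 1 (by norm_num)
  have a2 := hlt 2 (by norm_num)
  have a3 := hlt 3 (by norm_num)
  simp only [zero_add, Nat.reduceAdd] at a0 a1 a2 a3
  omega

lemma escape (H : Finset SL) (h1 : 1 ∈ H) (hinv : H⁻¹ = H)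
    (hgen : Subgroup.closure (H : Set SL) = ⊤) (hc : 81 < H.card) :
    ∃ a ∈ H ^ 4, tr a ≠ 0 ∧ tr a ^ 2 ≠ 4 := by
  by_contra hcon
  push Not at hcon
  have hT : ∀ a ∈ H ^ 4, tr a ∈ ({0, 2, -2} : Finset F) := by
    intro a ha
    by_cases h0 : tr a = 0
    · simp [h0]
    · have := hcon a ha h0
      have h2 : (tr a - 2) * (tr a + 2) = 0 := by linear_combination this
      rcases mul_eq_zero.1 h2 with h | h
      · have : tr a = 2 := by linear_combination h
        simp [this]
      · have : tr a = -2 := by linear_combination h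
        simp [this]
  obtain ⟨b, hbs, hbspan, hbli⟩ := exists_linearIndependent F
    ((fun x : SL => x.1) '' ((H ^ 3 : Finset SL) : Set SL))
  have hbfin : b.Finite := Set.Finite.subset (Set.toFinite _) hbs
  have : Fintype b := hbfin.fintype
  have hbcard : Fintype.card b ≤ 4 := by
    have := hbli.fintype_card_le_finrank
    rwa [Module.finrank_matrix, Fintype.card_fin, Module.finrank_self] at this
  have : H.card ≤ (Fintype.piFinset (fun _ : b => ({0, 2, -2} : Finset F))).card := by
    refine card_le_card_of_injOn (fun a w => Matrix.trace (a.1 * w.1)) ?_ ?_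
    · intro a ha
      refine mem_coe.2 (Fintype.mem_piFinset.2 fun w => ?_)
      obtain ⟨y, hy, hyw⟩ := hbs w.2
      have e : Matrix.trace (a.1 * w.1) = tr (a * y) := by
        rw [← hyw, tr, Matrix.trace_fin_two, Matrix.SpecialLinearGroup.coe_mul]
      change Matrix.trace (a.1 * w.1) ∈ _
      rw [e]
      apply hT
      rw [pow_succ']
      exact mul_mem_mul ha hy
    · intro a ha a' ha' he
      have hz : ∀ m ∈ Submodule.span F b, Matrix.trace (a.1 * m) = Matrix.trace (a'.1 * m) := by
        intro m hm
        induction hm using Submodule.span_induction with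
        | mem x hx => exact congrFun he ⟨x, hx⟩
        | zero => simp
        | add x y _ _ hx hy => rw [mul_add, mul_add, Matrix.trace_add, Matrix.trace_add, hx, hy]
        | smul c x _ hx => rw [mul_smul_comm, mul_smul_comm, Matrix.trace_smul, Matrix.trace_smul, hx]
      have hg : ∀ g : SL, tr (a * g) = tr (a' * g) := by
        intro g
        have := hz g.1 (by rw [hbspan]; exact escape_span H h1 hinv hgen g)
        simpa only [Matrix.trace_fin_two, tr, Matrix.SpecialLinearGroup.coe_mul] using this
      have e1 := hg 1
      have e2 := hg (mk2 1 1 0 1 (by ring))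
      have e3 := hg (mk2 1 0 1 1 (by ring))
      have e4 := hg (mk2 2 1 1 1 (by ring))
      simp only [tr, mul00, mul11, mk2_00, mk2_01, mk2_10, mk2_11, one00, one01, one10, one11]
        at e1 e2 e3 e4
      apply sl_ext
      · linear_combination e4 - e2 - e3 + e1
      · linear_combination e3 - e1
      · linear_combination e2 - e1
      · linear_combination 2 * e1 - e4 + e2 + e3 - 2 * e1 
  rw [Fintype.card_piFinset, prod_const, card_univ] at this
  have h3 : ({0, 2, -2} : Finset F).card ≤ 3 := card_le_three
  have : ({0, 2, -2} : Finset F).card ^ Fintype.card b ≤ 3 ^ 4 :=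
    (Nat.pow_le_pow_left h3 _).trans (Nat.pow_le_pow_right (by norm_num) hbcard)
  omega

open Classical in
lemma unip_bound (H : Finset SL)
    (hgen : Subgroup.closure (H : Set SL) = ⊤) :
    ∃ M : ℕ, (∀ v : F × F, v ≠ 0 → ((H ^ 12).filter (fixv v)).card ≤ M) ∧
      M ^ 2 * (M - 1) ≤ (H ^ 38).card := by
  have hne : (univ.filter (fun v : F × F => v ≠ 0)).Nonempty := ⟨(1, 0), by simp⟩
  obtain ⟨v, hv, hmax⟩ := exists_max_image (univ.filter (fun v : F × F => v ≠ 0))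
    (fun v => ((H ^ 12).filter (fixv v)).card) hne
  refine ⟨_, fun w hw => hmax w (mem_filter.2 ⟨mem_univ _, hw⟩), ?_⟩
  have hv0 : v ≠ 0 := (mem_filter.1 hv).2
  have : ∃ g ∈ H, ¬ fixl v g := by
    by_contra hcon
    push Not at hcon
    apply bor_ne_top v hv0
    rw [eq_top_iff, ← hgen, Subgroup.closure_le]
    exact fun g hg => hcon g hg
  obtain ⟨g, hg, hgv⟩ := this
  refine unip_count hv0 _ _ (fun u hu => (mem_filter.1 hu).2) g hgv ?_
  intro u1 h1 u2 h2 u3 h3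
  have e : H ^ 38 = H ^ 12 * H * H ^ 12 * H * H ^ 12 := by
    rw [← pow_succ, ← pow_add, ← pow_succ, ← pow_add]
  rw [e]
  exact mul_mem_mul (mul_mem_mul (mul_mem_mul (mul_mem_mul (mem_filter.1 h1).1 hg)
    (mem_filter.1 h2).1) hg) (mem_filter.1 h3).1

lemma class_num (C M W : ℕ) (X : ℝ) (hX81 : 81 ≤ X) (hQM : ((M ^ 2 * (M - 1) : ℕ) : ℝ) ≤ X)
    (hW' : (W : ℝ) ≤ X)
    (hcc' : (C : ℝ) ^ 3 ≤ 2 * (W : ℝ) ^ 2 + 3 * (C : ℝ) ^ 2 + 8 * C * (M : ℝ) ^ 2) :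
    (C : ℝ) ^ 3 ≤ 64 * X ^ 2 := by
  have hM3 : (M : ℝ) ^ 3 ≤ 2 * X := by
    rcases Nat.lt_or_ge M 2 with h | h
    · have : (M : ℝ) ≤ 1 := by exact_mod_cast Nat.lt_succ_iff.1 h
      have : (M : ℝ) ^ 3 ≤ 1 := pow_le_one₀ (Nat.cast_nonneg _) this
      linarith
    · have h3 : (M : ℝ) ^ 2 * ((M : ℝ) - 1) ≤ X := by
        rwa [Nat.cast_mul, Nat.cast_sub (by omega), Nat.cast_pow, Nat.cast_one] at hQM
      have h4 : (2 : ℝ) ≤ M := by exact_mod_cast h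
      nlinarith [sq_nonneg (M : ℝ)]
  have hCn : (0 : ℝ) ≤ C := Nat.cast_nonneg _
  have hMn : (0 : ℝ) ≤ M := Nat.cast_nonneg _
  by_contra hcon
  push Not at hcon
  have h2M : 2 * (M : ℝ) ^ 2 ≤ C := by
    refine le_of_lt (lt_of_pow_lt_pow_left₀ 3 hCn ?_)
    have : ((M : ℝ) ^ 3) ^ 2 ≤ (2 * X) ^ 2 := pow_le_pow_left₀ (by positivity) hM3 2
    nlinarith [sq_nonneg X]
  have hWs : (W : ℝ) ^ 2 ≤ X ^ 2 := pow_le_pow_left₀ (Nat.cast_nonneg _) hW' 2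
  have h5 : 8 * (C : ℝ) * (M : ℝ) ^ 2 ≤ 4 * (C : ℝ) ^ 2 := by nlinarith
  have h6 : (C : ℝ) ^ 3 < 8 * (C : ℝ) ^ 2 := by
    have : 2 * X ^ 2 < (C : ℝ) ^ 3 / 32 := by linarith
    have : (C : ℝ) ^ 3 * 31 / 32 < 7 * (C : ℝ) ^ 2 := by linarith
    nlinarith [sq_nonneg (C : ℝ)]
  have h7 : (C : ℝ) < 8 := by
    by_contra h
    push Not at h
    nlinarith [sq_nonneg (C : ℝ)]
  have h8 : (C : ℝ) ^ 3 ≤ 8 ^ 3 := pow_le_pow_left₀ hCn h7.le 3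
  nlinarith

lemma class_bound (H : Finset SL) (h1 : 1 ∈ H) (hinv : H⁻¹ = H)
    (hgen : Subgroup.closure (H : Set SL) = ⊤) (Q : ℝ) (hQ1 : 1 ≤ Q)
    (hQ : ((H ^ 38).card : ℝ) ≤ Q * H.card) (hc : 81 < H.card) {t : F} (ht : t ≠ 0)
    (ht2 : t ^ 2 ≠ 4) :
    (((H ^ 6).filter (fun x => tr x = t)).card : ℝ) ^ 3 ≤ 64 * Q ^ 2 * (H.card : ℝ) ^ 2 := by
  classical
  obtain ⟨M, hM, hM2⟩ := unip_bound H hgen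
  have hcc := class_count ht ht2 ((H ^ 6).filter (fun x => tr x = t)) (H ^ 12)
    (fun x hx => (mem_filter.1 hx).2) (by
      intro x hx
      rw [mem_filter] at hx ⊢
      refine ⟨?_, by rw [tr_inv, hx.2]⟩
      have : (H ^ 6)⁻¹ = H ^ 6 := by rw [← inv_pow, hinv]
      rw [← this]; exact inv_mem_inv hx.1) (by
      intro x hx y hy
      rw [show H ^ 12 = H ^ 6 * H ^ 6 by rw [← pow_add]]
      exact mul_mem_mul (mem_filter.1 hx).1 (mem_filter.1 hy).1) M (by
      intro v hv
      convert hM v hv)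
  set C := ((H ^ 6).filter (fun x => tr x = t)).card with hC
  have hW : (H ^ 12).card ≤ (H ^ 38).card := card_le_card (pow_subset_pow_right h1 (by norm_num))
  have hcc' : (C : ℝ) ^ 3 ≤ 2 * ((H ^ 12).card : ℝ) ^ 2 + 3 * (C : ℝ) ^ 2 + 8 * C * (M : ℝ) ^ 2 := by
    exact_mod_cast hcc
  have hQM : ((M ^ 2 * (M - 1) : ℕ) : ℝ) ≤ Q * H.card :=
    le_trans (by exact_mod_cast hM2) hQ
  have hW' : ((H ^ 12).card : ℝ) ≤ Q * H.card := le_trans (by exact_mod_cast hW) hQ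
  have hh : (81 : ℝ) ≤ H.card := by exact_mod_cast hc.le
  have hX : (81 : ℝ) ≤ Q * H.card := by
    clear hcc hcc' hW hW' hM2 hQM hQ
    nlinarith
  have := class_num C M _ (Q * H.card) hX hQM hW' hcc'
  calc (C : ℝ) ^ 3 ≤ 64 * (Q * H.card) ^ 2 := this
    _ = _ := by ring

end sl2
end BG


namespace BG

open Finset Pointwise

section sl2
variable {F : Type*} [Field F] [Fintype F] [DecidableEq F]

local notation "SL" => Matrix.SpecialLinearGroup (Fin 2) F

lemma comm_tr_card (h2 : (2 : F) ≠ 0) {b : SL} (hb : tr b ^ 2 ≠ 4) (Z : Finset SL)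
    (hZ : ∀ x ∈ Z, x * b = b * x) (T : Finset F) (hT : ∀ x ∈ Z, tr x ∈ T) :
    Z.card ≤ 2 * T.card := by
  refine card_le_mul_card_image_of_maps_to hT 2 fun t _ => ?_
  rcases (Z.filter (fun x => tr x = t)).eq_empty_or_nonempty with h | ⟨x, hx⟩
  · rw [h]; simp
  · rw [mem_filter] at hx
    refine (card_le_card (t := {x, x⁻¹}) fun y hy => ?_).trans card_le_two
    rw [mem_filter] at hy
    have := comm_same_tr h2 hb (hZ x hx.1) (hZ y hy.1) (by rw [hx.2, hy.2])
    simpa using this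

lemma tau_big (H : Finset SL) (h1 : 1 ∈ H) (hinv : H⁻¹ = H)
    (hgen : Subgroup.closure (H : Set SL) = ⊤) (Q : ℝ) (hQ1 : 1 ≤ Q)
    (hQ : ((H ^ 38).card : ℝ) ≤ Q * H.card) (hc : 81 < H.card) {b : SL} (hb : b ∈ H ^ 4)
    (ht : tr b ≠ 0) (ht2 : tr b ^ 2 ≠ 4) :
    (H.card : ℝ) ≤ 64 * Q ^ 2 * (((H ^ 2).filter (fun x => x * b = b * x)).card : ℝ) ^ 3 := by
  have hC := class_bound H h1 hinv hgen Q hQ1 hQ hc ht ht2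
  have hle : H.card ≤ ((H ^ 2).filter (fun x => x * b = b * x)).card *
      ((H ^ 6).filter (fun x => tr x = tr b)).card := by
    refine card_le_mul_card_image_of_maps_to (f := fun x => x * b * x⁻¹) ?_ _ ?_
    · intro x hx
      rw [mem_filter]
      refine ⟨?_, tr_conj _ _⟩
      rw [show H ^ 6 = H * H ^ 4 * H by rw [← pow_succ', ← pow_succ]]
      exact mul_mem_mul (mul_mem_mul hx hb) (by rw [← hinv]; exact inv_mem_inv hx)
    · intro c _
      rcases (H.filter (fun x => x * b * x⁻¹ = c)).eq_empty_or_nonempty with h | ⟨x, hx⟩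
      · rw [h]; simp
      · rw [mem_filter] at hx
        refine card_le_card_of_injOn (fun y => x⁻¹ * y) ?_ (by
          intro y _ z _ h
          exact mul_left_cancel h)
        intro y hy
        rw [mem_coe, mem_filter] at hy
        rw [mem_coe, mem_filter]
        constructor
        · rw [pow_two]
          exact mul_mem_mul (by rw [← hinv]; exact inv_mem_inv hx.1) hy.1
        · have e : x * b * x⁻¹ = y * b * y⁻¹ := by rw [hx.2, hy.2]
          have e2 : b = x⁻¹ * (y * b * y⁻¹) * x := by rw [← e]; group
          have e3 : b * (x⁻¹ * y) = x⁻¹ * (y * b * y⁻¹) * x * (x⁻¹ * y) := by rw [← e2]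
          rw [e3]; group
  set τ := ((H ^ 2).filter (fun x => x * b = b * x)).card
  set C := ((H ^ 6).filter (fun x => tr x = tr b)).card
  have hle' : (H.card : ℝ) ≤ τ * C := by exact_mod_cast hle
  have hh : (0 : ℝ) < H.card := by exact_mod_cast (by omega : 0 < H.card)
  have h3 : (H.card : ℝ) ^ 3 ≤ (τ * C) ^ 3 := pow_le_pow_left₀ hh.le hle' 3
  have h4 : (H.card : ℝ) ^ 3 ≤ τ ^ 3 * (64 * Q ^ 2 * (H.card : ℝ) ^ 2) := by
    refine h3.trans ?_
    rw [mul_pow]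
    exact mul_le_mul_of_nonneg_left hC (by positivity)
  have h5 : (H.card : ℝ) ^ 2 * H.card ≤ (H.card : ℝ) ^ 2 * (64 * Q ^ 2 * (τ : ℝ) ^ 3) := by
    linarith [h4]
  exact le_of_mul_le_mul_left h5 (by positivity)

lemma card_SL_ge : Fintype.card F ^ 2 * (Fintype.card F - 1) ≤ Fintype.card SL := by
  have : ((univ : Finset F) ×ˢ (univ : Finset F) ×ˢ (univ.erase (0 : F))).card ≤
      (univ : Finset SL).card := by
    refine card_le_card_of_injOn (fun q => if h : q.2.2 = 0 then 1 else
      mk2 q.2.2 q.1 q.2.1 ((1 + q.1 * q.2.1) / q.2.2) (by field_simp; ring)) (by simp) ?_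
    rintro ⟨a, b, c⟩ h ⟨a', b', c'⟩ h' he
    simp only [coe_product, Set.mem_prod, mem_coe, mem_erase] at h h'
    have hc : c ≠ 0 := h.2.2.1
    have hc' : c' ≠ 0 := h'.2.2.1
    simp only [hc, hc', dif_neg, not_false_eq_true] at he
    have e0 := congrArg (fun x : SL => x.1 0 0) he
    have e1 := congrArg (fun x : SL => x.1 0 1) he
    have e2 := congrArg (fun x : SL => x.1 1 0) he
    simp only [mk2_00, mk2_01, mk2_10] at e0 e1 e2
    rw [e0, e1, e2]
  rw [card_product, card_product, card_erase_of_mem (mem_univ _), card_univ, card_univ] at this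
  calc _ = _ := by ring
    _ ≤ _ := this

/-- product theorem -/
theorem product_thm (h2 : (2 : F) ≠ 0) (H : Finset SL) (h1 : 1 ∈ H) (hinv : H⁻¹ = H)
    (hgen : Subgroup.closure (H : Set SL) = ⊤) (Q : ℝ) (hQ1 : 1 ≤ Q)
    (hQ : ((H ^ 38).card : ℝ) ≤ Q * H.card) (hc : 81 < H.card)
    (hc2 : 64 * 343 * Q ^ 2 < H.card) :
    ((Fintype.card F : ℝ) ^ 2 - Fintype.card F) ^ 3 ≤ 64 * 28 ^ 3 * Q ^ 5 * (H.card : ℝ) ^ 2 := by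
  obtain ⟨a, ha, ha0, ha4⟩ := escape H h1 hinv hgen hc
  have hτ : ∀ b ∈ H ^ 4, tr b ≠ 0 → tr b ^ 2 ≠ 4 →
      7 < ((H ^ 2).filter (fun x => x * b = b * x)).card := by
    intro b hb hb0 hb4
    have := tau_big H h1 hinv hgen Q hQ1 hQ hc hb hb0 hb4
    by_contra hcon
    push Not at hcon
    have h7 : (((H ^ 2).filter (fun x => x * b = b * x)).card : ℝ) ≤ 7 := by exact_mod_cast hcon
    have h8 := pow_le_pow_left₀ (Nat.cast_nonneg _) h7 3
    have : (H.card : ℝ) ≤ 64 * Q ^ 2 * 7 ^ 3 := this.trans (by gcongr)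
    linarith
  -- pivot
  have hpiv : ∀ g : SL, ∃ b ∈ H ^ 4, tr b ≠ 0 ∧ tr b ^ 2 ≠ 4 ∧
      b * (g * a * g⁻¹) = (g * a * g⁻¹) * b := by
    have step : ∀ g ∈ H, ∀ x : SL, (∃ b ∈ H ^ 4, tr b ≠ 0 ∧ tr b ^ 2 ≠ 4 ∧
        b * (x * a * x⁻¹) = (x * a * x⁻¹) * b) → ∃ b ∈ H ^ 4, tr b ≠ 0 ∧ tr b ^ 2 ≠ 4 ∧
        b * ((g * x) * a * (g * x)⁻¹) = ((g * x) * a * (g * x)⁻¹) * b := by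
      rintro g hg x ⟨b, hb, hb0, hb4, hba⟩
      have : ∃ c ∈ (H ^ 2).filter (fun x => x * b = b * x), tr c ≠ 0 ∧ tr c ^ 2 ≠ 4 := by
        by_contra hcon
        push Not at hcon
        have h7 := hτ b hb hb0 hb4
        have := comm_tr_card h2 hb4 ((H ^ 2).filter (fun x => x * b = b * x))
          (fun x hx => (mem_filter.1 hx).2) {0, 2, -2} (by
            intro y hy
            by_cases h0 : tr y = 0
            · simp [h0]
            · have := hcon y hy h0
              have h2 : (tr y - 2) * (tr y + 2) = 0 := by linear_combination this
              rcases mul_eq_zero.1 h2 with h | h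
              · have : tr y = 2 := by linear_combination h
                simp [this]
              · have : tr y = -2 := by linear_combination h
                simp [this])
        have h3 : ({0, 2, -2} : Finset F).card ≤ 3 := card_le_three
        omega
      obtain ⟨c, hc', hc0, hc4⟩ := this
      rw [mem_filter] at hc'
      refine ⟨g * c * g⁻¹, ?_, by rwa [tr_conj], by rwa [tr_conj], ?_⟩
      · rw [show H ^ 4 = H * H ^ 2 * H by rw [← pow_succ', ← pow_succ]]
        exact mul_mem_mul (mul_mem_mul hg hc'.1) (by rw [← hinv]; exact inv_mem_inv hg)
      · have := comm_trans (nonscalar_of_tr hb4) hc'.2 hba.symm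
        calc g * c * g⁻¹ * (g * x * a * (g * x)⁻¹) = g * (c * (x * a * x⁻¹)) * g⁻¹ := by group
          _ = g * ((x * a * x⁻¹) * c) * g⁻¹ := by rw [this]
          _ = _ := by group
    intro g
    have hg : g ∈ Subgroup.closure (H : Set SL) := by rw [hgen]; trivial
    induction hg using Subgroup.closure_induction_left with
    | one => exact ⟨a, ha, ha0, ha4, by simp⟩
    | mul_left x hx y hy ih => exact step x hx y ih
    | inv_mul_cancel x hx y hy ih => exact step _ (by rw [← hinv]; exact inv_mem_inv hx) y ih
  -- many elements in each torus
  have hmany : ∀ g : SL, ((H ^ 2).filter (fun x => x * (g * a * g⁻¹) = (g * a * g⁻¹) * x)).card ^ 3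
      * (64 * Q ^ 2) ≥ H.card ∧
      7 < ((H ^ 2).filter (fun x => x * (g * a * g⁻¹) = (g * a * g⁻¹) * x)).card := by
    intro g
    obtain ⟨b, hb, hb0, hb4, hba⟩ := hpiv g
    have hga : tr (g * a * g⁻¹) ^ 2 ≠ 4 := by rwa [tr_conj]
    have e : (H ^ 2).filter (fun x => x * (g * a * g⁻¹) = (g * a * g⁻¹) * x) =
        (H ^ 2).filter (fun x => x * b = b * x) := by
      apply filter_congr
      intro x _
      exact ⟨fun h => comm_trans (nonscalar_of_tr hga) h hba,
        fun h => comm_trans (nonscalar_of_tr hb4) h hba.symm⟩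
    rw [e]
    refine ⟨?_, hτ b hb hb0 hb4⟩
    have := tau_big H h1 hinv hgen Q hQ1 hQ hc hb hb0 hb4
    linarith
  set sc : SL → Prop := fun b => b.1 0 1 = 0 ∧ b.1 1 0 = 0 ∧ b.1 0 0 = b.1 1 1 with hsc
  have hscd : DecidablePred sc := fun b => by rw [hsc]; infer_instance
  have hscal : ∀ Z : Finset SL, (Z.filter sc).card ≤ 2 := by
    intro Z
    refine (card_le_card (t := {1, mk2 (-1) 0 0 (-1) (by ring)}) fun y hy => ?_).trans card_le_two
    rw [mem_filter, hsc] at hy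
    obtain ⟨-, e1, e2, e3⟩ := hy
    have hd := sl_det y
    rw [e1, e3] at hd
    have : (y.1 1 1 - 1) * (y.1 1 1 + 1) = 0 := by linear_combination hd
    rw [mem_insert, mem_singleton]
    rcases mul_eq_zero.1 this with h | h
    · have : y.1 1 1 = 1 := by linear_combination h
      left; exact sl_ext (by rw [e3, this]; rfl) e1 e2 this
    · have : y.1 1 1 = -1 := by linear_combination h
      right; exact sl_ext (by rw [e3, this]; rfl) e1 e2 this
  set Y := (H ^ 2).filter (fun y => ¬ sc y) with hY
  have hrow : ∀ g : SL, ((H ^ 2).filter (fun x => x * (g * a * g⁻¹) = (g * a * g⁻¹) * x)).card ≤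
      7 * (Y.filter (fun x => x * (g * a * g⁻¹) = (g * a * g⁻¹) * x)).card := by
    intro g
    have h7 := (hmany g).2
    have e := card_filter_add_card_filter_not
      (s := (H ^ 2).filter (fun x => x * (g * a * g⁻¹) = (g * a * g⁻¹) * x)) sc
    have e2 := hscal ((H ^ 2).filter (fun x => x * (g * a * g⁻¹) = (g * a * g⁻¹) * x))
    have e3 : ((H ^ 2).filter (fun x => x * (g * a * g⁻¹) = (g * a * g⁻¹) * x)).filter
        (fun y => ¬ sc y) = Y.filter (fun x => x * (g * a * g⁻¹) = (g * a * g⁻¹) * x) := by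
      rw [hY, filter_filter, filter_filter]
      exact filter_congr fun x _ => and_comm
    rw [e3] at e
    omega
  have hcol : ∀ y ∈ Y, ((univ : Finset SL).filter
      (fun g => y * (g * a * g⁻¹) = (g * a * g⁻¹) * y)).card ≤ 4 * Fintype.card F := by
    intro y hy
    have hys : ¬ sc y := (mem_filter.1 hy).2
    have hZa : ((univ : Finset SL).filter (fun x => x * a = a * x)).card ≤ 2 * Fintype.card F := by
      have := comm_tr_card h2 ha4 ((univ : Finset SL).filter (fun x => x * a = a * x))
        (fun x hx => (mem_filter.1 hx).2) univ (fun _ _ => mem_univ _)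
      simpa using this
    set U := (univ : Finset SL).filter (fun g => y * (g * a * g⁻¹) = (g * a * g⁻¹) * y) with hU
    have himg : (U.image (fun g => g * a * g⁻¹)).card ≤ 2 := by
      rcases U.eq_empty_or_nonempty with h | ⟨g, hg⟩
      · rw [h]; simp
      · rw [hU, mem_filter] at hg
        refine (card_le_card (t := {g * a * g⁻¹, (g * a * g⁻¹)⁻¹}) fun z hz => ?_).trans card_le_two
        obtain ⟨k, hk, rfl⟩ := mem_image.1 hz
        rw [hU, mem_filter] at hk
        have hcomm := comm_trans hys hg.2.symm hk.2.symm
        have := comm_same_tr h2 (b := g * a * g⁻¹) (x := g * a * g⁻¹) (y := k * a * k⁻¹)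
          (by rwa [tr_conj]) rfl hcomm.symm (by rw [tr_conj, tr_conj])
        simpa using this
    have : U.card ≤ (2 * Fintype.card F) * (U.image (fun g => g * a * g⁻¹)).card := by
      refine card_le_mul_card_image_of_maps_to (fun g hg => mem_image_of_mem _ hg) _ ?_
      intro c hc'
      obtain ⟨k, hk, rfl⟩ := mem_image.1 hc'
      refine le_trans (card_le_card_of_injOn (fun g => k⁻¹ * g) ?_ (by
          intro y _ z _ h
          exact mul_left_cancel h)) hZa
      intro g hg
      rw [mem_coe, mem_filter] at hg
      rw [mem_coe, mem_filter]
      refine ⟨mem_univ _, ?_⟩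
      have e2 : a = k⁻¹ * (g * a * g⁻¹) * k := by rw [hg.2]; group
      have e3 : a * (k⁻¹ * g) = k⁻¹ * (g * a * g⁻¹) * k * (k⁻¹ * g) := by rw [← e2]
      rw [e3]; group
    calc U.card ≤ (2 * Fintype.card F) * (U.image (fun g => g * a * g⁻¹)).card := this
      _ ≤ (2 * Fintype.card F) * 2 := Nat.mul_le_mul_left _ himg
      _ = 4 * Fintype.card F := by ring
  -- smallest torus
  obtain ⟨g0, -, hg0⟩ := exists_min_image (univ : Finset SL)
    (fun g => ((H ^ 2).filter (fun x => x * (g * a * g⁻¹) = (g * a * g⁻¹) * x)).card) ⟨1, mem_univ _⟩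
  set τ := ((H ^ 2).filter (fun x => x * (g0 * a * g0⁻¹) = (g0 * a * g0⁻¹) * x)).card with hτdef
  have hdc : Fintype.card SL * τ ≤ 7 * (Y.card * (4 * Fintype.card F)) := by
    calc Fintype.card SL * τ = ∑ g : SL, τ := by rw [sum_const, card_univ, smul_eq_mul]
      _ ≤ ∑ g : SL, 7 * (Y.filter (fun x => x * (g * a * g⁻¹) = (g * a * g⁻¹) * x)).card :=
        sum_le_sum fun g hg => (hg0 g hg).trans (hrow g)
      _ = 7 * ∑ y ∈ Y, ((univ : Finset SL).filter
          (fun g => y * (g * a * g⁻¹) = (g * a * g⁻¹) * y)).card := by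
        rw [← mul_sum]; congr 1
        simp only [card_filter]
        rw [sum_comm]
      _ ≤ 7 * ∑ y ∈ Y, 4 * Fintype.card F := Nat.mul_le_mul_left _ (sum_le_sum hcol)
      _ = _ := by rw [sum_const, smul_eq_mul]
  have hYc : (Y.card : ℝ) ≤ Q * H.card := by
    refine le_trans ?_ hQ
    exact_mod_cast card_le_card ((filter_subset _ _).trans (pow_subset_pow_right h1 (by norm_num)))
  have hτ1 := (hmany g0).1
  rw [← hτdef] at hτ1
  have hG := card_SL_ge (F := F)
  have hq1 : 1 ≤ Fintype.card F := Fintype.card_pos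
  generalize Fintype.card F = q at *
  have hq1' : (1 : ℝ) ≤ q := by exact_mod_cast hq1
  have hG' : (q : ℝ) ^ 2 * (q - 1) ≤ Fintype.card SL := by
    have : ((q ^ 2 * (q - 1) : ℕ) : ℝ) ≤ Fintype.card SL := by exact_mod_cast hG
    rwa [Nat.cast_mul, Nat.cast_sub hq1, Nat.cast_pow, Nat.cast_one] at this
  have hdc' : (Fintype.card SL : ℝ) * τ ≤ 7 * (Y.card * (4 * q)) := by exact_mod_cast hdc
  have hh : (0 : ℝ) < H.card := by exact_mod_cast (by omega : 0 < H.card)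
  have hm : ((q : ℝ) ^ 2 - q) * τ ≤ 28 * (Q * H.card) := by
    have e1 : (q : ℝ) ^ 2 * (q - 1) * τ ≤ 7 * (Y.card * (4 * q)) :=
      le_trans (mul_le_mul_of_nonneg_right hG' (Nat.cast_nonneg _)) hdc'
    have e2 : 7 * ((Y.card : ℝ) * (4 * q)) ≤ 28 * (Q * H.card) * q := by nlinarith
    have e3 : (((q : ℝ) ^ 2 - q) * τ) * q ≤ (28 * (Q * H.card)) * q := by nlinarith
    exact le_of_mul_le_mul_right e3 (by linarith)
  have hq2 : 0 ≤ (q : ℝ) ^ 2 - q := by nlinarith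
  have hm3 := pow_le_pow_left₀ (by positivity) hm 3
  rw [mul_pow] at hm3
  have hfin : ((q : ℝ) ^ 2 - q) ^ 3 * H.card ≤ (64 * 28 ^ 3 * Q ^ 5 * (H.card : ℝ) ^ 2) * H.card := by
    calc ((q : ℝ) ^ 2 - q) ^ 3 * H.card ≤ ((q : ℝ) ^ 2 - q) ^ 3 * (τ ^ 3 * (64 * Q ^ 2)) :=
          mul_le_mul_of_nonneg_left hτ1 (by positivity)
      _ = (((q : ℝ) ^ 2 - q) ^ 3 * τ ^ 3) * (64 * Q ^ 2) := by ring
      _ ≤ (28 * (Q * H.card)) ^ 3 * (64 * Q ^ 2) := mul_le_mul_of_nonneg_right hm3 (by positivity)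
      _ = _ := by ring
  exact le_of_mul_le_mul_right hfin hh

end sl2
end BG


namespace BG

open Finset Pointwise

section classeq

/-- contribution of one class of tori -/
structure Tor (ν q : ℝ) : Prop where
  ex : ∃ τ e : ℕ, 2 ≤ τ ∧ (e = 1 ∨ e = 2) ∧ (e * τ : ℝ) < ν ∧ q * (e * τ) = τ - 1

lemma tor_ge {ν q : ℝ} (h : Tor ν q) : 1 / 4 ≤ q := by
  obtain ⟨τ, e, h2, he, hlt, hq⟩ := h.ex
  have : (2 : ℝ) ≤ τ := by exact_mod_cast h2
  rcases he with rfl | rfl <;> push_cast at hq <;> nlinarith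

lemma tor_cases {ν q : ℝ} (h : Tor ν q) : (∃ τ : ℕ, 2 ≤ τ ∧ (τ : ℝ) < ν ∧ q = 1 - 1 / τ) ∨
    (∃ τ : ℕ, 2 ≤ τ ∧ 2 * (τ : ℝ) < ν ∧ q = 1 / 2 - 1 / (2 * τ)) := by
  obtain ⟨τ, e, h2, he, hlt, hq⟩ := h.ex
  have : (2 : ℝ) ≤ τ := by exact_mod_cast h2
  rcases he with rfl | rfl <;> push_cast at hq hlt
  · left; refine ⟨τ, h2, by linarith, ?_⟩; field_simp; linarith
  · right; refine ⟨τ, h2, by linarith, ?_⟩; field_simp; linarith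

lemma inv_facts {τ : ℕ} (h : 2 ≤ τ) : (0 : ℝ) < 1 / τ ∧ (1 : ℝ) / τ ≤ 1 / 2 := by
  have : (2 : ℝ) ≤ τ := by exact_mod_cast h
  exact ⟨by positivity, one_div_le_one_div_of_le (by norm_num) this⟩

lemma inv_lt_facts {τ : ℕ} {ν c : ℝ} (h : 2 ≤ τ) (hc : 0 < c) (hlt : c * (τ : ℝ) < ν) :
    c / ν < 1 / τ := by
  have : (2 : ℝ) ≤ τ := by exact_mod_cast h
  rw [div_lt_div_iff₀ (by nlinarith) (by linarith)]; linarith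

lemma tor_one {ν a : ℝ} (hν : 60 < ν) (ha : Tor ν a) (h : a = 1 - 1 / ν) : False := by
  have hν' : 1 / ν < 1 / 60 := one_div_lt_one_div_of_lt (by norm_num) hν
  rcases tor_cases ha with ⟨τ, h2, hlt, hq⟩ | ⟨τ, h2, hlt, hq⟩
  · have := inv_lt_facts (c := 1) (ν := ν) h2 one_pos (by linarith); linarith
  · have := (inv_facts h2).1
    have : (0 : ℝ) < 1 / (2 * τ) := by
      have : (2 : ℝ) ≤ τ := by exact_mod_cast h2
      positivity
    linarith

lemma tor_two_aux {ν : ℝ} (hν : 60 < ν) {s t : ℕ} (hs : 2 ≤ s) (ht : 2 ≤ t)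
    (hlt : 2 * (t : ℝ) < ν) (h : (1 - 1 / s : ℝ) + (1 / 2 - 1 / (2 * t)) = 1 - 1 / ν) : False := by
  have hν' : 1 / ν < 1 / 60 := one_div_lt_one_div_of_lt (by norm_num) hν
  have hν0 : 0 < 1 / ν := by positivity
  have e : (1 : ℝ) / (2 * t) = 1 / t / 2 := by rw [div_div, mul_comm]
  rw [e] at h
  have h1 := inv_facts ht
  have h2 := inv_lt_facts ht two_pos hlt
  have e2 : 2 / ν = 2 * (1 / ν) := by ring
  rw [e2] at h2
  rcases (by omega : s = 2 ∨ s = 3 ∨ 4 ≤ s) with rfl | rfl | h4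
  · push_cast at h; linarith
  · push_cast at h
    rcases (by omega : t = 2 ∨ 3 ≤ t) with rfl | h3
    · push_cast at h; linarith
    · have : (1 : ℝ) / t ≤ 1 / 3 := one_div_le_one_div_of_le (by norm_num) (by exact_mod_cast h3)
      linarith
  · have : (1 : ℝ) / s ≤ 1 / 4 := one_div_le_one_div_of_le (by norm_num) (by exact_mod_cast h4)
    linarith

lemma tor_two {ν a b : ℝ} (hν : 60 < ν) (ha : Tor ν a) (hb : Tor ν b) (h : a + b = 1 - 1 / ν) :
    False := by
  have hν0 : 0 < 1 / ν := by positivity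
  rcases tor_cases ha with ⟨s, h2, hlt, rfl⟩ | ⟨s, h2, hlt, rfl⟩ <;>
  rcases tor_cases hb with ⟨t, k2, klt, rfl⟩ | ⟨t, k2, klt, rfl⟩
  · have h1 := inv_facts h2
    have h3 := inv_facts k2
    linarith
  · exact tor_two_aux hν h2 k2 klt h
  · exact tor_two_aux hν k2 h2 hlt (by linarith)
  · have h1 := inv_lt_facts h2 two_pos hlt
    have h3 := inv_lt_facts k2 two_pos klt
    have e : ∀ t : ℕ, (1 : ℝ) / (2 * t) = 1 / t / 2 := fun t => by rw [div_div, mul_comm]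
    rw [e, e] at h
    have e2 : 2 / ν = 2 * (1 / ν) := by ring
    rw [e2] at h1 h3
    linarith

lemma tor_three_aux {ν : ℝ} (hν : 60 < ν) {s t u : ℕ} (hs : 2 ≤ s) (hst : s ≤ t) (htu : t ≤ u)
    (hlt : 2 * (u : ℝ) < ν) (h : (1 : ℝ) / s + 1 / t + 1 / u = 1 + 2 * (1 / ν)) : False := by
  have hν' : 1 / ν < 1 / 60 := one_div_lt_one_div_of_lt (by norm_num) hν
  have hν0 : 0 < 1 / ν := by positivity
  have hu := inv_lt_facts (by omega : 2 ≤ u) two_pos hlt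
  have e2 : 2 / ν = 2 * (1 / ν) := by ring
  rw [e2] at hu
  have le : ∀ k m : ℕ, 0 < k → k ≤ m → (1 : ℝ) / m ≤ 1 / k := fun k m hk hm =>
    one_div_le_one_div_of_le (by exact_mod_cast hk) (by exact_mod_cast hm)
  rcases (by omega : s = 2 ∨ 3 ≤ s) with rfl | h3
  · rcases (by omega : t = 2 ∨ t = 3 ∨ 4 ≤ t) with rfl | rfl | h4
    · push_cast at h; linarith
    · rcases (by omega : u = 3 ∨ u = 4 ∨ u = 5 ∨ 6 ≤ u) with rfl | rfl | rfl | h6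
      · push_cast at h; linarith
      · push_cast at h; linarith
      · push_cast at h; linarith
      · have := le 6 u (by norm_num) h6
        push_cast at h this; linarith
    · have a1 := le 4 t (by norm_num) h4
      have a2 := le 4 u (by norm_num) (by omega)
      push_cast at h a1 a2; linarith
  · have a0 := le 3 s (by norm_num) h3
    have a1 := le 3 t (by norm_num) (by omega)
    have a2 := le 3 u (by norm_num) (by omega)
    push_cast at h a0 a1 a2; linarith

lemma tor_three {ν a b c : ℝ} (hν : 60 < ν) (ha : Tor ν a) (hb : Tor ν b) (hc : Tor ν c)
    (h : a + b + c = 1 - 1 / ν) : False := by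
  have hν0 : 0 < 1 / ν := by positivity
  have ga := tor_ge ha
  have gb := tor_ge hb
  have gc := tor_ge hc
  have e : ∀ t : ℕ, (1 : ℝ) / (2 * t) = 1 / t / 2 := fun t => by rw [div_div, mul_comm]
  rcases tor_cases ha with ⟨s, h2, hlt, rfl⟩ | ⟨s, h2, hlt, rfl⟩
  · linarith [(inv_facts h2).2]
  rcases tor_cases hb with ⟨t, k2, klt, rfl⟩ | ⟨t, k2, klt, rfl⟩
  · linarith [(inv_facts k2).2]
  rcases tor_cases hc with ⟨u, m2, mlt, rfl⟩ | ⟨u, m2, mlt, rfl⟩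
  · linarith [(inv_facts m2).2]
  rw [e, e, e] at h
  have h' : (1 : ℝ) / s + 1 / t + 1 / u = 1 + 2 * (1 / ν) := by linarith
  rcases le_total s t with a1 | a1 <;> rcases le_total t u with a2 | a2 <;>
    rcases le_total s u with a3 | a3
  · exact tor_three_aux hν h2 a1 a2 mlt h'
  · exact tor_three_aux hν h2 a1 a2 mlt h'
  · exact tor_three_aux hν h2 a3 a2 klt (by linarith)
  · exact tor_three_aux hν m2 a3 a1 klt (by linarith)
  · exact tor_three_aux hν k2 a1 a3 mlt (by linarith)
  · exact tor_three_aux hν k2 a2 a3 hlt (by linarith)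
  · exact tor_three_aux hν m2 a2 a1 hlt (by linarith)
  · exact tor_three_aux hν m2 a2 a1 hlt (by linarith)

variable {Γ : Type*} [Group Γ] [Fintype Γ]

/-- noncentral elements whose torus is conjugate to that of `x` -/
def Kset (Z : Subgroup Γ) (x y : Γ) : Prop := y ∉ Z ∧ ∃ g, y * (g * x * g⁻¹) = (g * x * g⁻¹) * y

open Classical in
lemma K_count (Z : Subgroup Γ) (hZ : ∀ z ∈ Z, ∀ g, z * g = g * z)
    (P1 : ∀ x, x ∉ Z → ∀ a b, a * x = x * a → b * x = x * b → a * b = b * a) {x : Γ} (hx : x ∉ Z) :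
    (univ.filter (Kset Z x)).card *
      (univ.filter (fun g => (g * x * g⁻¹) * x = x * (g * x * g⁻¹))).card =
    Fintype.card Γ * (univ.filter (fun y => y * x = x * y ∧ y ∉ Z)).card := by
  have hconj : ∀ g, g * x * g⁻¹ ∉ Z := by
    intro g hg
    apply hx
    have := hZ _ hg g
    have e : x = g * x * g⁻¹ := by
      have h3 : g⁻¹ * (g * x * g⁻¹) * g = g⁻¹ * (g * (g * x * g⁻¹)) := by
        rw [mul_assoc, this]
      simpa [mul_assoc] using h3
    rw [e]; exact hg
  have h1 : ∀ g, (univ.filter (fun y => y ∉ Z ∧ y * (g * x * g⁻¹) = (g * x * g⁻¹) * y)).card =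
      (univ.filter (fun y => y * x = x * y ∧ y ∉ Z)).card := by
    intro g
    refine card_nbij' (fun y => g⁻¹ * y * g) (fun y => g * y * g⁻¹) ?_ ?_ ?_ ?_
    · intro y hy
      simp only [coe_filter, mem_univ, true_and, Set.mem_ofPred_eq] at hy ⊢
      constructor
      · calc g⁻¹ * y * g * x = g⁻¹ * (y * (g * x * g⁻¹)) * g := by group
          _ = g⁻¹ * ((g * x * g⁻¹) * y) * g := by rw [hy.2]
          _ = _ := by group
      · intro h
        apply hy.1
        have e : y = g⁻¹ * y * g := by
          have := hZ _ h g
          have h3 : g * (g⁻¹ * y * g) * g⁻¹ = (g⁻¹ * y * g) * g * g⁻¹ := by rw [this]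
          simpa [mul_assoc] using h3
        rw [e]; exact h
    · intro y hy
      simp only [coe_filter, mem_univ, true_and, Set.mem_ofPred_eq] at hy ⊢
      constructor
      · intro h
        apply hy.2
        have e : y = g * y * g⁻¹ := by
          have := hZ _ h g
          have h3 : g⁻¹ * (g * y * g⁻¹) * g = g⁻¹ * (g * (g * y * g⁻¹)) := by
            rw [mul_assoc, this]
          simpa [mul_assoc] using h3
        rw [e]; exact h
      · calc g * y * g⁻¹ * (g * x * g⁻¹) = g * (y * x) * g⁻¹ := by group
          _ = g * (x * y) * g⁻¹ := by rw [hy.1]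
          _ = _ := by group
    · intro y _; simp [mul_assoc]
    · intro y _; simp [mul_assoc]
  have h2 : ∀ y ∈ univ.filter (Kset Z x),
      (univ.filter (fun g => y * (g * x * g⁻¹) = (g * x * g⁻¹) * y)).card =
      (univ.filter (fun g => (g * x * g⁻¹) * x = x * (g * x * g⁻¹))).card := by
    intro y hy
    obtain ⟨hyZ, g0, hg0⟩ := (mem_filter.1 hy).2
    have hiff : ∀ g, y * (g * x * g⁻¹) = (g * x * g⁻¹) * y ↔
        (g * x * g⁻¹) * (g0 * x * g0⁻¹) = (g0 * x * g0⁻¹) * (g * x * g⁻¹) := fun g =>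
      ⟨fun h => P1 y hyZ _ _ h.symm hg0.symm, fun h => P1 _ (hconj g0) _ _ hg0 h⟩
    have hiff2 : ∀ g, (g * x * g⁻¹) * (g0 * x * g0⁻¹) = (g0 * x * g0⁻¹) * (g * x * g⁻¹) ↔
        ((g0⁻¹ * g) * x * (g0⁻¹ * g)⁻¹) * x = x * ((g0⁻¹ * g) * x * (g0⁻¹ * g)⁻¹) := by
      intro g
      have e1 : (g * x * g⁻¹) * (g0 * x * g0⁻¹) =
        g0 * (((g0⁻¹ * g) * x * (g0⁻¹ * g)⁻¹) * x) * g0⁻¹ := by group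
      have e2 : (g0 * x * g0⁻¹) * (g * x * g⁻¹) =
        g0 * (x * ((g0⁻¹ * g) * x * (g0⁻¹ * g)⁻¹)) * g0⁻¹ := by group
      rw [e1, e2]
      simp only [mul_left_inj, mul_right_inj]
    refine card_nbij' (fun g => g0⁻¹ * g) (fun g => g0 * g) ?_ ?_ ?_ ?_
    · intro g hg
      simp only [coe_filter, mem_univ, true_and, Set.mem_ofPred_eq] at hg ⊢
      exact (hiff2 g).1 ((hiff g).1 hg)
    · intro g hg
      simp only [coe_filter, mem_univ, true_and, Set.mem_ofPred_eq] at hg ⊢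
      refine (hiff _).2 ((hiff2 _).2 ?_)
      simpa using hg
    · intro y _; simp
    · intro y _; simp
  have h3 : ∑ g : Γ, (univ.filter (fun y => y ∉ Z ∧ y * (g * x * g⁻¹) = (g * x * g⁻¹) * y)).card =
      ∑ y ∈ univ.filter (Kset Z x),
        (univ.filter (fun g => y * (g * x * g⁻¹) = (g * x * g⁻¹) * y)).card := by
    have : ∀ g : Γ, (univ.filter (fun y => y ∉ Z ∧ y * (g * x * g⁻¹) = (g * x * g⁻¹) * y)) =
        (univ.filter (Kset Z x)).filter (fun y => y * (g * x * g⁻¹) = (g * x * g⁻¹) * y) := by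
      intro g
      ext y
      simp only [mem_filter, mem_univ, true_and, Kset]
      constructor
      · rintro ⟨a, b⟩; exact ⟨⟨a, g, b⟩, b⟩
      · rintro ⟨⟨a, _⟩, b⟩; exact ⟨a, b⟩
    simp only [this]
    simp only [card_filter _ _]
    rw [sum_comm]
  rw [sum_congr rfl (fun g _ => h1 g), sum_congr rfl h2, sum_const, sum_const, card_univ] at h3
  simpa using h3.symm

end classeq
end BG


namespace BG

open Finset Pointwise

section classeq
variable {Γ : Type*} [Group Γ] [Fintype Γ]

open Classical in
lemma N_card {x : Γ}
    (P2 : ∀ g, (g * x * g⁻¹) * x = x * (g * x * g⁻¹) → g * x * g⁻¹ = x ∨ g * x * g⁻¹ = x⁻¹) :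
    (univ.filter (fun g => (g * x * g⁻¹) * x = x * (g * x * g⁻¹))).card =
      (univ.filter (fun g => g * x = x * g)).card ∨
    (univ.filter (fun g => (g * x * g⁻¹) * x = x * (g * x * g⁻¹))).card =
      2 * (univ.filter (fun g => g * x = x * g)).card := by
  have hcx : ∀ g, g * x = x * g ↔ g * x * g⁻¹ = x := fun g => by
    rw [mul_inv_eq_iff_eq_mul]
  by_cases h : ∃ g0, g0 * x * g0⁻¹ = x⁻¹ ∧ x⁻¹ ≠ x
  · right
    obtain ⟨g0, hg0, hne⟩ := h
    have e : univ.filter (fun g => (g * x * g⁻¹) * x = x * (g * x * g⁻¹)) =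
        univ.filter (fun g => g * x = x * g) ∪ univ.filter (fun g => g * x * g⁻¹ = x⁻¹) := by
      ext g
      simp only [mem_filter, mem_union, mem_univ, true_and]
      constructor
      · intro hg
        rcases P2 g hg with h | h
        · left; rwa [hcx]
        · right; exact h
      · rintro (h | h)
        · rw [hcx] at h; rw [h]
        · rw [h]; simp
    have hd : Disjoint (univ.filter (fun g => g * x = x * g))
        (univ.filter (fun g => g * x * g⁻¹ = x⁻¹)) := by
      rw [disjoint_filter]
      intro g _ h1 h2
      rw [hcx] at h1
      exact hne (by rw [← h2, h1])
    rw [e, card_union_of_disjoint hd, two_mul]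
    congr 1
    refine card_nbij' (fun g => g0⁻¹ * g) (fun g => g0 * g) ?_ ?_ ?_ ?_
    · intro g hg
      simp only [coe_filter, mem_univ, true_and, Set.mem_ofPred_eq] at hg ⊢
      rw [hcx]
      calc g0⁻¹ * g * x * (g0⁻¹ * g)⁻¹ = g0⁻¹ * (g * x * g⁻¹) * g0 := by group
        _ = g0⁻¹ * (g0 * x * g0⁻¹) * g0 := by rw [hg, hg0]
        _ = x := by group
    · intro g hg
      simp only [coe_filter, mem_univ, true_and, Set.mem_ofPred_eq] at hg ⊢
      rw [hcx] at hg
      calc g0 * g * x * (g0 * g)⁻¹ = g0 * (g * x * g⁻¹) * g0⁻¹ := by group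
        _ = x⁻¹ := by rw [hg, hg0]
    · intro y _; simp
    · intro y _; simp
  · left
    congr 1
    ext g
    simp only [mem_filter, mem_univ, true_and]
    constructor
    · intro hg
      rw [hcx]
      rcases P2 g hg with h' | h'
      · exact h'
      · by_contra hne
        exact h ⟨g, h', fun h4 => hne (by rw [h', h4])⟩
    · intro h; rw [hcx] at h; rw [h]

lemma K_disj (Z : Subgroup Γ)
    (P1 : ∀ x, x ∉ Z → ∀ a b, a * x = x * a → b * x = x * b → a * b = b * a) {x1 x2 y : Γ}
    (hx2 : x2 ∉ Z) (h : ¬ Kset Z x1 x2) (h1 : Kset Z x1 y) (h2 : Kset Z x2 y) : False := by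
  obtain ⟨hy, g, hg⟩ := h1
  obtain ⟨-, k, hk⟩ := h2
  have := P1 y hy _ _ hg.symm hk.symm
  refine h ⟨hx2, k⁻¹ * g, ?_⟩
  calc x2 * (k⁻¹ * g * x1 * (k⁻¹ * g)⁻¹) = k⁻¹ * ((k * x2 * k⁻¹) * (g * x1 * g⁻¹)) * k := by group
    _ = k⁻¹ * ((g * x1 * g⁻¹) * (k * x2 * k⁻¹)) * k := by rw [this]
    _ = _ := by group

lemma K_self (Z : Subgroup Γ) {x : Γ} (hx : x ∉ Z) : Kset Z x x := ⟨hx, 1, by simp⟩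

open Classical in
/-- class equation lemma -/
theorem class_lemma (Z : Subgroup Γ) (hZ : ∀ z ∈ Z, ∀ g, z * g = g * z)
    (P1 : ∀ x, x ∉ Z → ∀ a b, a * x = x * a → b * x = x * b → a * b = b * a)
    (P2 : ∀ x, x ∉ Z → ∀ g, (g * x * g⁻¹) * x = x * (g * x * g⁻¹) →
      g * x * g⁻¹ = x ∨ g * x * g⁻¹ = x⁻¹) :
    Fintype.card Γ ≤ 60 * (univ.filter (fun x => x ∈ Z)).card ∨ (∀ x, x ∈ Z) ∨
      ∃ x, x ∉ Z ∧ ∀ g, g * x * g⁻¹ = x ∨ g * x * g⁻¹ = x⁻¹ := by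
  by_contra hcon
  push Not at hcon
  obtain ⟨hn, ⟨x1, hx1⟩, hnn⟩ := hcon
  set z := (univ.filter (fun x => x ∈ Z)).card with hz
  set n := Fintype.card Γ with hn'
  have hz0 : 0 < z := card_pos.2 ⟨1, by simp [Z.one_mem]⟩
  have hzc : z = Nat.card Z := by
    rw [hz, Nat.card_eq_fintype_card, Fintype.card_subtype]
  have hz0' : (0 : ℝ) < z := by exact_mod_cast hz0
  set ν : ℝ := (n : ℝ) / z with hν
  have hν60 : 60 < ν := by
    rw [hν, lt_div_iff₀ hz0']; exact_mod_cast hn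
  have hn0 : (0 : ℝ) < n := by
    have : 0 < n := by omega
    exact_mod_cast this
  have htor : ∀ x, x ∉ Z → Tor ν (((univ.filter (Kset Z x)).card : ℝ) / n) := by
    intro x hx
    have hk := K_count Z hZ P1 hx
    have hN := N_card (P2 x hx)
    set a := (univ.filter (fun g => g * x = x * g)).card with ha
    set N := (univ.filter (fun g => (g * x * g⁻¹) * x = x * (g * x * g⁻¹))).card with hNd
    set k := (univ.filter (Kset Z x)).card
    have hNlt : N < n := by
      rw [hn', ← card_univ]
      apply card_lt_card
      rw [filter_ssubset]
      obtain ⟨g, hg1, hg2⟩ := hnn x hx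
      refine ⟨g, mem_univ _, fun h => ?_⟩
      rcases P2 x hx g h with h | h
      · exact hg1 h
      · exact hg2 h
    have hsum : (univ.filter (fun y => y * x = x * y ∧ y ∉ Z)).card + z = a := by
      rw [hz, ha, ← card_union_of_disjoint]
      · congr 1
        ext y
        simp only [mem_filter, mem_union, mem_univ, true_and]
        by_cases hy : y ∈ Z
        · simp [hy, hZ y hy x]
        · simp [hy]
      · rw [disjoint_filter]
        intro y _ h1 h2
        exact h1.2 h2
    have hpos : 0 < (univ.filter (fun y => y * x = x * y ∧ y ∉ Z)).card :=
      card_pos.2 ⟨x, by simp [hx]⟩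
    have hdvd : z ∣ a := by
      have hle : Z ≤ Subgroup.centralizer {x} := by
        intro y hy
        rw [Subgroup.mem_centralizer_singleton_iff]
        exact hZ y hy x
      have := Subgroup.card_dvd_of_le hle
      have ea : a = Nat.card (Subgroup.centralizer {x}) := by
        rw [ha, Nat.card_eq_fintype_card, Fintype.card_subtype]
        congr 1
        ext y
        simp only [mem_filter, mem_univ, true_and, Subgroup.mem_centralizer_singleton_iff]
      rwa [ea, hzc]
    obtain ⟨τ, hτ⟩ := hdvd
    have hτ2 : 2 ≤ τ := by
      by_contra hlt
      have : τ ≤ 1 := by omega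
      have : z * τ ≤ z := by nlinarith
      omega
    have hk' : (k : ℝ) * N = n * (z * τ - z) := by
      have : (univ.filter (fun y => y * x = x * y ∧ y ∉ Z)).card = a - z := by omega
      rw [this] at hk
      have h2 : ((k * N : ℕ) : ℝ) = ((n * (a - z) : ℕ) : ℝ) := by exact_mod_cast hk
      rw [Nat.cast_mul, Nat.cast_mul, Nat.cast_sub (by omega), hτ, Nat.cast_mul] at h2
      exact h2
    have key : ∀ e : ℕ, N = e * a → (e * τ : ℝ) < ν ∧ ((k : ℝ) / n) * (e * τ) = τ - 1 := by
      intro e he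
      have hNr : (N : ℝ) = e * (z * τ) := by rw [he, hτ]; push_cast; ring
      constructor
      · rw [hν, lt_div_iff₀ hz0']
        have : (N : ℝ) < n := by exact_mod_cast hNlt
        rw [hNr] at this; linarith
      · rw [hNr] at hk'
        have : (k : ℝ) * (e * τ) = n * (τ - 1) := by
          apply mul_left_cancel₀ hz0'.ne'
          linear_combination hk'
        field_simp
        linear_combination this
    rcases hN with h | h
    · exact ⟨τ, 1, hτ2, Or.inl rfl, key 1 (by omega)⟩
    · exact ⟨τ, 2, hτ2, Or.inr rfl, key 2 (by omega)⟩
  have hcardW : (univ.filter (fun x => x ∉ Z)).card + z = n := by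
    rw [hz, add_comm, hn', ← card_univ]
    exact card_filter_add_card_filter_not (s := (univ : Finset Γ)) (fun x => x ∈ Z)
  have hWr : ((univ.filter (fun x => x ∉ Z)).card : ℝ) / n = 1 - 1 / ν := by
    have : ((univ.filter (fun x => x ∉ Z)).card : ℝ) = n - z := by
      rw [← hcardW]; push_cast; ring
    rw [this, hν]; field_simp
  have hν0 : 0 < 1 / ν := by positivity
  set K : Γ → Finset Γ := fun x => univ.filter (Kset Z x) with hK
  have hKW : ∀ x, K x ⊆ univ.filter (fun x => x ∉ Z) := fun x y hy => by
    simp only [hK, mem_filter, mem_univ, true_and] at hy ⊢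
    exact hy.1
  have hdis : ∀ x x', x' ∉ Z → x' ∉ K x → Disjoint (K x) (K x') := by
    intro x x' h1 h2
    rw [disjoint_left]
    intro y hy hy'
    simp only [hK, mem_filter, mem_univ, true_and] at hy hy' h2
    exact K_disj Z P1 h1 h2 hy hy'
  by_cases c1 : univ.filter (fun x => x ∉ Z) ⊆ K x1
  · have e := subset_antisymm (hKW x1) c1
    rw [← e] at hWr
    exact tor_one hν60 (htor x1 hx1) hWr
  obtain ⟨x2, hx2, hx21⟩ := not_subset.1 c1
  replace hx2 : x2 ∉ Z := (mem_filter.1 hx2).2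
  have d12 := hdis x1 x2 hx2 hx21
  by_cases c2 : univ.filter (fun x => x ∉ Z) ⊆ K x1 ∪ K x2
  · have e := subset_antisymm (union_subset (hKW x1) (hKW x2)) c2
    rw [← e, card_union_of_disjoint d12, Nat.cast_add, add_div] at hWr
    exact tor_two hν60 (htor x1 hx1) (htor x2 hx2) hWr
  obtain ⟨x3, hx3, hx31⟩ := not_subset.1 c2
  replace hx3 : x3 ∉ Z := (mem_filter.1 hx3).2
  rw [mem_union, not_or] at hx31
  have d3 : Disjoint (K x1 ∪ K x2) (K x3) :=
    disjoint_union_left.2 ⟨hdis x1 x3 hx3 hx31.1, hdis x2 x3 hx3 hx31.2⟩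
  by_cases c3 : univ.filter (fun x => x ∉ Z) ⊆ K x1 ∪ K x2 ∪ K x3
  · have e := subset_antisymm (union_subset (union_subset (hKW x1) (hKW x2)) (hKW x3)) c3
    rw [← e, card_union_of_disjoint d3, card_union_of_disjoint d12, Nat.cast_add, Nat.cast_add,
      add_div, add_div] at hWr
    exact tor_three hν60 (htor x1 hx1) (htor x2 hx2) (htor x3 hx3) hWr
  obtain ⟨x4, hx4, hx41⟩ := not_subset.1 c3
  replace hx4 : x4 ∉ Z := (mem_filter.1 hx4).2
  rw [mem_union, mem_union, not_or, not_or] at hx41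
  have d4 : Disjoint (K x1 ∪ K x2 ∪ K x3) (K x4) :=
    disjoint_union_left.2 ⟨disjoint_union_left.2 ⟨hdis x1 x4 hx4 hx41.1.1,
      hdis x2 x4 hx4 hx41.1.2⟩, hdis x3 x4 hx4 hx41.2⟩
  have hle := card_le_card (union_subset (union_subset (union_subset (hKW x1) (hKW x2)) (hKW x3))
    (hKW x4))
  rw [card_union_of_disjoint d4, card_union_of_disjoint d3, card_union_of_disjoint d12] at hle
  have hle' : (((K x1).card : ℝ) + (K x2).card + (K x3).card + (K x4).card) / n ≤
      ((univ.filter (fun x => x ∉ Z)).card : ℝ) / n := by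
    apply div_le_div_of_nonneg_right _ hn0.le
    exact_mod_cast hle
  rw [hWr, add_div, add_div, add_div] at hle'
  have g1 := tor_ge (htor x1 hx1)
  have g2 := tor_ge (htor x2 hx2)
  have g3 := tor_ge (htor x3 hx3)
  have g4 := tor_ge (htor x4 hx4)
  linarith

end classeq
end BG


namespace BG

open Finset Pointwise

section dickson
variable {p : ℕ} [Fact p.Prime]

local notation "SL" => Matrix.SpecialLinearGroup (Fin 2) (ZMod p)

/-- upper unipotent -/
def up (b : ZMod p) : Matrix.SpecialLinearGroup (Fin 2) (ZMod p) := mk2 1 b 0 1 (by ring)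
/-- lower unipotent -/
def lo (b : ZMod p) : Matrix.SpecialLinearGroup (Fin 2) (ZMod p) := mk2 1 0 b 1 (by ring)

lemma up_mul (a b : ZMod p) : up a * up b = up (a + b) := by
  apply sl_ext <;> simp only [up, mul00, mul01, mul10, mul11, mk2_00, mk2_01, mk2_10, mk2_11] <;> ring
lemma lo_mul (a b : ZMod p) : lo a * lo b = lo (a + b) := by
  apply sl_ext <;> simp only [lo, mul00, mul01, mul10, mul11, mk2_00, mk2_01, mk2_10, mk2_11] <;> ring
lemma up_zero : up (0 : ZMod p) = 1 := by
  apply sl_ext <;> simp [up, one00, one01, one10, one11]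
lemma lo_zero : lo (0 : ZMod p) = 1 := by
  apply sl_ext <;> simp [lo, one00, one01, one10, one11]
lemma up_pow (b : ZMod p) (n : ℕ) : up b ^ n = up ((n : ZMod p) * b) := by
  induction n with
  | zero => simp [up_zero]
  | succ n ih => rw [pow_succ, ih, up_mul]; push_cast; congr 1; ring
lemma lo_pow (b : ZMod p) (n : ℕ) : lo b ^ n = lo ((n : ZMod p) * b) := by
  induction n with
  | zero => simp [lo_zero]
  | succ n ih => rw [pow_succ, ih, lo_mul]; push_cast; congr 1; ring

lemma up_all (H : Subgroup SL) {b : ZMod p} (hb : b ≠ 0) (h : up b ∈ H) (c : ZMod p) :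
    up c ∈ H := by
  have := H.pow_mem h (c / b).val
  rw [up_pow, ZMod.natCast_val, ZMod.cast_id', id, div_mul_cancel₀ _ hb] at this
  exact this
lemma lo_all (H : Subgroup SL) {b : ZMod p} (hb : b ≠ 0) (h : lo b ∈ H) (c : ZMod p) :
    lo c ∈ H := by
  have := H.pow_mem h (c / b).val
  rw [lo_pow, ZMod.natCast_val, ZMod.cast_id', id, div_mul_cancel₀ _ hb] at this
  exact this

lemma uplo_top (H : Subgroup SL) (hu : ∀ c, up c ∈ H) (hl : ∀ c, lo c ∈ H) : H = ⊤ := by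
  have key : ∀ g : SL, g.1 1 0 ≠ 0 → g ∈ H := by
    intro g hg
    have hd := sl_det g
    have : g = up ((g.1 0 0 - 1) / g.1 1 0) * lo (g.1 1 0) * up ((g.1 1 1 - 1) / g.1 1 0) := by
      apply sl_ext <;>
        simp only [up, lo, mul00, mul01, mul10, mul11, mk2_00, mk2_01, mk2_10, mk2_11]
      · field_simp; ring
      · field_simp; linear_combination -hd
      · ring
      · field_simp; ring
    rw [this]
    exact H.mul_mem (H.mul_mem (hu _) (hl _)) (hu _)
  rw [eq_top_iff]
  intro g _
  by_cases hg : g.1 1 0 = 0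
  · have hd := sl_det g
    rw [hg] at hd
    have h1 : g.1 1 1 ≠ 0 := by
      intro h; rw [h] at hd; simp at hd
    have h2 : g * lo 1 ∈ H := by
      apply key
      simp only [lo, mul10, mk2_00, mk2_10]
      rw [hg]; simpa using h1
    have := H.mul_mem h2 (H.inv_mem (hl 1))
    simpa using this
  · exact key g hg

lemma two_unip (H : Subgroup SL) {v : ZMod p × ZMod p} (hv : v ≠ 0) {u g : SL} (hu : u ∈ H)
    (hu1 : u ≠ 1) (huv : fixv v u) (hg : g ∈ H) (hgv : ¬ fixl v g) : H = ⊤ := by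
  unfold fixl at hgv
  set x := g.1 0 0 * v.1 + g.1 0 1 * v.2 with hx
  set y := g.1 1 0 * v.1 + g.1 1 1 * v.2 with hy
  have hD : v.1 * y - v.2 * x ≠ 0 := fun h => hgv (by linear_combination h)
  set D := v.1 * y - v.2 * x with hDd
  set k : SL := mk2 v.1 (x / D) v.2 (y / D) (by field_simp; rw [hDd]; ring) with hk
  have hf := fixv_conj (k := k) (v := v) rfl rfl huv
  obtain ⟨b, hb⟩ : ∃ b, k⁻¹ * u * k = up b := by
    refine ⟨(k⁻¹ * u * k).1 0 1, ?_⟩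
    obtain ⟨a1, a2⟩ := hf
    simp only [mul_one, mul_zero, add_zero] at a1 a2
    have da := sl_det (k⁻¹ * u * k)
    rw [a1, a2] at da
    exact sl_ext a1 rfl a2 (by simp only [up, mk2_11]; linear_combination da)
  have hb0 : b ≠ 0 := by
    rintro rfl
    rw [up_zero] at hb
    apply hu1
    have : u = k * (k⁻¹ * u * k) * k⁻¹ := by group
    rw [this, hb]; group
  set g' := k⁻¹ * g * k with hg'
  have hg00 : g'.1 0 0 = 0 := by
    rw [hg', hk]
    simp only [mul00, mul01, mul10, mul11, inv00, inv01, inv10, inv11, mk2_00, mk2_01, mk2_10, mk2_11]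
    rw [hx, hy]
    field_simp; ring
  have hd := sl_det g'
  rw [hg00] at hd
  have hg10 : g'.1 1 0 ≠ 0 := by
    intro h; rw [h] at hd; simp at hd
  set H' : Subgroup SL := H.comap (MulAut.conj k).toMonoidHom with hH'
  have mem' : ∀ z, z ∈ H' ↔ k * z * k⁻¹ ∈ H := fun z => by
    rw [hH', Subgroup.mem_comap]; rfl
  have m1 : up b ∈ H' := by
    rw [mem', ← hb]
    have : k * (k⁻¹ * u * k) * k⁻¹ = u := by group
    rwa [this]
  have m2 : g' ∈ H' := by
    rw [mem', hg']
    have : k * (k⁻¹ * g * k) * k⁻¹ = g := by group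
    rwa [this]
  have m3 : lo (-(g'.1 1 0) ^ 2 * b) ∈ H' := by
    have : lo (-(g'.1 1 0) ^ 2 * b) = g' * up b * g'⁻¹ := by
      apply sl_ext <;> simp only [up, lo, mul00, mul01, mul10, mul11, inv00, inv01, inv10, inv11,
        mk2_00, mk2_01, mk2_10, mk2_11, hg00]
      · linear_combination -hd
      · ring
      · ring
      · linear_combination -hd
    rw [this]
    exact H'.mul_mem (H'.mul_mem m2 m1) (H'.inv_mem m2)
  have top := uplo_top H' (up_all H' hb0 m1)
    (lo_all H' (mul_ne_zero (neg_ne_zero.2 (pow_ne_zero 2 hg10)) hb0) m3)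
  rw [eq_top_iff]
  intro z _
  have : k⁻¹ * z * k ∈ H' := by rw [top]; trivial
  rw [mem'] at this
  have e : k * (k⁻¹ * z * k) * k⁻¹ = z := by group
  rwa [e] at this

lemma fixv_comm {v : ZMod p × ZMod p} (hv : v ≠ 0) {u w : SL} (hu : fixv v u) (hw : fixv v w) :
    u * w = w * u := by
  obtain ⟨k, k0, k1⟩ := exists_col hv
  have aux : ∀ u : SL, fixv v u → ∃ b, k⁻¹ * u * k = up b := by
    intro u hu
    refine ⟨(k⁻¹ * u * k).1 0 1, ?_⟩
    obtain ⟨a1, a2⟩ := fixv_conj k0 k1 hu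
    simp only [mul_one, mul_zero, add_zero] at a1 a2
    have da := sl_det (k⁻¹ * u * k)
    rw [a1, a2] at da
    exact sl_ext a1 rfl a2 (by simp only [up, mk2_11]; linear_combination da)
  obtain ⟨b, hb⟩ := aux u hu
  obtain ⟨c, hc⟩ := aux w hw
  calc u * w = k * ((k⁻¹ * u * k) * (k⁻¹ * w * k)) * k⁻¹ := by group
    _ = k * ((k⁻¹ * w * k) * (k⁻¹ * u * k)) * k⁻¹ := by rw [hb, hc, up_mul, up_mul, add_comm]
    _ = _ := by group

lemma bor_comm {v : ZMod p × ZMod p} (hv : v ≠ 0) {a b : SL} (ha : fixl v a) (hb : fixl v b) :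
    fixv v (a * b * a⁻¹ * b⁻¹) := by
  have ha' : fixl v a⁻¹ := (bor v hv).inv_mem ha
  have hb' : fixl v b⁻¹ := (bor v hv).inv_mem hb
  obtain ⟨α, a1, a2⟩ := (fixl_iff hv _).1 ha'
  obtain ⟨β, b1, b2⟩ := (fixl_iff hv _).1 hb'
  have hα : α ≠ 0 := by
    have := eig_root hv a1 a2
    rintro rfl; simp at this
  have hβ : β ≠ 0 := by
    have := eig_root hv b1 b2
    rintro rfl; simp at this
  have e : a * b * a⁻¹ * b⁻¹ = (b⁻¹ * a⁻¹)⁻¹ * (a⁻¹ * b⁻¹) := by group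
  rw [e]
  refine fixv_inv_mul (c := α * β) (mul_ne_zero hα hβ) ?_ ?_ ?_ ?_ <;>
    simp only [mul00, mul01, mul10, mul11]
  · linear_combination b⁻¹.1 0 0 * a1 + b⁻¹.1 0 1 * a2 + α * b1
  · linear_combination b⁻¹.1 1 0 * a1 + b⁻¹.1 1 1 * a2 + α * b2
  · linear_combination a⁻¹.1 0 0 * b1 + a⁻¹.1 0 1 * b2 + β * a1
  · linear_combination a⁻¹.1 1 0 * b1 + a⁻¹.1 1 1 * b2 + β * a2

lemma unip_vec {u : SL} (hu : u ≠ 1) (ht : tr u = 2) : ∃ v : ZMod p × ZMod p, v ≠ 0 ∧ fixv v u := by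
  have hd := sl_det u
  rw [tr] at ht
  by_cases h : u.1 0 1 = 0 ∧ u.1 0 0 = 1
  · refine ⟨(0, 1), by simp, ?_, ?_⟩
    · simp [h.1]
    · simp; linear_combination ht - h.2
  · refine ⟨(u.1 0 1, 1 - u.1 0 0), ?_, ?_, ?_⟩
    · intro h'
      rw [Prod.mk_eq_zero] at h'
      exact h ⟨h'.1, by linear_combination -h'.2⟩
    · simp only; ring
    · simp only; linear_combination ht - hd

/-- subgroup of scalar matrices -/
def scal (p : ℕ) [Fact p.Prime] : Subgroup (Matrix.SpecialLinearGroup (Fin 2) (ZMod p)) where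
  carrier := {b | b.1 0 1 = 0 ∧ b.1 1 0 = 0 ∧ b.1 0 0 = b.1 1 1}
  one_mem' := ⟨rfl, rfl, rfl⟩
  mul_mem' := by
    rintro a b ⟨a1, a2, a3⟩ ⟨b1, b2, b3⟩
    refine ⟨?_, ?_, ?_⟩
    · rw [mul01, a1, b1]; ring
    · rw [mul10, a2, b2]; ring
    · rw [mul00, mul11, a1, a2, a3, b3]; ring
  inv_mem' := by
    rintro a ⟨a1, a2, a3⟩
    refine ⟨?_, ?_, ?_⟩
    · rw [inv01, a1]; ring
    · rw [inv10, a2]; ring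
    · rw [inv00, inv11, a3]

lemma mem_scal {b : SL} : b ∈ scal p ↔ b.1 0 1 = 0 ∧ b.1 1 0 = 0 ∧ b.1 0 0 = b.1 1 1 := Iff.rfl

lemma scal_comm {b : SL} (hb : b ∈ scal p) (g : SL) : b * g = g * b := by
  obtain ⟨a1, a2, a3⟩ := mem_scal.1 hb
  apply sl_ext <;> simp only [mul00, mul01, mul10, mul11, a1, a2, a3] <;> ring

lemma scal_pm {y : SL} (hy : y ∈ scal p) : y = 1 ∨ y = mk2 (-1) 0 0 (-1) (by ring) := by
  obtain ⟨e1, e2, e3⟩ := mem_scal.1 hy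
  have hd := sl_det y
  rw [e1, e3] at hd
  have : (y.1 1 1 - 1) * (y.1 1 1 + 1) = 0 := by linear_combination hd
  rcases mul_eq_zero.1 this with h | h
  · have : y.1 1 1 = 1 := by linear_combination h
    left; exact sl_ext (by rw [e3, this]; rfl) e1 e2 this
  · have : y.1 1 1 = -1 := by linear_combination h
    right; exact sl_ext (by rw [e3, this]; rfl) e1 e2 this

open Classical in
/-- weak form of Dickson's theorem -/
theorem dickson (h2 : (2 : ZMod p) ≠ 0) (H : Subgroup SL) (hH : H ≠ ⊤) :
    Nat.card H ≤ 120 ∨ ∀ a ∈ H, ∀ b ∈ H, ∀ c ∈ H, ∀ d ∈ H,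
      (a * b * a⁻¹ * b⁻¹) * (c * d * c⁻¹ * d⁻¹) = (c * d * c⁻¹ * d⁻¹) * (a * b * a⁻¹ * b⁻¹) := by
  by_cases hu : ∃ x ∈ H, x ∉ scal p ∧ tr x ^ 2 = 4
  · right
    obtain ⟨x, hx, hxs, ht⟩ := hu
    have : ∃ u ∈ H, u ≠ 1 ∧ tr u = 2 := by
      have h3 : (tr x - 2) * (tr x + 2) = 0 := by linear_combination ht
      rcases mul_eq_zero.1 h3 with h | h
      · exact ⟨x, hx, fun h => hxs (by rw [h]; exact (scal p).one_mem), by linear_combination h⟩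
      · have ht' : x.1 0 0 + x.1 1 1 = -2 := by rw [tr] at h; linear_combination h
        have hd := sl_det x
        refine ⟨x * x, H.mul_mem hx hx, fun h1 => hxs ?_, ?_⟩
        · have e0 : (x * x).1 0 0 = 1 := by rw [h1]; rfl
          have e1 : (x * x).1 0 1 = 0 := by rw [h1]; rfl
          have e2 : (x * x).1 1 0 = 0 := by rw [h1]; rfl
          have e3 : (x * x).1 1 1 = 1 := by rw [h1]; rfl
          rw [mul00] at e0
          rw [mul01] at e1
          rw [mul10] at e2
          rw [mul11] at e3
          refine mem_scal.2 ⟨?_, ?_, ?_⟩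
          · apply mul_left_cancel₀ h2
            linear_combination -e1 + x.1 0 1 * ht'
          · apply mul_left_cancel₀ h2
            linear_combination -e2 + x.1 1 0 * ht'
          · apply mul_left_cancel₀ h2
            linear_combination -e0 + e3 + (x.1 0 0 - x.1 1 1) * ht'
        · rw [tr, mul00, mul11]
          linear_combination -2 * hd + (x.1 0 0 + x.1 1 1 - 2) * ht'
    obtain ⟨u, hu, hu1, hut⟩ := this
    obtain ⟨v, hv, huv⟩ := unip_vec hu1 hut
    have hall : ∀ g ∈ H, fixl v g := by
      intro g hg
      by_contra hgv
      exact hH (two_unip H hv hu hu1 huv hg hgv)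
    intro a ha b hb c hc d hd
    exact fixv_comm hv (bor_comm hv (hall a ha) (hall b hb)) (bor_comm hv (hall c hc) (hall d hd))
  · push Not at hu
    set Z : Subgroup H := (scal p).subgroupOf H with hZ
    have mz : ∀ x : H, x ∈ Z ↔ (x : SL) ∈ scal p := fun x => Subgroup.mem_subgroupOf
    have hz2 : (univ.filter (fun x => x ∈ Z)).card ≤ 2 := by
      have : ((univ.filter (fun x => x ∈ Z)).image (fun x : H => (x : SL))).card ≤ 2 := by
        refine (card_le_card (t := {1, mk2 (-1) 0 0 (-1) (by ring)}) fun y hy => ?_).trans card_le_two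
        obtain ⟨x, hx, rfl⟩ := mem_image.1 hy
        have := scal_pm ((mz x).1 (mem_filter.1 hx).2)
        simpa using this
      rwa [card_image_of_injective _ Subtype.val_injective] at this
    rcases class_lemma Z
      (fun z hz g => Subtype.ext (scal_comm ((mz z).1 hz) g))
      (fun x hx a b ha hb => Subtype.ext (by
        exact comm_trans (fun h => hx ((mz x).2 h)) (congrArg Subtype.val ha)
          (congrArg Subtype.val hb)))
      (fun x hx g hg => by
        have hxs : (x : SL) ∉ scal p := fun h => hx ((mz x).2 h)
        have h := comm_same_tr h2 (b := (x : SL)) (x := (x : SL)) (y := (g * x * g⁻¹ : H))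
          (hu x x.2 hxs) rfl (congrArg Subtype.val hg) (tr_conj (g : SL) (x : SL)).symm
        rcases h with h | h
        · left; exact Subtype.ext h
        · right; exact Subtype.ext h) with h | h | ⟨x, hx, h⟩
    · left
      rw [Nat.card_eq_fintype_card]
      omega
    · right
      intro a ha b hb c hc d hd
      have hs : ∀ a ∈ H, a ∈ scal p := fun a ha => (mz ⟨a, ha⟩).1 (h _)
      exact scal_comm (hs _ (H.mul_mem (H.mul_mem (H.mul_mem ha hb) (H.inv_mem ha)) (H.inv_mem hb))) _
    · right
      have key : ∀ a b : H, (a * b * a⁻¹ * b⁻¹) * x = x * (a * b * a⁻¹ * b⁻¹) := by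
        have hi : ∀ g : H, g⁻¹ * x * g = g * x * g⁻¹ := by
          intro g
          rcases h g with hg | hg
          · rw [hg]
            have : g * x = x * g := by rwa [mul_inv_eq_iff_eq_mul] at hg
            rw [mul_assoc, ← this]; group
          · rw [hg]
            have e : x = g⁻¹ * x⁻¹ * g := by rw [← hg]; group
            have : x⁻¹ = (g⁻¹ * x⁻¹ * g)⁻¹ := by rw [← e]
            rw [this]; group
        have hc : ∀ a b : H, (a * b) * x * (a * b)⁻¹ = (b * a) * x * (b * a)⁻¹ := by
          intro a b
          have e1 : (a * b) * x * (a * b)⁻¹ = a * (b * x * b⁻¹) * a⁻¹ := by group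
          have e2 : (b * a) * x * (b * a)⁻¹ = b * (a * x * a⁻¹) * b⁻¹ := by group
          rw [e1, e2]
          have i : ∀ g : H, g * x⁻¹ * g⁻¹ = (g * x * g⁻¹)⁻¹ := fun g => by group
          rcases h a with ha | ha <;> rcases h b with hb | hb <;> rw [ha, hb] <;>
            simp only [i, ha, hb]
        intro a b
        have e : a * b * a⁻¹ * b⁻¹ = (a * b) * (b * a)⁻¹ := by group
        rw [e, ← mul_inv_eq_iff_eq_mul]
        calc (a * b) * (b * a)⁻¹ * x * ((a * b) * (b * a)⁻¹)⁻¹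
            = (a * b) * ((b * a)⁻¹ * x * (b * a)) * (a * b)⁻¹ := by group
          _ = (a * b) * ((b * a) * x * (b * a)⁻¹) * (a * b)⁻¹ := by rw [hi]
          _ = (a * b) * ((a * b) * x * (a * b)⁻¹) * (a * b)⁻¹ := by rw [hc]
          _ = (a * b) * ((a * b)⁻¹ * x * (a * b)) * (a * b)⁻¹ := by rw [hi]
          _ = x := by group
      intro a ha b hb c hc d hd
      have hxs : (x : SL) ∉ scal p := fun h => hx ((mz x).2 h)
      exact comm_trans hxs (congrArg Subtype.val (key ⟨a, ha⟩ ⟨b, hb⟩))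
        (congrArg Subtype.val (key ⟨c, hc⟩ ⟨d, hd⟩))

end dickson
end BG

namespace BG
open Finset Pointwise
section
variable {G : Type*} [Group G]

/-- Reduced words over `S`. -/
def Red (S : Finset G) (l : List G) : Prop :=
  (∀ x ∈ l, x ∈ S) ∧ l.IsChain (fun a b => a * b ≠ 1)

/-- The inverse word. -/
def winv (l : List G) : List G := (l.map (fun x => x⁻¹)).reverse

lemma winv_prod (l : List G) : (winv l).prod = l.prod⁻¹ := by
  unfold winv; rw [List.prod_inv_reverse]

lemma winv_length (l : List G) : (winv l).length = l.length := by simp [winv]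

lemma red_nil (S : Finset G) : Red S [] := ⟨by simp, by simp⟩

lemma red_winv {S : Finset G} (hsym : ∀ s ∈ S, s⁻¹ ∈ S) {l : List G} (h : Red S l) :
    Red S (winv l) := by
  refine ⟨?_, ?_⟩
  · intro x hx
    simp only [winv, List.mem_reverse, List.mem_map] at hx
    obtain ⟨a, ha, rfl⟩ := hx
    exact hsym _ (h.1 a ha)
  · unfold winv
    rw [List.isChain_reverse, List.isChain_map]
    refine h.2.imp ?_
    intro a b hab h1
    apply hab
    have : (a * b)⁻¹ = 1 := by rw [mul_inv_rev]; exact h1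
    exact inv_eq_one.1 this

lemma red_cons {S : Finset G} {a : G} {l : List G} :
    Red S (a :: l) ↔ a ∈ S ∧ (∀ b ∈ l.head?, a * b ≠ 1) ∧ Red S l := by
  unfold Red; rw [List.isChain_cons]; simp; tauto

lemma red_append {S : Finset G} {l1 l2 : List G} :
    Red S (l1 ++ l2) ↔ Red S l1 ∧ Red S l2 ∧
      ∀ a ∈ l1.getLast?, ∀ b ∈ l2.head?, a * b ≠ 1 := by
  unfold Red; rw [List.isChain_append]
  constructor
  · rintro ⟨h, h1, h2, h3⟩
    exact ⟨⟨fun x hx => h x (by simp [hx]), h1⟩, ⟨fun x hx => h x (by simp [hx]), h2⟩, h3⟩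
  · rintro ⟨⟨h1, h1'⟩, ⟨h2, h2'⟩, h3⟩
    refine ⟨fun x hx => ?_, h1', h2', h3⟩
    rcases List.mem_append.1 hx with h | h
    exacts [h1 x h, h2 x h]

variable {S : Finset G}

theorem red_unique (hsym : ∀ s ∈ S, s⁻¹ ∈ S) (hfree : ∀ l, l ≠ [] → Red S l → l.prod ≠ 1) :
    ∀ l1 l2 : List G, Red S l1 → Red S l2 → l1.prod = l2.prod → l1 = l2 := by
  intro l1
  induction l1 with
  | nil =>
    intro l2 _ h2 h
    by_contra hn
    exact hfree l2 (fun h => hn h.symm) h2 (by simpa using h.symm)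
  | cons a t ih =>
    intro l2 h1 h2 h
    cases l2 with
    | nil => exact absurd (by simpa using h) (hfree _ (by simp) h1)
    | cons b u =>
      by_cases hab : a = b
      · subst hab
        rw [ih u (red_cons.1 h1).2.2 (red_cons.1 h2).2.2 (by simpa using h)]
      · exfalso
        refine hfree (winv (a :: t) ++ (b :: u)) (by simp) ?_ ?_
        · rw [red_append]
          refine ⟨red_winv hsym h1, h2, ?_⟩
          intro x hx y hy
          simp [winv] at hx hy
          subst hx; subst hy
          intro h
          exact hab (inv_mul_eq_one.1 h)
        · rw [List.prod_append, winv_prod, h]; simp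

theorem mulWord (hsym : ∀ s ∈ S, s⁻¹ ∈ S) : ∀ l1 l2 : List G, Red S l1 → Red S l2 →
    ∃ l, Red S l ∧ l.prod = l1.prod * l2.prod ∧ l.length ≤ l1.length + l2.length ∧
      (l.length = l1.length + l2.length → l = l1 ++ l2) := by
  intro l1
  induction l1 with
  | nil => intro l2 _ h2; exact ⟨l2, h2, by simp, by simp, by simp⟩
  | cons a t ih =>
    intro l2 h1 h2
    obtain ⟨l, hl, hp, hlen, heq⟩ := ih l2 (red_cons.1 h1).2.2 h2
    by_cases hc : ∀ b ∈ l.head?, a * b ≠ 1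
    · refine ⟨a :: l, red_cons.2 ⟨(red_cons.1 h1).1, hc, hl⟩, by simp [hp, mul_assoc],
        by simp; omega, ?_⟩
      intro h
      simp at h
      rw [heq (by omega)]; rfl
    · push Not at hc
      obtain ⟨b, hb, hab⟩ := hc
      cases l with
      | nil => simp at hb
      | cons c u =>
        simp at hb; subst hb
        refine ⟨u, (red_cons.1 hl).2.2, ?_, ?_, ?_⟩
        · rw [List.prod_cons, mul_assoc, ← hp, List.prod_cons, ← mul_assoc, hab, one_mul]
        · simp at hlen ⊢; omega
        · intro h; simp at hlen h; omega

theorem comm_swap (hsym : ∀ s ∈ S, s⁻¹ ∈ S) (hfree : ∀ l, l ≠ [] → Red S l → l.prod ≠ 1)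
    {l1 l2 : List G} (h : Red S (l1 ++ l2)) (hc : l1.prod * l2.prod = l2.prod * l1.prod) :
    l1 ++ l2 = l2 ++ l1 := by
  obtain ⟨h1, h2, _⟩ := red_append.1 h
  obtain ⟨l, hl, hp, _, he⟩ := mulWord hsym l2 l1 h2 h1
  have : l1 ++ l2 = l := red_unique hsym hfree _ _ h hl (by rw [hp, List.prod_append, hc])
  rw [this]; apply he
  rw [← this]; simp [add_comm]

theorem comm_eq_len (hsym : ∀ s ∈ S, s⁻¹ ∈ S) (hfree : ∀ l, l ≠ [] → Red S l → l.prod ≠ 1) :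
    ∀ n (x y : List G), x.length = n → y.length = n → Red S x → Red S y →
      x.prod * y.prod = y.prod * x.prod → y.prod = x.prod ∨ y.prod = x.prod⁻¹ := by
  intro n
  induction n using Nat.strong_induction_on with
  | _ n ih =>
  intro x y hx hy hrx hry hc
  by_cases hA : Red S (x ++ y)
  · left
    have := comm_swap hsym hfree hA hc
    rw [(List.append_inj this (by omega)).1]
  by_cases hA2 : Red S (y ++ x)
  · left
    have := comm_swap hsym hfree hA2 hc.symm
    rw [(List.append_inj this (by omega)).1]
  by_cases hB : Red S (x ++ winv y)
  · right
    have := comm_swap hsym hfree hB (by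
      rw [winv_prod, eq_inv_mul_iff_mul_eq, ← mul_assoc, ← hc, mul_inv_cancel_right])
    rw [(List.append_inj this (by rw [winv_length]; omega)).1, winv_prod, inv_inv]
  rw [red_append] at hA hB hA2
  simp only [hrx, hry, red_winv hsym hry, true_and] at hA hB hA2
  push Not at hA hB hA2
  obtain ⟨a, ha, b, hb, hab⟩ := hA
  obtain ⟨c, hc', d, hd, hcd⟩ := hA2
  obtain ⟨e, he, f, hf, hef⟩ := hB
  obtain ⟨rfl⟩ : a = e := by
    have := (Option.mem_def.1 ha).symm.trans (Option.mem_def.1 he)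
    simpa using this
  have hf' : ∃ g ∈ y.getLast?, g⁻¹ = f := by
    simp [winv] at hf; simpa using hf
  obtain ⟨g, hg, rfl⟩ := hf'
  obtain ⟨rfl⟩ : c = g := by
    have := (Option.mem_def.1 hc').symm.trans (Option.mem_def.1 hg)
    simpa using this
  obtain rfl : a = c := by simpa [mul_inv_eq_one] using hef
  obtain rfl : b = d := by
    rw [mul_eq_one_iff_eq_inv] at hab hcd
    have h := hab.symm.trans hcd
    simpa using h
  -- x = b ... a, y = b ... a
  cases x with
  | nil => simp at hd
  | cons x0 x1 =>
  cases y with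
  | nil => simp at hb
  | cons y0 y1 =>
  simp at hb hd; subst hb; subst hd
  rcases List.eq_nil_or_concat x1 with rfl | ⟨x', x2, rfl⟩
  · left
    have : y1 = [] := by
      apply List.eq_nil_of_length_eq_zero; simp at hx hy; omega
    subst this; rfl
  rcases List.eq_nil_or_concat y1 with rfl | ⟨y', y2, rfl⟩
  · exfalso; simp at hx hy; omega
  have e1 : x2 = a := by
    have : (x0 :: (x' ++ [x2])).getLast? = some x2 := by
      rw [← List.cons_append, List.getLast?_append]; simp
    simp only [List.concat_eq_append] at ha
    rw [this] at ha; simpa using ha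
  have e2 : y2 = a := by
    have : (x0 :: (y' ++ [y2])).getLast? = some y2 := by
      rw [← List.cons_append, List.getLast?_append]; simp
    simp only [List.concat_eq_append] at hg
    rw [this] at hg; simpa using hg
  subst e1; subst e2
  have hy2 : y2 = x0⁻¹ := mul_eq_one_iff_eq_inv.1 hab
  subst hy2
  simp only [List.concat_eq_append] at *
  have r1 := (red_append.1 (red_cons.1 hrx).2.2).1
  have r2 := (red_append.1 (red_cons.1 hry).2.2).1
  simp only [List.prod_cons, List.prod_append, List.prod_nil, mul_one] at hc ⊢
  have hlx : x'.length < n := by simp at hx; omega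
  have := ih _ hlx x' y' rfl (by simp at hx hy; omega) r1 r2 (by
    have h2 : x0 * (x'.prod * y'.prod) * x0⁻¹ = x0 * (y'.prod * x'.prod) * x0⁻¹ := by
      calc _ = x0 * (x'.prod * x0⁻¹) * (x0 * (y'.prod * x0⁻¹)) := by group
        _ = _ := hc
        _ = _ := by group
    simpa using h2)
  rcases this with h | h
  · left; rw [h]
  · right; rw [h]; group

/-- The ball of radius `N`. -/
def InBall (S : Finset G) (N : ℕ) (g : G) : Prop := ∃ l, Red S l ∧ l.length ≤ N ∧ l.prod = g

lemma inBall_mul (hsym : ∀ s ∈ S, s⁻¹ ∈ S) {M N : ℕ} {g h : G} (hg : InBall S M g)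
    (hh : InBall S N h) : InBall S (M + N) (g * h) := by
  obtain ⟨l1, r1, n1, rfl⟩ := hg
  obtain ⟨l2, r2, n2, rfl⟩ := hh
  obtain ⟨l, r, hp, n, _⟩ := mulWord hsym l1 l2 r1 r2
  exact ⟨l, r, by omega, hp⟩

lemma inBall_inv (hsym : ∀ s ∈ S, s⁻¹ ∈ S) {N : ℕ} {g : G} (hg : InBall S N g) :
    InBall S N g⁻¹ := by
  obtain ⟨l1, r1, n1, rfl⟩ := hg
  exact ⟨winv l1, red_winv hsym r1, by rw [winv_length]; exact n1, winv_prod _⟩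

lemma inBall_mono {M N : ℕ} (hMN : M ≤ N) {g : G} (hg : InBall S M g) : InBall S N g := by
  obtain ⟨l1, r1, n1, rfl⟩ := hg
  exact ⟨l1, r1, by omega, rfl⟩

theorem comm_count [DecidableEq G] (hsym : ∀ s ∈ S, s⁻¹ ∈ S)
    (hfree : ∀ l, l ≠ [] → Red S l → l.prod ≠ 1) (N : ℕ)
    (Y : Finset G) (hY : ∀ y ∈ Y, InBall S N y) (hcomm : ∀ x ∈ Y, ∀ y ∈ Y, x * y = y * x) :
    Y.card ≤ 2 * (N + 1) := by
  classical
  choose! w hw using hY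
  have h := card_le_mul_card_image_of_maps_to (s := Y) (t := Finset.range (N + 1))
    (f := fun y => (w y).length) (n := 2) (by
      intro y hy
      simp only [Finset.mem_range]
      have := (hw y hy).2.1
      omega) (by
      intro n _
      by_cases he : (Y.filter (fun y => (w y).length = n)).Nonempty
      · obtain ⟨x, hx⟩ := he
        refine (card_le_card (t := {x, x⁻¹}) ?_).trans card_le_two
        intro y hy
        rw [mem_filter] at hx hy
        have := comm_eq_len hsym hfree n (w x) (w y) hx.2 hy.2 (hw x hx.1).1 (hw y hy.1).1 (by
          rw [(hw x hx.1).2.2, (hw y hy.1).2.2]; exact hcomm x hx.1 y hy.1)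
        rw [(hw x hx.1).2.2, (hw y hy.1).2.2] at this
        simpa using this
      · rw [not_nonempty_iff_eq_empty.1 he]; simp)
  simpa using h

/-- Elements of the ball are not central. -/
theorem not_central [DecidableEq G] (hsym : ∀ s ∈ S, s⁻¹ ∈ S)
    (hfree : ∀ l, l ≠ [] → Red S l → l.prod ≠ 1) (hcard : 3 ≤ S.card)
    {N : ℕ} {x : G} (hx : InBall S N x) (h1 : x ≠ 1) : ∃ s ∈ S, x * s ≠ s * x := by
  obtain ⟨l, r, _, rfl⟩ := hx
  have hl : l ≠ [] := by rintro rfl; simp at h1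
  obtain ⟨s, hs, hs2⟩ : ∃ s ∈ S, s ∉ ({(l.getLast hl)⁻¹, l.head hl} : Finset G) := by
    by_contra hcon
    push Not at hcon
    have := card_le_card (fun a ha => hcon a ha : S ⊆ _)
    have := this.trans card_le_two
    omega
  refine ⟨s, hs, fun hc => ?_⟩
  simp at hs2
  have hr : Red S (l ++ [s]) := by
    rw [red_append]
    refine ⟨r, red_cons.2 ⟨hs, by simp, red_nil S⟩, ?_⟩
    intro a ha b hb
    simp at hb; subst hb
    rw [List.getLast?_eq_some_getLast hl] at ha
    simp at ha; subst ha
    intro h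
    exact hs2.1 (mul_eq_one_iff_eq_inv'.1 h)
  have := comm_swap hsym hfree hr (by simpa using hc)
  apply hs2.2
  cases l with
  | nil => simp at hl
  | cons a t => simp at this; simp [this.1]

end
end BG

namespace BG
open Finset Pointwise
section
variable {G : Type*} [Group G] [DecidableEq G] {S : Finset G}

theorem metab_count (hsym : ∀ s ∈ S, s⁻¹ ∈ S)
    (hfree : ∀ l, l ≠ [] → Red S l → l.prod ≠ 1) (hcard : 3 ≤ S.card)
    (hCT : ∀ b : G, (∃ s : G, b * s ≠ s * b) → ∀ x y : G, x * b = b * x → y * b = b * y →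
      x * y = y * x) (N : ℕ)
    (Y : Finset G) (hY : ∀ y ∈ Y, InBall S N y)
    (hmet : ∀ a ∈ Y, ∀ b ∈ Y, ∀ c ∈ Y, ∀ d ∈ Y,
      (a*b*a⁻¹*b⁻¹)*(c*d*c⁻¹*d⁻¹) = (c*d*c⁻¹*d⁻¹)*(a*b*a⁻¹*b⁻¹)) :
    Y.card ≤ (8 * N + 2) * (4 * N + 2) := by
  by_cases h1 : ∃ b ∈ Y, b ≠ 1
  · obtain ⟨b, hb, hb1⟩ := h1
    obtain ⟨s, -, hs⟩ := not_central hsym hfree hcard (hY b hb) hb1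
    have hI : (Y.image (fun a => a*b*a⁻¹*b⁻¹)).card ≤ 2 * (4 * N + 1) := by
      apply comm_count hsym hfree
      · intro y hy
        obtain ⟨a, ha, rfl⟩ := mem_image.1 hy
        exact inBall_mono (by omega) (inBall_mul hsym (inBall_mul hsym
          (inBall_mul hsym (hY a ha) (hY b hb)) (inBall_inv hsym (hY a ha)))
          (inBall_inv hsym (hY b hb)))
      · intro x hx y hy
        obtain ⟨a, ha, rfl⟩ := mem_image.1 hx
        obtain ⟨c, hc, rfl⟩ := mem_image.1 hy
        exact hmet a ha b hb c hc b hb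
    have hF := card_le_mul_card_image (s := Y) (f := fun a => a*b*a⁻¹*b⁻¹) (2 * (2 * N + 1)) (by
      intro c hc
      obtain ⟨a0, ha0, rfl⟩ := mem_image.1 hc
      have hcm : ∀ a, a * b * a⁻¹ * b⁻¹ = a0 * b * a0⁻¹ * b⁻¹ →
          (a0⁻¹ * a) * b = b * (a0⁻¹ * a) := by
        intro a h
        have h2 : a * b * a⁻¹ = a0 * b * a0⁻¹ := mul_right_cancel h
        calc (a0⁻¹ * a) * b = a0⁻¹ * (a * b * a⁻¹) * a := by group
          _ = a0⁻¹ * (a0 * b * a0⁻¹) * a := by rw [h2]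
          _ = _ := by group
      rw [← card_image_of_injective _ (mul_right_injective a0⁻¹)]
      apply comm_count hsym hfree
      · intro y hy
        obtain ⟨a, ha, rfl⟩ := mem_image.1 hy
        exact inBall_mono (by omega) (inBall_mul hsym (inBall_inv hsym (hY a0 ha0))
          (hY a (mem_filter.1 ha).1))
      · intro x hx y hy
        obtain ⟨a, ha, rfl⟩ := mem_image.1 hx
        obtain ⟨c, hc, rfl⟩ := mem_image.1 hy
        exact hCT b ⟨s, hs⟩ _ _ (hcm a (mem_filter.1 ha).2) (hcm c (mem_filter.1 hc).2))
    calc Y.card ≤ _ := hF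
      _ ≤ 2 * (2 * N + 1) * (2 * (4 * N + 1)) := Nat.mul_le_mul_left _ hI
      _ = _ := by ring
  · push Not at h1
    have : Y ⊆ {1} := fun y hy => by simpa using h1 y hy
    have := card_le_card this
    simp at this
    nlinarith

open Classical in
/-- The spherical supersolution. -/
noncomputable def sph (S : Finset G) (β : ℝ) (y : G) : ℝ :=
  if h : ∃ l, Red S l ∧ l.prod = y then β ^ (h.choose).length else 0

lemma sph_word (hsym : ∀ s ∈ S, s⁻¹ ∈ S)
    (hfree : ∀ l, l ≠ [] → Red S l → l.prod ≠ 1) (β : ℝ) {l : List G} (hl : Red S l) :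
    sph S β l.prod = β ^ l.length := by
  have h : ∃ l', Red S l' ∧ l'.prod = l.prod := ⟨l, hl, rfl⟩
  unfold sph
  rw [dif_pos h, red_unique hsym hfree _ _ h.choose_spec.1 hl h.choose_spec.2]

lemma sph_nonneg {β : ℝ} (hβ : 0 ≤ β) (y : G) : 0 ≤ sph S β y := by
  unfold sph; split_ifs <;> positivity

lemma sph_le_one {β : ℝ} (hβ : 0 ≤ β) (hβ1 : β ≤ 1) (y : G) : sph S β y ≤ 1 := by
  unfold sph; split_ifs
  · exact pow_le_one₀ hβ hβ1
  · norm_num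

lemma red_snoc {l : List G} {s : G} (hl : Red S l) (hs : s ∈ S)
    (h : ∀ a ∈ l.getLast?, s ≠ a⁻¹) : Red S (l ++ [s]) := by
  rw [red_append]
  refine ⟨hl, red_cons.2 ⟨hs, by simp, red_nil S⟩, ?_⟩
  intro a ha b hb
  simp at hb; subst hb
  intro h1
  exact h a ha (mul_eq_one_iff_eq_inv'.1 h1)

theorem sph_super (hsym : ∀ s ∈ S, s⁻¹ ∈ S)
    (hfree : ∀ l, l ≠ [] → Red S l → l.prod ≠ 1) (hcard : 4 ≤ S.card) (β r : ℝ)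
    (hβ : 0 < β) (hβ2 : ((S.card : ℝ) - 1) * β ^ 2 = 1)
    (hr : r * S.card = 2 * ((S.card : ℝ) - 1) * β) (y : G) :
    avg S id (sph S β) y ≤ r * sph S β y := by
  have hk : (4 : ℝ) ≤ S.card := by exact_mod_cast hcard
  rw [avg_apply, div_le_iff₀ (by linarith)]
  simp only [id]
  by_cases h : ∃ l, Red S l ∧ l.prod = y
  · obtain ⟨l, hl, rfl⟩ := h
    rw [sph_word hsym hfree β hl]
    rcases List.eq_nil_or_concat l with rfl | ⟨l', t, rfl⟩
    · have : ∀ s ∈ S, sph S β (([] : List G).prod * s) = β := by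
        intro s hs
        have := sph_word hsym hfree β (red_snoc hl hs (by simp))
        simpa using this
      rw [sum_congr rfl this]
      simp
      nlinarith
    · simp only [List.concat_eq_append] at *
      have ht : t ∈ S := hl.1 t (by simp)
      rw [← add_sum_erase S _ (hsym t ht)]
      have h1 : sph S β ((l' ++ [t]).prod * t⁻¹) = β ^ l'.length := by
        rw [← sph_word hsym hfree β (red_append.1 hl).1]; simp
      have h2 : ∀ s ∈ S.erase t⁻¹, sph S β ((l' ++ [t]).prod * s) = β ^ (l'.length + 2) := by
        intro s hs
        have := sph_word hsym hfree β (red_snoc (s := s) hl (mem_of_mem_erase hs) (by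
          intro a ha
          simp at ha; subst ha
          exact ne_of_mem_erase hs))
        rw [List.prod_append] at this
        simpa using this
      rw [h1, sum_congr rfl h2, sum_const, card_erase_of_mem (hsym t ht), nsmul_eq_mul,
        Nat.cast_sub (by omega), List.length_append]
      simp only [Nat.cast_one, List.length_singleton, pow_succ]
      apply le_of_eq
      have e1 : r * (β ^ l'.length * β) * (S.card : ℝ) = (r * S.card) * β * β ^ l'.length := by ring
      rw [e1, hr]
      linear_combination (-1 : ℝ) * β ^ l'.length * hβ2
  · have h0 : ∀ s ∈ S, sph S β (y * s) = 0 := by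
      intro s hs
      unfold sph
      rw [dif_neg]
      rintro ⟨l, hl, hly⟩
      apply h
      obtain ⟨l2, r2, p2, -⟩ := mulWord hsym l [s⁻¹] hl
        (red_cons.2 ⟨hsym s hs, by simp, red_nil S⟩)
      exact ⟨l2, r2, by rw [p2, hly]; simp⟩
    rw [sum_congr rfl h0]
    unfold sph
    rw [dif_neg h]; simp

theorem free_walk (hsym : ∀ s ∈ S, s⁻¹ ∈ S)
    (hfree : ∀ l, l ≠ [] → Red S l → l.prod ≠ 1) (hcard : 4 ≤ S.card) (β r : ℝ)
    (hβ : 0 < β) (hβ2 : ((S.card : ℝ) - 1) * β ^ 2 = 1)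
    (hr : r * S.card = 2 * ((S.card : ℝ) - 1) * β) (n : ℕ) (Y : Finset G) :
    (avg S id ^ n) (fun y => if y ∈ Y then 1 else 0) 1 ≤ Y.card * r ^ n := by
  have hk : (4 : ℝ) ≤ S.card := by exact_mod_cast hcard
  have hβ1 : β ≤ 1 := by nlinarith
  have hr0 : 0 ≤ r := by
    have : 0 ≤ r * S.card := by rw [hr]; have : 0 ≤ (S.card : ℝ) - 1 := by linarith
                                positivity
    nlinarith
  have h1 : ∀ x, (avg S id ^ n) (sph S β) x ≤ r ^ n * sph S β x := by
    induction n with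
    | zero => intro x; simp
    | succ n ih =>
      intro x
      rw [avg_pow_succ]
      calc _ ≤ avg S id (fun x => r ^ n * sph S β x) x := avg_mono S id ih x
        _ = r ^ n * avg S id (sph S β) x := by
          simp only [avg_apply, ← mul_sum, mul_div_assoc]
        _ ≤ r ^ n * (r * sph S β x) := by
          gcongr; exact sph_super hsym hfree hcard β r hβ hβ2 hr x
        _ = _ := by ring
  have h2 : ∀ x0 : G, (avg S id ^ n) (Pi.single x0 1) 1 ≤ r ^ n := by
    intro x0
    have e : (Pi.single x0 1 : G → ℝ) = fun y => (Pi.single 1 1 : G → ℝ) (x0⁻¹ * y) := by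
      funext y
      simp only [Pi.single_apply, inv_mul_eq_one, eq_comm]
    rw [e, avg_pow_left, mul_one]
    calc _ ≤ (avg S id ^ n) (sph S β) x0⁻¹ := by
          apply avg_pow_mono
          intro x
          by_cases hx : x = 1
          · subst hx
            have := sph_word hsym hfree β (red_nil S)
            simp at this; simp [this]
          · simp [hx, sph_nonneg hβ.le]
      _ ≤ r ^ n * sph S β x0⁻¹ := h1 _
      _ ≤ r ^ n * 1 := by gcongr; exact sph_le_one hβ.le hβ1 _
      _ = _ := mul_one _
  have e : (fun y => if y ∈ Y then (1:ℝ) else 0) = ∑ x ∈ Y, Pi.single x 1 := by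
    funext y
    simp [Finset.sum_apply, Pi.single_apply]
  rw [e, map_sum, Finset.sum_apply]
  calc _ ≤ ∑ x ∈ Y, r ^ n := sum_le_sum fun x _ => h2 x
    _ = _ := by simp

lemma avg_ball_mono (hsym : ∀ s ∈ S, s⁻¹ ∈ S) (f h : G → ℝ) : ∀ n M : ℕ,
    (∀ y, InBall S (M + n) y → f y ≤ h y) → ∀ x, InBall S M x →
      (avg S id ^ n) f x ≤ (avg S id ^ n) h x := by
  intro n
  induction n with
  | zero => intro M hfh x hx; simpa using hfh x hx
  | succ n ih =>
    intro M hfh x hx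
    rw [avg_pow_succ, avg_pow_succ, avg_apply, avg_apply]
    gcongr with s hs
    apply ih (M + 1)
    · intro y hy; exact hfh y (by rwa [add_assoc, add_comm 1 n] at hy)
    · exact inBall_mul hsym hx ⟨[s], red_cons.2 ⟨hs, by simp, red_nil S⟩, by simp, by simp⟩

theorem free_walk_ball (hsym : ∀ s ∈ S, s⁻¹ ∈ S)
    (hfree : ∀ l, l ≠ [] → Red S l → l.prod ≠ 1) (hcard : 4 ≤ S.card) (β r : ℝ)
    (hβ : 0 < β) (hβ2 : ((S.card : ℝ) - 1) * β ^ 2 = 1)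
    (hr : r * S.card = 2 * ((S.card : ℝ) - 1) * β) (n : ℕ) (Y : Finset G)
    (f : G → ℝ) (hf : ∀ y, f y ≤ 1) (hfY : ∀ y, InBall S n y → y ∉ Y → f y ≤ 0) :
    (avg S id ^ n) f 1 ≤ Y.card * r ^ n := by
  refine le_trans ?_ (free_walk hsym hfree hcard β r hβ hβ2 hr n Y)
  apply avg_ball_mono hsym _ _ n 0
  · intro y hy
    by_cases h : y ∈ Y
    · simp [h, hf]
    · simp only [h, if_false]; exact hfY y (by simpa using hy) h
  · exact ⟨[], red_nil S, by simp, rfl⟩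

end

theorem CT_int (b : Matrix.SpecialLinearGroup (Fin 2) ℤ) (hb : ∃ s, b * s ≠ s * b)
    (x y : Matrix.SpecialLinearGroup (Fin 2) ℤ) (hx : x * b = b * x) (hy : y * b = b * y) :
    x * y = y * x := by
  have hinj : Function.Injective (Matrix.SpecialLinearGroup.map (n := Fin 2) (Int.castRingHom ℚ)) := by
    intro u v h
    ext i j
    have := congrArg (fun m : Matrix.SpecialLinearGroup (Fin 2) ℚ => m.1 i j) h
    simpa using this
  apply hinj
  rw [map_mul, map_mul]
  apply comm_trans (b := Matrix.SpecialLinearGroup.map (n := Fin 2) (Int.castRingHom ℚ) b)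
  · rintro ⟨h1, h2, h3⟩
    simp at h1 h2 h3
    obtain ⟨s, hs⟩ := hb
    apply hs
    ext i j
    fin_cases i <;> fin_cases j <;> simp [Matrix.mul_apply, h1, h2, h3, mul_comm]
  · rw [← map_mul, hx, map_mul]
  · rw [← map_mul, hy, map_mul]
end BG

namespace BG
open Finset Pointwise
local notation "SLZ" => Matrix.SpecialLinearGroup (Fin 2) ℤ

lemma opnorm_mul (g h : SLZ) : sl2zOpNorm (g * h) ≤ sl2zOpNorm g * sl2zOpNorm h := by
  unfold sl2zOpNorm
  have : (((g * h : SLZ) : Matrix (Fin 2) (Fin 2) ℤ).map (Int.cast : ℤ → ℝ)) =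
      ((g : Matrix (Fin 2) (Fin 2) ℤ).map (Int.cast : ℤ → ℝ)) *
      ((h : Matrix (Fin 2) (Fin 2) ℤ).map (Int.cast : ℤ → ℝ)) := by
    rw [Matrix.SpecialLinearGroup.coe_mul]
    exact Matrix.map_mul (f := Int.castRingHom ℝ)
  rw [this, map_mul]
  exact norm_mul_le _ _

lemma opnorm_one : sl2zOpNorm (1 : SLZ) ≤ 1 := by
  unfold sl2zOpNorm
  have : (((1 : SLZ) : Matrix (Fin 2) (Fin 2) ℤ).map (Int.cast : ℤ → ℝ)) = 1 := by
    rw [Matrix.SpecialLinearGroup.coe_one]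
    exact Matrix.map_one _ (by simp) (by simp)
  rw [this, map_one]
  exact ContinuousLinearMap.norm_id_le

lemma opnorm_nonneg (g : SLZ) : 0 ≤ sl2zOpNorm g := norm_nonneg _

lemma col_le (g : SLZ) (j : Fin 2) :
    ((g.1 0 j : ℝ)) ^ 2 + ((g.1 1 j : ℝ)) ^ 2 ≤ sl2zOpNorm g ^ 2 := by
  have h := (Matrix.toEuclideanCLM (𝕜 := ℝ)
    ((g : Matrix (Fin 2) (Fin 2) ℤ).map (Int.cast : ℤ → ℝ))).le_opNorm (PiLp.single 2 j (1:ℝ))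
  rw [PiLp.norm_single, norm_one, mul_one] at h
  have h2 := pow_le_pow_left₀ (norm_nonneg _) h 2
  rw [EuclideanSpace.norm_sq_eq] at h2
  simpa [Fin.sum_univ_two, Matrix.ofLp_toEuclideanCLM, sl2zOpNorm] using h2

lemma entry_le (g : SLZ) (i j : Fin 2) : |(g.1 i j : ℝ)| ≤ sl2zOpNorm g := by
  have h := col_le g j
  apply abs_le_of_sq_le_sq _ (opnorm_nonneg g)
  fin_cases i
  · simp; nlinarith [sq_nonneg (g.1 1 j : ℝ)]
  · simp; nlinarith [sq_nonneg (g.1 0 j : ℝ)]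

lemma opnorm_list {S : Finset SLZ} {D : ℝ} (hD : ∀ s ∈ S, sl2zOpNorm s ≤ D) :
    ∀ l : List SLZ, (∀ x ∈ l, x ∈ S) → sl2zOpNorm l.prod ≤ D ^ l.length := by
  intro l
  induction l with
  | nil => intro _; simpa using opnorm_one
  | cons a t ih =>
    intro h
    have ha := hD a (h a (by simp))
    rw [List.prod_cons, List.length_cons, pow_succ']
    refine (opnorm_mul _ _).trans ?_
    exact mul_le_mul ha (ih fun x hx => h x (by simp [hx])) (opnorm_nonneg _)
      ((opnorm_nonneg a).trans ha)

lemma ball_inj {S : Finset SLZ} {D : ℝ} (hD : ∀ s ∈ S, sl2zOpNorm s ≤ D) (hD1 : 1 ≤ D)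
    (p R : ℕ) (hp : 2 * D ^ R < p) {x y : SLZ} (hx : InBall S R x) (hy : InBall S R y)
    (h : Matrix.SpecialLinearGroup.map (Int.castRingHom (ZMod p)) x =
      Matrix.SpecialLinearGroup.map (Int.castRingHom (ZMod p)) y) : x = y := by
  have hb : ∀ z, InBall S R z → ∀ i j, |(z.1 i j : ℝ)| ≤ D ^ R := by
    rintro z ⟨l, hl, hn, rfl⟩ i j
    exact (entry_le _ i j).trans ((opnorm_list hD l hl.1).trans (pow_le_pow_right₀ hD1 hn))
  ext i j
  have h1 := congrArg (fun m : Matrix.SpecialLinearGroup (Fin 2) (ZMod p) => m.1 i j) h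
  simp only [Matrix.SpecialLinearGroup.map_apply_coe, RingHom.mapMatrix_apply, Matrix.map_apply,
    Int.coe_castRingHom] at h1
  have h2 := (ZMod.intCast_eq_intCast_iff_dvd_sub _ _ _).1 h1
  have h3 : |y.1 i j - x.1 i j| < (p : ℤ) := by
    have : |(y.1 i j : ℝ) - x.1 i j| < p := by
      refine (abs_sub _ _).trans_lt ?_
      linarith [hb x hx i j, hb y hy i j]
    exact_mod_cast this
  have := Int.eq_zero_of_abs_lt_dvd h2 h3
  omega

lemma norm_lower {S : Finset SLZ} (hsym : ∀ s ∈ S, s⁻¹ ∈ S)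
    (hfree : ∀ l, l ≠ [] → Red S l → l.prod ≠ 1) (hcard : 4 ≤ S.card)
    {D : ℝ} (hD : ∀ s ∈ S, sl2zOpNorm s ≤ D) : 2 ≤ D ^ 2 := by
  by_contra hcon
  push Not at hcon
  have hrot : ∀ s ∈ S, s.1 0 0 = s.1 1 1 ∧ s.1 0 1 = - s.1 1 0 := by
    intro s hs
    have hc : ∀ j, (s.1 0 j) ^ 2 + (s.1 1 j) ^ 2 < 2 := by
      intro j
      have h1 := col_le s j
      have h2 := pow_le_pow_left₀ (opnorm_nonneg s) (hD s hs) 2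
      have : ((s.1 0 j : ℝ)) ^ 2 + ((s.1 1 j : ℝ)) ^ 2 < 2 := by linarith
      exact_mod_cast this
    have hdet : s.1 0 0 * s.1 1 1 - s.1 0 1 * s.1 1 0 = 1 := by
      have := s.2; rwa [Matrix.det_fin_two] at this
    have h0 := hc 0
    have h1 := hc 1
    have h3 : (s.1 0 0 - s.1 1 1) ^ 2 + (s.1 0 1 + s.1 1 0) ^ 2 ≤ 0 := by nlinarith
    constructor
    · nlinarith [sq_nonneg (s.1 0 1 + s.1 1 0), sq_nonneg (s.1 0 0 - s.1 1 1)]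
    · nlinarith [sq_nonneg (s.1 0 1 + s.1 1 0), sq_nonneg (s.1 0 0 - s.1 1 1)]
  obtain ⟨x, hx⟩ : S.Nonempty := card_pos.1 (by omega)
  have hrx : Red S [x] := red_cons.2 ⟨hx, by simp, red_nil S⟩
  have hx1 : x ≠ 1 := by
    have := hfree [x] (by simp) hrx
    simpa using this
  obtain ⟨s, hs, hne⟩ := not_central hsym hfree (by omega) ⟨[x], hrx, le_refl _, by simp⟩ hx1
  apply hne
  obtain ⟨a1, a2⟩ := hrot x hx
  obtain ⟨b1, b2⟩ := hrot s hs
  ext i j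
  fin_cases i <;> fin_cases j <;> simp [Matrix.mul_apply, a1, a2, b1, b2] <;> ring
end BG

namespace BG
open Finset Pointwise

section
variable {G ι : Type*} [Group G] [Fintype G] [DecidableEq G] (S : Finset ι) (σ : ι → G)
open Classical in
theorem coset_sq (hsym : ∀ f : G → ℝ, ∑ s ∈ S, f (σ s) = ∑ s ∈ S, f (σ s)⁻¹) (n : ℕ)
    (H0 : Subgroup G) (d : G) :
    (∑ x, wk S σ n x * (if d * x ∈ H0 then 1 else 0)) ^ 2 ≤
      ∑ x, wk S σ (2 * n) x * (if x ∈ H0 then 1 else 0) := by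
  have e : ∑ x, wk S σ (2 * n) x * (if x ∈ H0 then 1 else 0) =
      ∑ y, ∑ w, (wk S σ n y * wk S σ n w) * (if y⁻¹ * w ∈ H0 then 1 else 0) := by
    simp only [two_mul, wk_add, sum_mul]
    rw [sum_comm]
    rw [← Equiv.sum_comp (Equiv.inv G)]
    refine sum_congr rfl fun y _ => ?_
    rw [← Equiv.sum_comp (Equiv.mulLeft y⁻¹)]
    refine sum_congr rfl fun w _ => ?_
    simp only [wk_inv S σ hsym, Equiv.inv_apply, Equiv.coe_mulLeft, inv_inv, mul_inv_cancel_left]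
    congr
  rw [e, sq, sum_mul_sum]
  refine sum_le_sum fun y _ => sum_le_sum fun w _ => ?_
  rw [mul_mul_mul_comm]
  refine mul_le_mul_of_nonneg_left ?_ (mul_nonneg (wk_nonneg _ _ _ _) (wk_nonneg _ _ _ _))
  by_cases h1 : d * y ∈ H0
  · by_cases h2 : d * w ∈ H0
    · have : y⁻¹ * w ∈ H0 := by
        have := H0.mul_mem (H0.inv_mem h1) h2
        rwa [mul_inv_rev, mul_assoc, inv_mul_cancel_left] at this
      simp [h1, h2, this]
    · simp only [h1, h2, if_false, mul_zero]; split_ifs <;> norm_num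
  · simp only [h1, if_false, zero_mul]; split_ifs <;> norm_num

open Classical in
theorem coset_mass (hS : S.Nonempty)
    (hsym : ∀ f : G → ℝ, ∑ s ∈ S, f (σ s) = ∑ s ∈ S, f (σ s)⁻¹) (n m : ℕ) (hnm : n ≤ m)
    (H0 : Subgroup G) (c : ℝ) (hc : 0 ≤ c)
    (hH : ∑ x, wk S σ (2 * n) x * (if x ∈ H0 then 1 else 0) ≤ c ^ 2) (d : G) :
    ∑ x, wk S σ m x * (if d * x ∈ H0 then 1 else 0) ≤ c := by
  obtain ⟨k, rfl⟩ := Nat.exists_eq_add_of_le hnm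
  rw [← avg_pow_eq_one, add_comm, pow_add, Module.End.mul_apply]
  rw [← avg_pow_const S hS σ k c 1]
  apply avg_pow_mono
  intro x
  rw [avg_pow_eq]
  have := (coset_sq S σ hsym n H0 (d * x)).trans hH
  have h2 := abs_le_of_sq_le_sq this hc
  simp only [mul_assoc] at h2
  exact (abs_le.1 h2).2
end

section
variable (p : ℕ) [Fact p.Prime]
local notation "SLZ" => Matrix.SpecialLinearGroup (Fin 2) ℤ


theorem return_prob {S : Finset SLZ} (hsym : ∀ s ∈ S, s⁻¹ ∈ S)
    (hfree : ∀ l, l ≠ [] → Red S l → l.prod ≠ 1) (hcard : 4 ≤ S.card) {β r : ℝ}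
    (hβ : 0 < β) (hβ2 : ((S.card : ℝ) - 1) * β ^ 2 = 1)
    (hr : r * S.card = 2 * ((S.card : ℝ) - 1) * β)
    {D : ℝ} (hD : ∀ s ∈ S, sl2zOpNorm s ≤ D) (hD1 : 1 ≤ D) (N : ℕ)
    (hp : 2 * D ^ N < p) :
    wk S (Matrix.SpecialLinearGroup.map (n := Fin 2) (Int.castRingHom (ZMod p))) N 1 ≤ r ^ N := by
  have h := avg_pow_map (Matrix.SpecialLinearGroup.map (n := Fin 2) (Int.castRingHom (ZMod p)))
    S id N (Pi.single 1 1) 1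
  rw [map_one] at h
  unfold wk
  refine h.symm.le.trans ?_
  refine (free_walk_ball hsym hfree hcard β r hβ hβ2 hr N {1} _ ?_ ?_).trans (by simp)
  · intro y; simp only [Pi.single_apply]; split_ifs <;> norm_num
  · intro y hy hy1
    simp only [Pi.single_apply]
    rw [if_neg]
    intro h1
    simp at hy1
    apply hy1
    exact ball_inj hD hD1 p N hp hy ⟨[], red_nil S, by simp, rfl⟩ (by rw [h1, map_one])

open Classical in
theorem sub_mass {S : Finset SLZ} (hsym : ∀ s ∈ S, s⁻¹ ∈ S)
    (hfree : ∀ l, l ≠ [] → Red S l → l.prod ≠ 1) (hcard : 4 ≤ S.card) {β r : ℝ}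
    (hβ : 0 < β) (hβ2 : ((S.card : ℝ) - 1) * β ^ 2 = 1)
    (hr : r * S.card = 2 * ((S.card : ℝ) - 1) * β)
    {D : ℝ} (hD : ∀ s ∈ S, sl2zOpNorm s ≤ D) (hD1 : 1 ≤ D) (N : ℕ)
    (hp : 2 * D ^ (8 * N) < p) (h2 : (2 : ZMod p) ≠ 0)
    (H0 : Subgroup (Matrix.SpecialLinearGroup (Fin 2) (ZMod p))) (hH : H0 ≠ ⊤) :
    ∑ x, wk S (Matrix.SpecialLinearGroup.map (n := Fin 2) (Int.castRingHom (ZMod p))) N x *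
      (if x ∈ H0 then 1 else 0) ≤ (120 + (8 * N + 2) * (4 * N + 2)) * r ^ N := by
  set φ := Matrix.SpecialLinearGroup.map (n := Fin 2) (Int.castRingHom (ZMod p)) with hφ
  have hinj : ∀ x y, InBall S (8 * N) x → InBall S (8 * N) y → φ x = φ y → x = y :=
    fun x y hx hy h => ball_inj hD hD1 p _ hp hx hy h
  have h := avg_pow_map φ S id N (fun x => if x ∈ H0 then (1:ℝ) else 0) 1
  rw [map_one] at h
  rw [← avg_pow_eq_one]
  refine h.symm.le.trans ?_
  have hr0 : 0 ≤ r := by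
    have hk : (4 : ℝ) ≤ S.card := by exact_mod_cast hcard
    have : 0 ≤ r * S.card := by rw [hr]; have : 0 ≤ (S.card : ℝ) - 1 := by linarith
                                positivity
    nlinarith
  have hfin : {y | InBall S N y ∧ φ y ∈ H0}.Finite := by
    apply Set.Finite.of_finite_image (f := φ) (Set.toFinite _)
    intro x hx y hy hxy
    exact hinj x y (inBall_mono (by omega) hx.1) (inBall_mono (by omega) hy.1) hxy
  set Y := hfin.toFinset with hYdef
  have hY : ∀ y, y ∈ Y ↔ InBall S N y ∧ φ y ∈ H0 := by
    intro y; simp [hYdef]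
  refine (free_walk_ball hsym hfree hcard β r hβ hβ2 hr N Y _ ?_ ?_).trans ?_
  · intro y; split_ifs <;> norm_num
  · intro y hy hy1
    rw [if_neg]
    intro h1
    exact hy1 ((hY y).2 ⟨hy, h1⟩)
  · refine mul_le_mul_of_nonneg_right ?_ (pow_nonneg hr0 _)
    have : Y.card ≤ 120 + (8 * N + 2) * (4 * N + 2) := by
      rcases dickson h2 H0 hH with hs | hm
      · refine le_trans (le_trans ?_ hs) (by omega)
        rw [Nat.card_eq_fintype_card, ← Fintype.card_coe Y]
        apply Fintype.card_le_of_injective (fun y : Y => (⟨φ y.1, ((hY _).1 y.2).2⟩ : H0))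
        intro x y hxy
        simp only [Subtype.mk.injEq] at hxy
        exact Subtype.ext (hinj _ _ (inBall_mono (by omega) ((hY _).1 x.2).1)
          (inBall_mono (by omega) ((hY _).1 y.2).1) hxy)
      · refine le_trans (metab_count hsym hfree (by omega) CT_int N Y
          (fun y hy => ((hY y).1 hy).1) ?_) (by omega)
        intro a ha b hb c hc d hd
        rw [hY] at ha hb hc hd
        have hb4 : ∀ a b, InBall S N a → InBall S N b → InBall S (4 * N) (a * b * a⁻¹ * b⁻¹) := by
          intro a b ha hb
          exact inBall_mono (by omega) (inBall_mul hsym (inBall_mul hsym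
            (inBall_mul hsym ha hb) (inBall_inv hsym ha)) (inBall_inv hsym hb))
        apply hinj
        · exact inBall_mono (by omega) (inBall_mul hsym (hb4 a b ha.1 hb.1) (hb4 c d hc.1 hd.1))
        · exact inBall_mono (by omega) (inBall_mul hsym (hb4 c d hc.1 hd.1) (hb4 a b ha.1 hb.1))
        · have := hm _ ha.2 _ hb.2 _ hc.2 _ hd.2
          simpa only [map_mul, map_inv] using this
    exact_mod_cast this
end
end BG

namespace BG
open Finset Pointwise

section
variable {G ι : Type*} [Group G] [Fintype G] [DecidableEq G] (S : Finset ι) (σ : ι → G)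

lemma avg_sum_eq (hS : S.Nonempty) (f : G → ℝ) : ∑ x, avg S σ f x = ∑ x, f x := by
  have hk : (S.card : ℝ) ≠ 0 := by exact_mod_cast (card_pos.2 hS).ne'
  simp only [avg_apply, ← sum_div]
  rw [sum_comm]
  have : ∀ s ∈ S, ∑ x, f (x * σ s) = ∑ x, f x := fun s _ =>
    Equiv.sum_comp (Equiv.mulRight (σ s)) f
  rw [sum_congr rfl this]
  simp; field_simp

lemma avg_quad_le (hS : S.Nonempty) (f : G → ℝ) : ∑ x, avg S σ f x * f x ≤ ∑ x, f x ^ 2 := by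
  have hk : (0 : ℝ) < S.card := by exact_mod_cast (card_pos.2 hS)
  simp only [avg_apply, div_mul_eq_mul_div, ← sum_div, sum_mul]
  rw [div_le_iff₀ hk, sum_comm]
  have : ∀ s ∈ S, ∑ x, f (x * σ s) * f x ≤ ∑ x, f x ^ 2 := fun s _ => by
    have e : ∑ x, f (x * σ s) ^ 2 = ∑ x, f x ^ 2 :=
      Equiv.sum_comp (Equiv.mulRight (σ s)) (fun x => f x ^ 2)
    have : ∑ x, f (x * σ s) * f x ≤ ∑ x, (f (x * σ s) ^ 2 + f x ^ 2) / 2 :=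
      sum_le_sum fun x _ => by nlinarith [sq_nonneg (f (x * σ s) - f x)]
    rw [← sum_div, sum_add_distrib, e] at this
    linarith
  refine (sum_le_sum this).trans ?_
  simp [mul_comm]

theorem exists_eigen (hS : S.Nonempty) (hG : 2 ≤ Fintype.card G)
    (hsym : ∀ f : G → ℝ, ∑ s ∈ S, f (σ s) = ∑ s ∈ S, f (σ s)⁻¹) :
    ∃ L : ℝ, (∀ f : G → ℝ, ∑ x, f x = 0 → ∑ x, avg S σ f x * f x ≤ L * ∑ x, f x ^ 2) ∧
      ∃ v : G → ℝ, v ≠ 0 ∧ ∑ x, v x = 0 ∧ avg S σ v = L • v := by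
  let E := EuclideanSpace ℝ G
  let e : E ≃ₗ[ℝ] (G → ℝ) := WithLp.linearEquiv 2 ℝ (G → ℝ)
  let T : E →ₗ[ℝ] E := e.symm.conj (avg S σ)
  have hTa : ∀ (x : E) (g : G), (T x) g = avg S σ (e x) g := fun x g => rfl
  have hinner : ∀ x y : E, inner ℝ x y = ∑ g, (e x) g * (e y) g := by
    intro x y
    rw [PiLp.inner_apply]
    refine sum_congr rfl fun g _ => ?_
    simp [e, mul_comm]
    rfl
  have hT : T.IsSymmetric := by
    intro x y
    rw [hinner, hinner]
    exact avg_symm S σ hsym (e x) (e y)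
  let W : Submodule ℝ E :=
    { carrier := {x | ∑ g, (e x) g = 0}
      add_mem' := by
        intro a b ha hb
        simp only [Set.mem_ofPred_eq] at ha hb ⊢
        simp [sum_add_distrib, ha, hb]
      zero_mem' := by simp
      smul_mem' := by
        intro c a ha
        simp only [Set.mem_ofPred_eq] at ha ⊢
        simp [← mul_sum, ha] }
  have hWm : ∀ x : E, x ∈ W ↔ ∑ g, (e x) g = 0 := fun x => Iff.rfl
  have hW : ∀ x ∈ W, T x ∈ W := by
    intro x hx
    rw [hWm] at hx ⊢
    exact (avg_sum_eq S σ hS (e x)).trans hx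
  have hsymW := hT.restrict_invariant hW
  obtain ⟨a, ha⟩ : ∃ a : G, a ≠ 1 := by
    have := Fintype.one_lt_card_iff_nontrivial.1 (by omega : 1 < Fintype.card G)
    exact exists_ne 1
  have hnt : Nontrivial W := by
    refine ⟨⟨⟨e.symm (Pi.single a 1 - Pi.single 1 1), ?_⟩, 0, ?_⟩⟩
    · rw [hWm]; simp
    · intro h
      have := congrArg (fun w : W => e w.1 a) h
      simp [ha] at this
  have hev := hsymW.hasEigenvalue_iSup_of_finiteDimensional
  set L : ℝ := ⨆ x : { x : W // x ≠ 0 }, RCLike.re (inner ℝ ((T.restrict hW) x) (x : W)) / ‖(x : W)‖ ^ 2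
  have hnorm : ∀ x : W, ‖x‖ ^ 2 = ∑ g, (e x.1) g ^ 2 := by
    intro x
    rw [Submodule.coe_norm, EuclideanSpace.norm_sq_eq]
    refine sum_congr rfl fun g _ => ?_
    simp [e]
    rfl
  have hq : ∀ x : W, RCLike.re (inner ℝ ((T.restrict hW) x) x) = ∑ g, avg S σ (e x.1) g * e x.1 g := by
    intro x
    rw [Submodule.coe_inner, hinner]
    rfl
  have hbdd : BddAbove (Set.range fun x : { x : W // x ≠ 0 } =>
      RCLike.re (inner ℝ ((T.restrict hW) x) (x : W)) / ‖(x : W)‖ ^ 2) := by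
    refine ⟨1, ?_⟩
    rintro _ ⟨x, rfl⟩
    simp only
    rw [hq, hnorm]
    exact div_le_one_of_le₀ (avg_quad_le S σ hS _) (sum_nonneg fun _ _ => sq_nonneg _)
  refine ⟨L, ?_, ?_⟩
  · intro f hf
    by_cases h0 : f = 0
    · subst h0; simp
    let x : W := ⟨e.symm f, by rw [hWm]; simpa using hf⟩
    have hx : x ≠ 0 := by
      intro h
      apply h0
      have := congrArg (fun w : W => e w.1) h
      simpa [x] using this
    have hle := le_ciSup hbdd ⟨x, hx⟩
    simp only at hle
    rw [div_le_iff₀ (by positivity), hq, hnorm] at hle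
    exact hle
  · obtain ⟨v, hv⟩ := hev.exists_hasEigenvector
    refine ⟨e v.1, ?_, v.2, ?_⟩
    · intro h
      apply hv.2
      apply Subtype.ext
      exact e.map_eq_zero_iff.1 h
    · have := congrArg (fun w : W => e w.1) hv.apply_eq_smul
      exact this
end
end BG

namespace BG
open Finset Pointwise

section
variable {G ι : Type*} [Group G] [Fintype G] [DecidableEq G] (S : Finset ι) (σ : ι → G)

lemma avg_pow_eigen {L : ℝ} {v : G → ℝ} (hv : avg S σ v = L • v) (n : ℕ) :
    (avg S σ ^ n) v = L ^ n • v := by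
  induction n with
  | zero => simp
  | succ n ih => rw [avg_pow_succ, ih, map_smul, hv, smul_smul, pow_succ]

lemma wk_eigen {L : ℝ} {h : G → ℂ} (hre : avg S σ (fun x => (h x).re) = L • fun x => (h x).re)
    (him : avg S σ (fun x => (h x).im) = L • fun x => (h x).im) (n : ℕ) (g : G) :
    ∑ y, (wk S σ n (g⁻¹ * y) : ℂ) * h y = (L : ℂ) ^ n * h g := by
  have key : ∀ v : G → ℝ, avg S σ v = L • v → ∑ y, wk S σ n (g⁻¹ * y) * v y = L ^ n * v g := by
    intro v hv
    have h1 := congrFun (avg_pow_eigen S σ hv n) g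
    rw [avg_pow_eq] at h1
    rw [← Equiv.sum_comp (Equiv.mulLeft g)]
    simpa using h1
  have h1 := key _ hre
  have h2 := key _ him
  rw [← Complex.ofReal_pow]
  apply Complex.ext
  · rw [Complex.re_sum, Complex.re_ofReal_mul, ← h1]
    exact sum_congr rfl fun y _ => Complex.re_ofReal_mul _ _
  · rw [Complex.im_sum, Complex.im_ofReal_mul, ← h2]
    exact sum_congr rfl fun y _ => Complex.im_ofReal_mul _ _

theorem bessel_mult (hsym : ∀ f : G → ℝ, ∑ s ∈ S, f (σ s) = ∑ s ∈ S, f (σ s)⁻¹)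
    {κ : Type*} [Fintype κ] (h : κ → G → ℂ) (L : ℝ)
    (hne : ∀ a, h a ≠ 0) (horth : ∀ a b, a ≠ b → ∑ x, (starRingEnd ℂ) (h a x) * h b x = 0)
    (hre : ∀ a, avg S σ (fun x => (h a x).re) = L • fun x => (h a x).re)
    (him : ∀ a, avg S σ (fun x => (h a x).im) = L • fun x => (h a x).im) (n : ℕ) :
    (Fintype.card κ : ℝ) * L ^ (2 * n) ≤ Fintype.card G * wk S σ (2 * n) 1 := by
  classical
  let u : κ → EuclideanSpace ℂ G := fun a => WithLp.toLp 2 (h a)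
  have hu0 : ∀ a, ‖u a‖ ≠ 0 := by
    intro a h0
    apply hne a
    have := norm_eq_zero.1 h0
    funext x
    exact congrArg (fun w : EuclideanSpace ℂ G => w x) this
  let v : κ → EuclideanSpace ℂ G := fun a => ((‖u a‖ : ℂ)⁻¹) • u a
  have hv : Orthonormal ℂ v := by
    refine ⟨?_, ?_⟩
    · intro a
      simp only [v, norm_smul, norm_inv, Complex.norm_real, norm_norm]
      exact inv_mul_cancel₀ (hu0 a)
    · intro a b hab
      simp only [v, inner_smul_left, inner_smul_right]
      have : inner ℂ (u a) (u b) = 0 := by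
        rw [PiLp.inner_apply, ← horth a b hab]
        refine sum_congr rfl fun x _ => ?_
        simp [u, mul_comm]
      rw [this]; simp
  let w : G → EuclideanSpace ℂ G := fun g => WithLp.toLp 2 (fun y => (wk S σ n (g⁻¹ * y) : ℂ))
  have hw : ∀ g, ‖w g‖ ^ 2 = wk S σ (2 * n) 1 := by
    intro g
    rw [EuclideanSpace.norm_sq_eq, wk_two S σ hsym, ← Equiv.sum_comp (Equiv.mulLeft g)]
    refine sum_congr rfl fun x _ => ?_
    simp [w]
  have hin : ∀ a g, ‖inner ℂ (v a) (w g)‖ ^ 2 = L ^ (2 * n) * ‖v a g‖ ^ 2 := by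
    intro a g
    have h1 : inner ℂ (w g) (u a) = (L : ℂ) ^ n * h a g := by
      rw [← wk_eigen S σ (hre a) (him a) n g, PiLp.inner_apply]
      refine sum_congr rfl fun x _ => ?_
      simp [u, w, mul_comm]
    rw [norm_inner_symm]
    simp only [v, inner_smul_right, h1]
    simp only [norm_mul, norm_pow, Complex.norm_real, PiLp.smul_apply, u, norm_smul]
    rw [pow_mul]
    rw [mul_pow, mul_pow, mul_pow, ← pow_mul, mul_comm n 2, pow_mul, Real.norm_eq_abs, sq_abs]
    ring
  have hB : ∀ g, ∑ a, L ^ (2 * n) * ‖v a g‖ ^ 2 ≤ wk S σ (2 * n) 1 := by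
    intro g
    have := hv.sum_inner_products_le (w g) (s := univ)
    rw [hw] at this
    simpa only [hin] using this
  have hsum := sum_le_sum fun (g : G) (_ : g ∈ univ) => hB g
  rw [sum_comm] at hsum
  simp only [← mul_sum] at hsum
  have hone : ∀ a, ∑ g, ‖v a g‖ ^ 2 = 1 := by
    intro a
    rw [← EuclideanSpace.norm_sq_eq, hv.1 a, one_pow]
  simp only [hone] at hsum
  simpa [mul_comm] using hsum
end
end BG

namespace BG
open Finset Pointwise

section
variable {p : ℕ} [Fact p.Prime]
local notation "SL" => Matrix.SpecialLinearGroup (Fin 2) (ZMod p)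

/-- The stabilizer of a function under left translations. -/
def stabL (v : SL → ℝ) : Subgroup SL where
  carrier := {h | ∀ y, v (h * y) = v y}
  one_mem' := by intro y; rw [one_mul]
  mul_mem' := by
    intro a b ha hb y
    rw [mul_assoc, ha, hb]
  inv_mem' := by
    intro a ha y
    have := ha (a⁻¹ * y)
    rw [mul_inv_cancel_left] at this
    exact this.symm

lemma not_invariant (v : SL → ℝ) (hv0 : v ≠ 0) (hv : ∑ x, v x = 0) :
    ∃ g x : SL, v (g * (up 1 * x)) ≠ v (g * x) := by
  by_contra hcon
  push Not at hcon
  have hconj : ∀ g : SL, g * up 1 * g⁻¹ ∈ stabL v := by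
    intro g y
    have := hcon g (g⁻¹ * y)
    rw [mul_inv_cancel_left] at this
    rw [← this]
    simp only [mul_assoc]
  have hu : up (1 : ZMod p) ∈ stabL v := by simpa using hconj 1
  have hl : lo (-1 : ZMod p) ∈ stabL v := by
    have := hconj (mk2 0 1 (-1) 0 (by ring))
    convert this using 1
    rw [eq_mul_inv_iff_mul_eq]
    apply sl_ext <;> simp [lo, up, mul00, mul01, mul10, mul11]
  have htop := uplo_top (stabL v) (up_all _ one_ne_zero hu) (lo_all _ (by simp) hl)
  have hc : ∀ g, v g = v 1 := by
    intro g
    have : g ∈ stabL v := by rw [htop]; trivial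
    simpa using this 1
  apply hv0
  funext g
  have h1 : ∑ x : SL, v x = Fintype.card SL * v 1 := by
    rw [sum_congr rfl fun x _ => hc x]; simp
  rw [hv] at h1
  have : (Fintype.card SL : ℝ) ≠ 0 := by exact_mod_cast Fintype.card_ne_zero
  rw [hc g]
  rcases mul_eq_zero.1 h1.symm with h | h
  · exact absurd h this
  · simpa using h

/-- The twisted sum along the unipotent subgroup. -/
noncomputable def tw (f : SL → ℝ) (j : ZMod p) (x : SL) : ℂ :=
  ∑ b : ZMod p, ZMod.stdAddChar (-(j * b)) * (f (up b * x) : ℂ)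

lemma tw_up (f : SL → ℝ) (j c : ZMod p) (x : SL) :
    tw f j (up c * x) = ZMod.stdAddChar (j * c) * tw f j x := by
  unfold tw
  rw [mul_sum, ← Equiv.sum_comp (Equiv.addRight c)
    (fun b => ZMod.stdAddChar (j * c) * (ZMod.stdAddChar (-(j * b)) * (f (up b * x) : ℂ)))]
  refine sum_congr rfl fun b _ => ?_
  rw [← mul_assoc, up_mul, ← mul_assoc, ← AddChar.map_add_eq_mul, Equiv.coe_addRight]
  congr 3
  ring

lemma tw_ne (f : SL → ℝ) {x : SL} (hx : f (up 1 * x) ≠ f x) : ∃ j, j ≠ 0 ∧ tw f j ≠ 0 := by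
  by_contra hcon
  push Not at hcon
  have hs : ∀ y : SL, (p : ℂ) * f y = tw f 0 y := by
    intro y
    have h1 : ∑ j, tw f j y = tw f 0 y := by
      rw [sum_eq_single 0]
      · intro j _ hj; rw [hcon j hj]; rfl
      · simp
    rw [← h1]
    unfold tw
    rw [sum_comm]
    have h2 : ∀ b : ZMod p, ∑ j : ZMod p, (ZMod.stdAddChar (-(j * b)) : ℂ) =
        if b = 0 then (p : ℂ) else 0 := by
      intro b
      have := AddChar.sum_mulShift (-b) (ZMod.isPrimitive_stdAddChar p)
      simpa using this
    simp only [← sum_mul, h2, ite_mul, zero_mul, sum_ite_eq', mem_univ, if_true, up_zero, one_mul]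
  apply hx
  have h3 := tw_up f 0 1 x
  rw [← hs, ← hs] at h3
  have hp : (p : ℂ) ≠ 0 := by exact_mod_cast (Fact.out : p.Prime).ne_zero
  simp only [zero_mul, AddChar.map_zero_eq_one, one_mul] at h3
  exact_mod_cast mul_left_cancel₀ hp h3

/-- Diagonal matrices. -/
def dg (a : (ZMod p)ˣ) : SL := mk2 a 0 0 (a⁻¹ : (ZMod p)ˣ)
  (by rw [Units.mul_inv, mul_zero, sub_zero])

lemma dg_up (a : (ZMod p)ˣ) (c : ZMod p) : dg a * up c = up ((a : ZMod p) ^ 2 * c) * dg a := by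
  apply sl_ext <;> simp only [dg, up, mul00, mul01, mul10, mul11, mk2_00, mk2_01, mk2_10, mk2_11]
  · ring
  · have : (a : ZMod p) * ((a⁻¹ : (ZMod p)ˣ) : ZMod p) = 1 := Units.mul_inv a
    linear_combination (-(a : ZMod p) * c) * this
  · ring
  · ring

theorem quasirandom (h2 : (2 : ZMod p) ≠ 0) {ι : Type*} (S : Finset ι) (σ : ι → SL)
    (hsym : ∀ f : SL → ℝ, ∑ s ∈ S, f (σ s) = ∑ s ∈ S, f (σ s)⁻¹) (L : ℝ)
    (v : SL → ℝ) (hv0 : v ≠ 0) (hv : ∑ x, v x = 0) (hvL : avg S σ v = L • v) (n : ℕ) :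
    ((p : ℝ) - 1) / 2 * L ^ (2 * n) ≤ Fintype.card SL * wk S σ (2 * n) 1 := by
  obtain ⟨g, x0, hgx⟩ := not_invariant v hv0 hv
  obtain ⟨j, hj, hjne⟩ := tw_ne (fun y => v (g * y)) hgx
  set F := tw (fun y => v (g * y)) j with hF
  have hFev : ∀ y : SL, ∀ z : SL → SL, (∀ y s, z (y * s) = z y * s) →
      (avg S σ (fun x => (F (z x)).re) = L • fun x => (F (z x)).re) ∧
      (avg S σ (fun x => (F (z x)).im) = L • fun x => (F (z x)).im) := by
    intro y z hz
    have hlin : ∀ c : ZMod p → ℝ, avg S σ (fun x => ∑ b, c b * v (g * (up b * z x))) =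
        L • fun x => ∑ b, c b * v (g * (up b * z x)) := by
      intro c
      have e : ∀ b, avg S σ (fun x => v (g * (up b * z x))) =
          L • fun x => v (g * (up b * z x)) := by
        intro b
        funext x
        have := congrFun hvL (g * (up b * z x))
        rw [avg_apply] at this ⊢
        simp only [hz, Pi.smul_apply, smul_eq_mul, mul_assoc] at this ⊢
        exact this
      have e2 : (fun x => ∑ b, c b * v (g * (up b * z x))) =
          ∑ b, c b • fun x => v (g * (up b * z x)) := by
        funext x; simp
      rw [e2, map_sum, smul_sum]
      refine sum_congr rfl fun b _ => ?_
      rw [map_smul, e b, smul_comm]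
    constructor
    · have := hlin (fun b => (ZMod.stdAddChar (-(j * b)) : ℂ).re)
      simpa only [hF, tw, Complex.re_sum, Complex.re_mul_ofReal] using this
    · have := hlin (fun b => (ZMod.stdAddChar (-(j * b)) : ℂ).im)
      simpa only [hF, tw, Complex.im_sum, Complex.im_mul_ofReal] using this
  let T : Finset (ZMod p) := univ.image (fun a : (ZMod p)ˣ => (a : ZMod p) ^ 2)
  have hT : ∀ t : T, ∃ a : (ZMod p)ˣ, (a : ZMod p) ^ 2 = t.1 := by
    intro t
    obtain ⟨a, -, ha⟩ := mem_image.1 t.2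
    exact ⟨a, ha⟩
  choose r hr using hT
  have hcardT : ((p : ℝ) - 1) / 2 ≤ T.card := by
    have h := card_le_mul_card_image (s := (univ : Finset (ZMod p)ˣ))
      (f := fun a : (ZMod p)ˣ => (a : ZMod p) ^ 2) 2 (by
        intro c hc
        obtain ⟨a, -, rfl⟩ := mem_image.1 hc
        refine (card_le_card (t := {a, -a}) ?_).trans card_le_two
        intro b hb
        have hb := (mem_filter.1 hb).2
        rcases sq_eq_sq_iff_eq_or_eq_neg.1 hb with h | h
        · simp [Units.ext h]
        · have : b = -a := Units.ext (by simpa using h)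
          simp [this])
    rw [card_univ, ZMod.card_units] at h
    have hp1 : 1 ≤ p := (Fact.out : p.Prime).one_lt.le
    have : (p : ℝ) - 1 ≤ 2 * T.card := by
      have h' : ((p - 1 : ℕ) : ℝ) ≤ ((2 * T.card : ℕ) : ℝ) := by exact_mod_cast h
      rw [Nat.cast_sub hp1] at h'
      push_cast at h'
      exact h'
    linarith
  have hB := bessel_mult S σ hsym (fun (t : T) x => F (dg (r t) * x)) L ?_ ?_
    (fun t => (hFev 1 (fun x => dg (r t) * x) (fun y s => (mul_assoc _ _ _).symm)).1)
    (fun t => (hFev 1 (fun x => dg (r t) * x) (fun y s => (mul_assoc _ _ _).symm)).2) n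
  · refine le_trans (mul_le_mul_of_nonneg_right ?_ (by rw [pow_mul]; positivity)) hB
    simpa using hcardT
  · intro t h0
    apply hjne
    funext x
    have := congrFun h0 ((dg (r t))⁻¹ * x)
    simpa using this
  · intro a b hab
    have htr : ∀ (t : T) x, F (dg (r t) * (up 1 * x)) =
        ZMod.stdAddChar (j * t.1) * F (dg (r t) * x) := by
      intro t x
      rw [← mul_assoc, dg_up, mul_assoc, hF, tw_up, mul_one, hr]
    set Z := ∑ x, (starRingEnd ℂ) (F (dg (r a) * x)) * F (dg (r b) * x) with hZ
    have h1 : Z = (starRingEnd ℂ) (ZMod.stdAddChar (j * a.1)) * ZMod.stdAddChar (j * b.1) * Z := by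
      conv_lhs => rw [hZ, ← Equiv.sum_comp (Equiv.mulLeft (up (1 : ZMod p)))]
      rw [hZ, mul_sum]
      refine sum_congr rfl fun x _ => ?_
      rw [Equiv.coe_mulLeft, htr, htr, map_mul]
      ring
    have h3 : (starRingEnd ℂ) (ZMod.stdAddChar (j * a.1)) * ZMod.stdAddChar (j * b.1) ≠ 1 := by
      intro h
      apply hab
      have h4 : (starRingEnd ℂ) (ZMod.stdAddChar (j * a.1)) = ZMod.stdAddChar (-(j * a.1)) := by
        rw [AddChar.map_neg_eq_conj]
      rw [h4, ← AddChar.map_add_eq_mul, ← AddChar.map_zero_eq_one (ZMod.stdAddChar (N := p))] at h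
      have h5 := ZMod.injective_stdAddChar h
      have h6 : j * (b.1 - a.1) = 0 := by linear_combination h5
      rcases mul_eq_zero.1 h6 with h | h
      · exact absurd h hj
      · exact Subtype.ext (sub_eq_zero.1 h).symm
    have h5 : ((starRingEnd ℂ) (ZMod.stdAddChar (j * a.1)) * ZMod.stdAddChar (j * b.1) - 1) * Z = 0 := by
      linear_combination (-1 : ℂ) * h1
    rcases mul_eq_zero.1 h5 with h | h
    · exact absurd (sub_eq_zero.1 h) h3
    · exact h
end
end BG

namespace BG
open Finset Pointwise

section
variable {p : ℕ} [Fact p.Prime]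
local notation "SL" => Matrix.SpecialLinearGroup (Fin 2) (ZMod p)

lemma card_SL_le : Fintype.card SL ≤ p ^ 3 := by
  have h : Fintype.card SL ≤ Fintype.card (ZMod p × ZMod p × ZMod p) := by
    apply Fintype.card_le_of_injective
      (fun g : SL => (g.1 0 0, g.1 0 1, if g.1 0 0 = 0 then g.1 1 1 else g.1 1 0))
    intro x y hxy
    simp only [Prod.mk.injEq] at hxy
    obtain ⟨h0, h1, h2⟩ := hxy
    have dx := sl_det x
    have dy := sl_det y
    by_cases hx : x.1 0 0 = 0
    · have hy : y.1 0 0 = 0 := by rw [← h0]; exact hx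
      rw [if_pos hx, if_pos hy] at h2
      rw [hx] at dx
      rw [hy, ← h1] at dy
      have hne : x.1 0 1 ≠ 0 := by
        intro h; rw [h] at dx; simp at dx
      have : x.1 1 0 = y.1 1 0 := by
        apply mul_left_cancel₀ hne
        linear_combination dy - dx
      exact sl_ext h0 h1 this h2
    · have hy : y.1 0 0 ≠ 0 := by rw [← h0]; exact hx
      rw [if_neg hx, if_neg hy] at h2
      rw [← h0, ← h1, ← h2] at dy
      have : x.1 1 1 = y.1 1 1 := by
        apply mul_left_cancel₀ hx
        linear_combination dx - dy
      exact sl_ext h0 h1 h2 this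
  have h3 : Fintype.card (ZMod p × ZMod p × ZMod p) = p ^ 3 := by
    simp [Fintype.card_prod, ZMod.card]; ring
  omega

theorem step {ι : Type*} (h2 : (2 : ZMod p) ≠ 0) (S : Finset ι) (hS : S.Nonempty) (σ : ι → SL)
    (hsym : ∀ f : SL → ℝ, ∑ s ∈ S, f (σ s) = ∑ s ∈ S, f (σ s)⁻¹)
    (n0 : ℕ) (K c Q : ℝ) (hK : 4096 ≤ K) (hQ : K ^ 7236 = Q) (hc : 0 ≤ c)
    (hKc : K ^ 34 * c < 1)
    (hsub : ∀ H0 : Subgroup SL, H0 ≠ ⊤ → ∀ h : SL → ℝ, (∀ x, h x ≤ 1) → (∀ x, x ∉ H0 → h x ≤ 0) →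
      ∑ x, wk S σ (2 * n0) x * h x ≤ c ^ 2)
    (hE : 64 * 343 * Q ^ 2 * (K ^ 32 * wk S σ (2 * n0) 1) < 1)
    (m : ℕ) (hm : n0 ≤ m) :
    wk S σ (2 * (4 * m)) 1 ≤ wk S σ (2 * m) 1 / K ∨
    ((p : ℝ) ^ 2 - p) ^ 3 * wk S σ (2 * m) 1 ^ 2 ≤ 64 * 28 ^ 3 * Q ^ 5 * (K ^ 28) ^ 2 := by
  classical
  rcases le_or_gt (wk S σ (2 * (4 * m)) 1) (wk S σ (2 * m) 1 / K) with h | hT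
  · exact Or.inl h
  right
  obtain ⟨H, h1, hinv, h38, hlow, hup, d, hd⟩ := walk_approx S σ hsym hS m K hK hT.le
  rw [hQ] at h38
  have hK1 : 1 ≤ K := by linarith
  have hQ1 : 1 ≤ Q := by rw [← hQ]; exact one_le_pow₀ hK1
  obtain ⟨b, rfl⟩ := Nat.exists_eq_add_of_le hm
  have hanti := wk_anti S σ hsym hS n0 b
  have hEm := wk_pos S σ hsym hS (n0 + b)
  have hE0 := wk_pos S σ hsym hS n0
  by_cases hgen : Subgroup.closure (H : Set SL) = ⊤
  · have hHE : 1 ≤ (H.card : ℝ) * (K ^ 32 * wk S σ (2 * n0) 1) := by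
      refine hlow.trans ?_
      refine mul_le_mul_of_nonneg_left ?_ (Nat.cast_nonneg _)
      exact mul_le_mul_of_nonneg_left hanti (by positivity)
    have hpos : 0 < K ^ 32 * wk S σ (2 * n0) 1 := by positivity
    have hc2 : 64 * 343 * Q ^ 2 < H.card := by
      by_contra hcon
      push Not at hcon
      have := mul_le_mul_of_nonneg_right hcon hpos.le
      linarith
    have hc1 : 81 < H.card := by
      have : (81 : ℝ) < H.card := by
        have : (1 : ℝ) ≤ Q ^ 2 := one_le_pow₀ hQ1
        linarith
      exact_mod_cast this
    have hP := product_thm h2 H h1 hinv hgen Q hQ1 h38 hc1 hc2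
    rw [ZMod.card] at hP
    have h3 := mul_le_mul_of_nonneg_right hP (sq_nonneg (wk S σ (2 * (n0 + b)) 1))
    refine h3.trans ?_
    rw [mul_assoc, ← mul_pow]
    refine mul_le_mul_of_nonneg_left ?_ (by positivity)
    exact pow_le_pow_left₀ (by positivity) hup 2
  · exfalso
    have hcos := coset_mass S σ hS hsym n0 (2 * (n0 + b)) (by omega)
      (Subgroup.closure (H : Set SL)) c hc (hsub _ hgen _ (by intro x; split_ifs <;> norm_num)
        (by intro x hx; rw [if_neg hx])) d
    have := hd (Subgroup.closure (H : Set SL)) Subgroup.subset_closure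
      (fun x => if d * x ∈ Subgroup.closure (H : Set SL) then 1 else 0)
      (by intro x; split_ifs <;> norm_num) (by intro x hx; rw [if_pos hx])
    have h4 := mul_le_mul_of_nonneg_left hcos (by positivity : 0 ≤ K ^ 34)
    linarith

theorem iter {ι : Type*} (S : Finset ι) (hS : S.Nonempty) (σ : ι → SL)
    (hsym : ∀ f : SL → ℝ, ∑ s ∈ S, f (σ s) = ∑ s ∈ S, f (σ s)⁻¹)
    (n0 : ℕ) (K B : ℝ) (hK : 1 ≤ K)
    (hstep : ∀ m, n0 ≤ m → wk S σ (2 * (4 * m)) 1 ≤ wk S σ (2 * m) 1 / K ∨ wk S σ (2 * m) 1 ≤ B)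
    (J : ℕ) : wk S σ (2 * (4 ^ J * n0)) 1 ≤ B ∨ wk S σ (2 * (4 ^ J * n0)) 1 ≤ (1 / K) ^ J := by
  induction J with
  | zero =>
    right
    have h := wk_sum S σ hS (2 * (4 ^ 0 * n0))
    have h2 := single_le_sum (f := fun x => wk S σ (2 * (4 ^ 0 * n0)) x)
      (fun x _ => wk_nonneg S σ _ x) (mem_univ (1 : SL))
    rw [h] at h2
    rw [pow_zero (1 / K)]
    exact h2
  | succ J ih =>
    have e : 4 ^ (J + 1) * n0 = 4 * (4 ^ J * n0) := by ring
    have e2 : 4 * (4 ^ J * n0) = 4 ^ J * n0 + 3 * (4 ^ J * n0) := by ring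
    have hanti : wk S σ (2 * (4 * (4 ^ J * n0))) 1 ≤ wk S σ (2 * (4 ^ J * n0)) 1 := by
      rw [e2]; exact wk_anti S σ hsym hS _ _
    rw [e]
    have hpos : 1 ≤ 4 ^ J := Nat.one_le_pow _ _ (by norm_num)
    rcases hstep (4 ^ J * n0) (by nlinarith) with h | h
    · rcases ih with ih | ih
      · left; exact hanti.trans ih
      · right
        refine h.trans ?_
        rw [pow_succ, div_eq_mul_one_div]
        exact mul_le_mul_of_nonneg_right ih (by positivity)
    · left; exact hanti.trans h

theorem gap_of_return {ι : Type*} (h2 : (2 : ZMod p) ≠ 0) (S : Finset ι) (hS : S.Nonempty)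
    (σ : ι → SL) (hsym : ∀ f : SL → ℝ, ∑ s ∈ S, f (σ s) = ∑ s ∈ S, f (σ s)⁻¹)
    (m : ℕ) (X : ℝ) (hX : (p : ℝ) = Real.exp X) (hm0 : 0 < m)
    (hret : wk S σ (2 * m) 1 ≤ Real.exp (-(5/2) * X)) (hX1 : 2 * Real.exp (X / 2) ≤
      (Real.exp X - 1) * Real.exp (-(1/4) * X)) (f : SL → ℝ) (hf : ∑ x, f x = 0) (δ : ℝ)
    (hδ : δ ≤ 1 - Real.exp (-(X / (8 * m)))) :
    δ * S.card * ∑ g, f g ^ 2 ≤ ∑ g, ∑ s ∈ S, f g * (f g - f (g * σ s)) := by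
  have hk : (0 : ℝ) < S.card := by exact_mod_cast card_pos.2 hS
  have hp1 : (1 : ℝ) < p := by exact_mod_cast (Fact.out : p.Prime).one_lt
  have hcard2 : 2 ≤ Fintype.card SL := by
    have : Nontrivial SL := ⟨⟨up 1, 1, by
      intro h
      have := congrArg (fun g : SL => g.1 0 1) h
      simp [up] at this⟩⟩
    exact Fintype.one_lt_card
  obtain ⟨L, hL, v, hv0, hv, hvL⟩ := exists_eigen S σ hS hcard2 hsym
  have hq := quasirandom h2 S σ hsym L v hv0 hv hvL m
  have hLle : L ≤ Real.exp (-(X / (8 * m))) := by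
    rcases le_or_gt L 0 with h | h
    · exact h.trans (Real.exp_pos _).le
    have hG : (Fintype.card SL : ℝ) ≤ Real.exp (3 * X) := by
      have := card_SL_le (p := p)
      have h1 : (Fintype.card SL : ℝ) ≤ (p : ℝ) ^ 3 := by exact_mod_cast this
      rw [hX, ← Real.exp_nat_mul] at h1
      exact_mod_cast h1
    have h3 : ((p : ℝ) - 1) / 2 * L ^ (2 * m) ≤ Real.exp (X / 2) := by
      refine hq.trans ?_
      calc _ ≤ Real.exp (3 * X) * Real.exp (-(5/2) * X) :=
            mul_le_mul hG hret (wk_nonneg _ _ _ _) (Real.exp_pos _).le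
        _ = _ := by rw [← Real.exp_add]; congr 1; ring
    have h4 : L ^ (2 * m) ≤ Real.exp (-(1/4) * X) := by
      have hp' : 0 < (p : ℝ) - 1 := by linarith
      rw [← hX] at hX1
      have : ((p : ℝ) - 1) * L ^ (2 * m) ≤ ((p : ℝ) - 1) * Real.exp (-(1/4) * X) := by linarith
      exact le_of_mul_le_mul_left this hp'
    have h5 : Real.exp (-(X / (8 * m))) ^ (2 * m) = Real.exp (-(1/4) * X) := by
      rw [← Real.exp_nat_mul]
      congr 1
      have : (m : ℝ) ≠ 0 := by exact_mod_cast hm0.ne'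
      push_cast
      field_simp
      ring
    rw [← h5] at h4
    exact le_of_pow_le_pow_left₀ (by omega) (Real.exp_pos _).le h4
  have hrhs : ∑ g, ∑ s ∈ S, f g * (f g - f (g * σ s)) =
      S.card * (∑ g, f g ^ 2 - ∑ g, avg S σ f g * f g) := by
    have : ∀ g, ∑ s ∈ S, f g * (f g - f (g * σ s)) = S.card * (f g ^ 2 - avg S σ f g * f g) := by
      intro g
      rw [← mul_sum, sum_sub_distrib, avg_apply]
      simp only [sum_const, nsmul_eq_mul]
      field_simp
    rw [sum_congr rfl fun g _ => this g, ← mul_sum, sum_sub_distrib]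
  rw [hrhs]
  have hsq : 0 ≤ ∑ g, f g ^ 2 := sum_nonneg fun _ _ => sq_nonneg _
  have h6 := hL f hf
  have h7 : δ * ∑ g, f g ^ 2 ≤ ∑ g, f g ^ 2 - ∑ g, avg S σ f g * f g := by
    have : δ * ∑ g, f g ^ 2 ≤ (1 - L) * ∑ g, f g ^ 2 :=
      mul_le_mul_of_nonneg_right (by linarith) hsq
    linarith
  calc _ = S.card * (δ * ∑ g, f g ^ 2) := by ring
    _ ≤ _ := mul_le_mul_of_nonneg_left h7 hk.le
end
end BG

namespace BG
open Finset Pointwise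

lemma card_le_pow {S : Finset (Matrix.SpecialLinearGroup (Fin 2) ℤ)} {D : ℝ} (hD0 : 0 ≤ D)
    (hD2 : 2 ≤ D ^ 2) (hD : ∀ s ∈ S, sl2zOpNorm s ≤ D) : (S.card : ℝ) ≤ D ^ 16 := by
  have hD14 : 1.4 ≤ D := by nlinarith
  set I : Finset ℤ := Icc (-⌊D⌋) ⌊D⌋ with hI
  have hfl : 0 ≤ ⌊D⌋ := Int.floor_nonneg.2 hD0
  have hIc : (I.card : ℝ) ≤ 2 * D + 1 := by
    have h1 : (I.card : ℤ) = 2 * ⌊D⌋ + 1 := by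
      rw [hI, Int.card_Icc, Int.toNat_of_nonneg (by omega)]; ring
    have h2 : (I.card : ℝ) = 2 * (⌊D⌋ : ℝ) + 1 := by exact_mod_cast h1
    have := Int.floor_le D
    linarith
  have hmem : ∀ s ∈ S, ∀ i j, s.1 i j ∈ I := by
    intro s hs i j
    have h := abs_le.1 ((entry_le s i j).trans (hD s hs))
    rw [hI, mem_Icc]
    have h2 : s.1 i j ≤ ⌊D⌋ := Int.le_floor.2 h.2
    have h3 : -(s.1 i j) ≤ ⌊D⌋ := Int.le_floor.2 (by push_cast; linarith [h.1])
    constructor <;> linarith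
  have hc : S.card ≤ (I ×ˢ I ×ˢ I ×ˢ I).card := by
    apply card_le_card_of_injOn (fun s => (s.1 0 0, s.1 0 1, s.1 1 0, s.1 1 1))
    · intro s hs
      simp only [coe_product, Set.mem_prod, mem_coe]
      exact ⟨hmem s hs _ _, hmem s hs _ _, hmem s hs _ _, hmem s hs _ _⟩
    · intro x _ y _ hxy
      simp only [Prod.mk.injEq] at hxy
      obtain ⟨a, b, c, d⟩ := hxy
      ext i j
      fin_cases i <;> fin_cases j <;> assumption
  have hc2 : (S.card : ℝ) ≤ (I.card : ℝ) ^ 4 := by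
    have : S.card ≤ I.card ^ 4 := by
      refine hc.trans ?_
      simp only [card_product]
      exact le_of_eq (by ring)
    exact_mod_cast this
  have h4 : 2 * D + 1 ≤ D ^ 4 := by nlinarith
  calc (S.card : ℝ) ≤ (I.card : ℝ) ^ 4 := hc2
    _ ≤ (D ^ 4) ^ 4 := pow_le_pow_left₀ (by positivity) (hIc.trans h4) 4
    _ = D ^ 16 := by ring

lemma log_A (k : ℝ) (hk : 4 ≤ k) :
    Real.log (2 / Real.sqrt 3 * Real.sqrt k) = Real.log (4 / 3 * k) / 2 := by
  have h : 2 / Real.sqrt 3 * Real.sqrt k = Real.sqrt (4 / 3 * k) := by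
    rw [Real.sqrt_mul (by norm_num), Real.sqrt_div (by norm_num)]
    congr 2
    rw [show (4:ℝ) = 2 ^ 2 by norm_num, Real.sqrt_sq (by norm_num)]
  rw [h, Real.log_sqrt (by positivity)]

lemma r_bound (k A : ℝ) (hk : 4 ≤ k) (hA : A = Real.log (4 / 3 * k) / 2) :
    ∃ β r : ℝ, 0 < β ∧ (k - 1) * β ^ 2 = 1 ∧ r * k = 2 * (k - 1) * β ∧ 0 < r ∧
      r ≤ Real.exp (-(A / 16)) := by
  have h1 : 0 < k - 1 := by linarith
  set u := Real.sqrt (k - 1) with hu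
  have hu2 : u ^ 2 = k - 1 := Real.sq_sqrt h1.le
  have hu0 : 0 < u := Real.sqrt_pos.2 h1
  refine ⟨1 / u, 2 * u / k, by positivity, ?_, ?_, by positivity, ?_⟩
  · rw [← hu2]; field_simp
  · rw [← hu2]; field_simp
  · have hq : 1 + (k - 2) / 6 ≤ k ^ 2 / (4 * (k - 1)) := by
      rw [le_div_iff₀ (by linarith)]; nlinarith
    have hb := one_add_mul_le_pow (a := (k - 2) / 6) (by linarith) 16
    have h5 : 4 / 3 * k ≤ (k ^ 2 / (4 * (k - 1))) ^ 16 := by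
      refine le_trans ?_ (hb.trans (pow_le_pow_left₀ (by linarith) hq 16))
      push_cast; linarith
    have hr0 : 0 < 2 * u / k := by positivity
    rw [← Real.exp_log hr0]
    apply Real.exp_le_exp.2
    have e : k ^ 2 / (4 * (k - 1)) = ((2 * u / k) ^ 2)⁻¹ := by
      rw [← hu2]; field_simp; norm_num
    have h6 := Real.log_le_log (by positivity) h5
    rw [e, Real.log_pow, Real.log_inv, Real.log_pow] at h6
    push_cast at h6
    rw [hA]
    linarith

open Filter in
lemma eventual (l γ ε : ℝ) (hl : 0 < l) (hγ : 0 < γ) (hγ9 : γ ≤ 9) (hε : ε = γ / 2 ^ 24) :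
    ∀ᶠ X : ℝ in atTop, 4096 ≤ Real.exp (ε * X) ∧ 17 * Real.log 2 < X ∧
      (X / (18 * l) ≤ X / (17 * l) - 1 ∧ 1 ≤ X / (18 * l)) ∧
      (120 + (16 * (X / (17 * l)) + 2) * (8 * (X / (17 * l)) + 2)) *
        Real.exp (-(γ / 144 - 68 * ε) * X) < 1 ∧
      64 * 343 * Real.exp (-(γ / 144 - 14504 * ε) * X) < 1 ∧
      8 * 64 * 28 ^ 3 ≤ Real.exp ((1 - 36236 * ε) * X) ∧
      2 * Real.exp (X / 2) ≤ (Real.exp X - 1) * Real.exp (-(1/4) * X) := by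
  have hε0 : 0 < ε := by rw [hε]; positivity
  have hexp : ∀ c : ℝ, 0 < c → Tendsto (fun X : ℝ => Real.exp (c * X)) atTop atTop := fun c hc =>
    Real.tendsto_exp_atTop.comp (tendsto_id.const_mul_atTop hc)
  have h1 := (hexp ε hε0).eventually_ge_atTop 4096
  have h2 := eventually_gt_atTop (17 * Real.log 2)
  have h3 := eventually_ge_atTop (18 * 17 * l)
  have hpoly : ∀ (c : ℝ) (n : ℕ), 0 < c →
      Tendsto (fun X : ℝ => X ^ n * Real.exp (-c * X)) atTop (nhds 0) := by
    intro c n hc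
    have := Real.tendsto_pow_mul_exp_neg_atTop_nhds_zero n
    have h := (this.comp (tendsto_id.const_mul_atTop hc)).const_mul ((1 / c) ^ n)
    rw [mul_zero] at h
    refine h.congr fun X => ?_
    simp only [Function.comp, id]
    rw [mul_pow, ← mul_assoc, ← mul_assoc, ← mul_pow]
    rw [one_div_mul_cancel hc.ne', one_pow, one_mul]
    congr 2; ring
  have hc4 : 0 < γ / 144 - 68 * ε := by rw [hε]; linarith
  have hc5 : 0 < γ / 144 - 14504 * ε := by rw [hε]; linarith
  have hc6 : 0 < 1 - 36236 * ε := by rw [hε]; linarith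
  have h4 : ∀ᶠ X : ℝ in atTop, (120 + (16 * (X / (17 * l)) + 2) * (8 * (X / (17 * l)) + 2)) *
        Real.exp (-(γ / 144 - 68 * ε) * X) < 1 := by
    have t := (((hpoly _ 0 hc4).const_mul 124).add ((hpoly _ 1 hc4).const_mul (48 / (17 * l)))).add
      ((hpoly _ 2 hc4).const_mul (128 / (17 * l) ^ 2))
    simp only [mul_zero, add_zero] at t
    refine ((t.eventually_lt_const (show (0:ℝ) < 1 by norm_num))).mono fun X hX => ?_
    refine lt_of_eq_of_lt ?_ hX
    field_simp
    ring
  have h5 : ∀ᶠ X : ℝ in atTop, 64 * 343 * Real.exp (-(γ / 144 - 14504 * ε) * X) < 1 := by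
    have t := (hpoly _ 0 hc5).const_mul (64 * 343)
    simp only [mul_zero, pow_zero, one_mul] at t
    exact t.eventually_lt_const (by norm_num)
  have h6 := (hexp _ hc6).eventually_ge_atTop (8 * 64 * 28 ^ 3)
  have h7 := (hexp (1/4) (by norm_num)).eventually_ge_atTop 3
  filter_upwards [h1, h2, h3, h4, h5, h6, h7] with X h1 h2 h3 h4 h5 h6 h7
  refine ⟨h1, h2, ⟨?_, ?_⟩, h4, h5, h6, ?_⟩
  · have : X / (17 * l) - X / (18 * l) = X / (18 * 17 * l) := by field_simp; ring
    have h : 1 ≤ X / (18 * 17 * l) := by rw [le_div_iff₀ (by positivity)]; linarith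
    linarith
  · rw [le_div_iff₀ (by positivity)]; linarith
  · set u := Real.exp (1 / 4 * X) with hu
    have e1 : Real.exp (X / 2) = u ^ 2 := by rw [hu, ← Real.exp_nat_mul]; congr 1; push_cast; ring
    have e2 : Real.exp X = u ^ 4 := by rw [hu, ← Real.exp_nat_mul]; congr 1; push_cast; ring
    have e3 : Real.exp (-(1/4) * X) = u⁻¹ := by rw [hu, ← Real.exp_neg]; congr 1; ring
    rw [e1, e2, e3, ← div_eq_mul_inv, le_div_iff₀ (by linarith)]
    have : 3 * u ^ 3 ≤ u ^ 4 := by nlinarith [pow_pos (show 0 < u by linarith) 3]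
    have h27 : (3:ℝ) ^ 3 ≤ u ^ 3 := pow_le_pow_left₀ (by norm_num) h7 3
    nlinarith

end BG

namespace BG
open Finset Pointwise

lemma delta_bound (X l γ : ℝ) (J n0 : ℕ) (hX : 0 < X) (hl : 0.34 ≤ l) (hγ : 0 < γ) (hγ9 : γ ≤ 9)
    (hn0 : 0 < n0) (hn : (n0 : ℝ) ≤ X / (17 * l)) (hJ : (J : ℝ) ≤ 3 / (γ / 2 ^ 24) + 1) :
    (2 : ℝ) ^ (-(2 : ℝ) ^ (35 : ℕ) / γ) ≤
      1 - Real.exp (-(X / (8 * ((4 ^ J * n0 : ℕ) : ℝ)))) := by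
  have hn' : (0 : ℝ) < n0 := by exact_mod_cast hn0
  have h4 : (1 : ℝ) ≤ 4 ^ J := one_le_pow₀ (by norm_num)
  rw [le_div_iff₀ (by positivity)] at hn
  set x : ℝ := 1 / (4 * 4 ^ J) with hx
  have hx0 : 0 < x := by positivity
  have hx1 : x ≤ 1 := by
    rw [hx, div_le_one (by positivity)]; linarith
  have hy : x ≤ X / (8 * ((4 ^ J * n0 : ℕ) : ℝ)) := by
    push_cast
    rw [hx, div_le_div_iff₀ (by positivity) (by positivity)]
    have : 2 * (n0 : ℝ) ≤ X := by nlinarith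
    nlinarith
  have he : Real.exp (-x) ≤ 1 - x / 2 := by
    rw [Real.exp_neg]
    have h := Real.add_one_le_exp x
    refine (inv_anti₀ (by linarith) h).trans ?_
    rw [inv_le_iff_one_le_mul₀ (by linarith)]
    nlinarith
  have he2 : Real.exp (-(X / (8 * ((4 ^ J * n0 : ℕ) : ℝ)))) ≤ Real.exp (-x) :=
    Real.exp_le_exp.2 (by linarith)
  have hlast : (2 : ℝ) ^ (-(2 : ℝ) ^ (35 : ℕ) / γ) ≤ x / 2 := by
    have e : x / 2 = (2 : ℝ) ^ (-((2 * J + 3 : ℕ) : ℝ)) := by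
      rw [Real.rpow_neg (by norm_num), Real.rpow_natCast, hx, pow_add, pow_mul]
      norm_num
      ring
    rw [e]
    apply Real.rpow_le_rpow_of_exponent_le (by norm_num)
    rw [neg_div, neg_le_neg_iff, le_div_iff₀ hγ]
    push_cast
    have h5 : (J : ℝ) * γ ≤ 3 * 2 ^ 24 + γ := by
      have h := mul_le_mul_of_nonneg_right hJ hγ.le
      have : (3 / (γ / 2 ^ 24) + 1) * γ = 3 * 2 ^ 24 + γ := by field_simp
      linarith
    norm_num at h5 ⊢
    nlinarith
  linarith

section
variable {p : ℕ} [Fact p.Prime]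
local notation "SL" => Matrix.SpecialLinearGroup (Fin 2) (ZMod p)

lemma alt_bound (X ε E Q K : ℝ) (hX : (p : ℝ) = Real.exp X) (hE : 0 ≤ E)
    (hK : K = Real.exp (ε * X)) (hQ : Q = Real.exp (7236 * ε * X))
    (h6 : 8 * 64 * 28 ^ 3 ≤ Real.exp ((1 - 36236 * ε) * X))
    (h : ((p : ℝ) ^ 2 - p) ^ 3 * E ^ 2 ≤ 64 * 28 ^ 3 * Q ^ 5 * (K ^ 28) ^ 2) :
    E ≤ Real.exp (-(5/2) * X) := by
  have hp : (2 : ℝ) ≤ p := by exact_mod_cast (Fact.out : p.Prime).two_le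
  have h1 : ((p : ℝ) ^ 2 / 2) ^ 3 ≤ ((p : ℝ) ^ 2 - p) ^ 3 :=
    pow_le_pow_left₀ (by positivity) (by nlinarith) 3
  have e1 : Q ^ 5 * (K ^ 28) ^ 2 = Real.exp (36236 * ε * X) := by
    rw [hQ, hK, ← Real.exp_nat_mul, ← Real.exp_nat_mul, ← Real.exp_nat_mul, ← Real.exp_add]
    congr 1; push_cast; ring
  have e2 : ((p : ℝ) ^ 2 / 2) ^ 3 = Real.exp (6 * X) / 8 := by
    have : Real.exp (6 * X) = (p : ℝ) ^ 6 := by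
      rw [hX, ← Real.exp_nat_mul]; push_cast; rfl
    rw [this]; ring
  have h2 := (mul_le_mul_of_nonneg_right h1 (sq_nonneg E)).trans h
  rw [e2, mul_assoc (64 * 28 ^ 3), e1] at h2
  have h3 : Real.exp (6 * X) * E ^ 2 ≤ Real.exp X := by
    calc Real.exp (6 * X) * E ^ 2 ≤ 8 * 64 * 28 ^ 3 * Real.exp (36236 * ε * X) := by linarith
      _ ≤ Real.exp ((1 - 36236 * ε) * X) * Real.exp (36236 * ε * X) :=
        mul_le_mul_of_nonneg_right h6 (Real.exp_pos _).le
      _ = Real.exp X := by rw [← Real.exp_add]; congr 1; ring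
  have h4 : E ^ 2 ≤ Real.exp (-(5/2) * X) ^ 2 := by
    have e : Real.exp (6 * X) * Real.exp (-(5/2) * X) ^ 2 = Real.exp X := by
      rw [← Real.exp_nat_mul, ← Real.exp_add]; congr 1; push_cast; ring
    rw [← e] at h3
    exact le_of_mul_le_mul_left h3 (Real.exp_pos _)
  exact le_of_pow_le_pow_left₀ two_ne_zero (Real.exp_pos _).le h4

theorem core {S : Finset (Matrix.SpecialLinearGroup (Fin 2) ℤ)} (hsym : ∀ s ∈ S, s⁻¹ ∈ S)
    (hfree : ∀ l, l ≠ [] → Red S l → l.prod ≠ 1) (hcard : 4 ≤ S.card)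
    (D l A γ ε X : ℝ) (hD0 : 0 < D) (hD : ∀ s ∈ S, sl2zOpNorm s ≤ D) (hD1 : 1 ≤ D)
    (hlD : l = Real.log D) (hl : 0.34 ≤ l) (hA : A = Real.log (4 / 3 * S.card) / 2)
    (hγA : A = γ * l) (hγ : 0 < γ) (hγ9 : γ ≤ 9) (hε : ε = γ / 2 ^ 24)
    (hX : (p : ℝ) = Real.exp X) (h2 : (2 : ZMod p) ≠ 0)
    (c1 : 4096 ≤ Real.exp (ε * X)) (c2 : 17 * Real.log 2 < X)
    (c3 : X / (18 * l) ≤ X / (17 * l) - 1 ∧ 1 ≤ X / (18 * l))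
    (c4 : (120 + (16 * (X / (17 * l)) + 2) * (8 * (X / (17 * l)) + 2)) *
        Real.exp (-(γ / 144 - 68 * ε) * X) < 1)
    (c5 : 64 * 343 * Real.exp (-(γ / 144 - 14504 * ε) * X) < 1)
    (c6 : 8 * 64 * 28 ^ 3 ≤ Real.exp ((1 - 36236 * ε) * X))
    (c7 : 2 * Real.exp (X / 2) ≤ (Real.exp X - 1) * Real.exp (-(1/4) * X))
    (f : SL → ℝ) (hf : ∑ g, f g = 0) :
    (2 : ℝ) ^ (-(2 : ℝ) ^ (35 : ℕ) / γ) * S.card * ∑ g, f g ^ 2 ≤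
      ∑ g, ∑ s ∈ S, f g *
        (f g - f (g * Matrix.SpecialLinearGroup.map (n := Fin 2) (Int.castRingHom (ZMod p)) s)) := by
  classical
  have hk : (4 : ℝ) ≤ S.card := by exact_mod_cast hcard
  have hSne : S.Nonempty := card_pos.1 (by omega)
  obtain ⟨β, r, hβ, hβ2, hr, hr0, hrA⟩ := r_bound S.card A hk hA
  have hX0 : 0 < X := lt_trans (by have := Real.log_pos one_lt_two; linarith) c2
  have hε0 : 0 < ε := by rw [hε]; positivity
  have hl0 : 0 < l := by linarith
  set σ : Matrix.SpecialLinearGroup (Fin 2) ℤ →* SL :=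
    Matrix.SpecialLinearGroup.map (n := Fin 2) (Int.castRingHom (ZMod p)) with hσ
  have hsy : ∀ f : SL → ℝ, ∑ s ∈ S, f (σ s) = ∑ s ∈ S, f (σ s)⁻¹ := by
    intro f
    refine sum_nbij' (fun s => s⁻¹) (fun s => s⁻¹) hsym hsym (by simp) (by simp) ?_
    intro s _
    rw [map_inv, inv_inv]
  set n0 := ⌊X / (17 * l)⌋₊ with hn0
  have hn1 : (n0 : ℝ) ≤ X / (17 * l) := Nat.floor_le (by positivity)
  have hn2 : X / (18 * l) ≤ n0 := by
    have := Nat.lt_floor_add_one (X / (17 * l))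
    rw [← hn0] at this; linarith [c3.1]
  have hn3 : 0 < n0 := by
    have : (0 : ℝ) < n0 := by linarith [c3.2]
    exact_mod_cast this
  have hDe : D = Real.exp l := by rw [hlD, Real.exp_log hD0]
  have hnl : (n0 : ℝ) * (17 * l) ≤ X := (le_div_iff₀ (by positivity)).1 hn1
  have hbig : 2 * D ^ (8 * (2 * n0)) < p := by
    rw [hDe, ← Real.exp_nat_mul, hX]
    have : (2 : ℝ) < Real.exp (X / 17) := by
      rw [← Real.log_lt_iff_lt_exp (by norm_num)]; linarith
    calc 2 * Real.exp (((8 * (2 * n0) : ℕ) : ℝ) * l) ≤ 2 * Real.exp (16 / 17 * X) := by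
          refine mul_le_mul_of_nonneg_left (Real.exp_le_exp.2 ?_) (by norm_num)
          push_cast; linarith
      _ < Real.exp (X / 17) * Real.exp (16 / 17 * X) :=
          mul_lt_mul_of_pos_right this (Real.exp_pos _)
      _ = Real.exp X := by rw [← Real.exp_add]; congr 1; ring
  have hbig2 : 2 * D ^ (2 * n0) < p := by
    refine lt_of_le_of_lt ?_ hbig
    refine mul_le_mul_of_nonneg_left (pow_le_pow_right₀ hD1 (by omega)) (by norm_num)
  have hrn : r ^ (2 * n0) ≤ Real.exp (-(γ / 144) * X) := by
    refine (pow_le_pow_left₀ hr0.le hrA _).trans ?_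
    rw [← Real.exp_nat_mul]
    apply Real.exp_le_exp.2
    have h : X ≤ n0 * (18 * l) := (div_le_iff₀ (by positivity)).1 hn2
    push_cast
    rw [hγA]
    have := mul_le_mul_of_nonneg_left h hγ.le
    linarith
  have hret := return_prob p hsym hfree hcard hβ hβ2 hr hD hD1 (2 * n0) hbig2
  have hsm := sub_mass p hsym hfree hcard hβ hβ2 hr hD hD1 (2 * n0) hbig h2
  rw [← hσ] at hret hsm
  set P : ℝ := 120 + (16 * (X / (17 * l)) + 2) * (8 * (X / (17 * l)) + 2) with hP
  have hP0 : 0 < P := by positivity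
  set c : ℝ := Real.sqrt (P * Real.exp (-(γ / 144) * X)) with hc
  have hc2 : c ^ 2 = P * Real.exp (-(γ / 144) * X) := Real.sq_sqrt (by positivity)
  have hc0 : 0 ≤ c := Real.sqrt_nonneg _
  set K := Real.exp (ε * X) with hK
  have hQ : K ^ 7236 = Real.exp (7236 * ε * X) := by
    rw [hK, ← Real.exp_nat_mul]; congr 1; push_cast; ring
  have hKc : K ^ 34 * c < 1 := by
    have h : (K ^ 34 * c) ^ 2 < 1 := by
      rw [mul_pow, hc2, hK, ← Real.exp_nat_mul, ← Real.exp_nat_mul]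
      refine lt_of_eq_of_lt ?_ c4
      rw [mul_left_comm, ← Real.exp_add]
      congr 2; push_cast; ring
    exact (sq_lt_one_iff₀ (by positivity)).1 h
  have hsub : ∀ H0 : Subgroup SL, H0 ≠ ⊤ → ∀ h : SL → ℝ, (∀ x, h x ≤ 1) →
      (∀ x, x ∉ H0 → h x ≤ 0) → ∑ x, wk S σ (2 * n0) x * h x ≤ c ^ 2 := by
    intro H0 hH h ha hb
    have hs := hsm H0 hH
    have h3 : ∑ x, wk S σ (2 * n0) x * h x ≤
        ∑ x, wk S σ (2 * n0) x * (if x ∈ H0 then 1 else 0) := by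
      refine sum_le_sum fun x _ => mul_le_mul_of_nonneg_left ?_ (wk_nonneg _ _ _ _)
      split_ifs with hx
      · exact ha x
      · exact hb x hx
    refine h3.trans (le_trans (le_of_eq ?_) (hs.trans ?_))
    · refine sum_congr rfl fun x _ => ?_
      congr 1
    · rw [hc2]
      refine mul_le_mul ?_ hrn (by positivity) hP0.le
      rw [hP]; push_cast
      have hn0' : (0 : ℝ) ≤ n0 := Nat.cast_nonneg _
      have : (8 * (2 * (n0 : ℝ)) + 2) * (4 * (2 * (n0 : ℝ)) + 2) ≤
          (16 * (X / (17 * l)) + 2) * (8 * (X / (17 * l)) + 2) :=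
        mul_le_mul (by linarith) (by linarith) (by positivity) (by positivity)
      linarith
  have hE : 64 * 343 * Real.exp (7236 * ε * X) ^ 2 * (K ^ 32 * wk S σ (2 * n0) 1) < 1 := by
    have h := hret.trans hrn
    refine lt_of_le_of_lt ?_ c5
    have e : 64 * 343 * Real.exp (-(γ / 144 - 14504 * ε) * X) =
        64 * 343 * Real.exp (7236 * ε * X) ^ 2 * (K ^ 32 * Real.exp (-(γ / 144) * X)) := by
      rw [hK, ← Real.exp_nat_mul, ← Real.exp_nat_mul, ← Real.exp_add, mul_assoc (64 * 343 : ℝ),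
        ← Real.exp_add]
      congr 2; push_cast; ring
    rw [e]
    refine mul_le_mul_of_nonneg_left (mul_le_mul_of_nonneg_left h ?_) ?_ <;> positivity
  have hstep : ∀ m, n0 ≤ m → wk S σ (2 * (4 * m)) 1 ≤ wk S σ (2 * m) 1 / K ∨
      wk S σ (2 * m) 1 ≤ Real.exp (-(5/2) * X) := by
    intro m hm
    rcases step h2 S hSne σ hsy n0 K c _ c1 hQ hc0 hKc hsub hE m hm with h | h
    · exact Or.inl h
    · right
      exact alt_bound X ε _ _ K hX (wk_nonneg _ _ _ _) hK rfl c6 h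
  set J := ⌈3 / ε⌉₊ with hJ
  have hJ1 : 3 / ε ≤ J := Nat.le_ceil _
  have hJ2 : (J : ℝ) ≤ 3 / ε + 1 := (Nat.ceil_lt_add_one (by positivity)).le
  have hit := iter S hSne σ hsy n0 K _ (by linarith) hstep J
  have hfin : wk S σ (2 * (4 ^ J * n0)) 1 ≤ Real.exp (-(5/2) * X) := by
    rcases hit with h | h
    · exact h
    · refine h.trans ?_
      rw [hK, one_div, ← Real.exp_neg, ← Real.exp_nat_mul]
      apply Real.exp_le_exp.2
      have : 3 ≤ J * ε := (div_le_iff₀ hε0).1 hJ1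
      have := mul_le_mul_of_nonneg_right this hX0.le
      linarith
  refine gap_of_return h2 S hSne σ hsy (4 ^ J * n0) X hX (by positivity) hfin c7 f hf _ ?_
  exact delta_bound X l γ J n0 hX0 hl hγ hγ9 hn3 hn1 (by rw [← hε]; exact hJ2)
end

open Filter in
theorem main (S : Finset (Matrix.SpecialLinearGroup (Fin 2) ℤ))
    (hcard : 4 ≤ S.card) (hsym : ∀ s ∈ S, s⁻¹ ∈ S)
    (hfree : ∀ l, l ≠ [] → Red S l → l.prod ≠ 1) (D : ℝ) (hD : ∀ s ∈ S, sl2zOpNorm s ≤ D) :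
    ∃ p₀ : ℕ, ∀ (p : ℕ) [Fact p.Prime], p₀ ≤ p →
      ∀ f : Matrix.SpecialLinearGroup (Fin 2) (ZMod p) → ℝ, ∑ g, f g = 0 →
        (2 : ℝ) ^ (-(2 : ℝ) ^ (35 : ℕ) /
            (Real.log (2 / Real.sqrt 3 * Real.sqrt (S.card : ℝ)) / Real.log D)) *
          (S.card : ℝ) * ∑ g, (f g) ^ 2 ≤
        ∑ g, ∑ s ∈ S, f g *
          (f g - f (g * Matrix.SpecialLinearGroup.map (n := Fin 2) (Int.castRingHom (ZMod p)) s)) := by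
  have hk : (4 : ℝ) ≤ S.card := by exact_mod_cast hcard
  rw [log_A _ hk]
  obtain ⟨s, hs⟩ : S.Nonempty := card_pos.1 (by omega)
  have hD0 : 0 ≤ D := (opnorm_nonneg s).trans (hD s hs)
  have hD2 := norm_lower hsym hfree hcard hD
  have hD1 : 1.4 ≤ D := by nlinarith
  set l := Real.log D with hl
  have hl34 : 0.34 ≤ l := by
    have h := Real.log_le_log (by norm_num) hD2
    rw [Real.log_pow, ← hl] at h
    have := Real.log_two_gt_d9
    push_cast at h
    linarith
  have hl0 : 0 < l := by linarith
  set A := Real.log (4 / 3 * S.card) / 2 with hA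
  have hA0 : 0 < A := by
    have := Real.log_pos (show 1 < 4 / 3 * (S.card : ℝ) by linarith)
    rw [hA]; linarith
  have hA9 : A ≤ 9 * l := by
    have h1 := card_le_pow hD0 hD2 hD
    have h2 : 4 / 3 * (S.card : ℝ) ≤ D ^ 18 := by
      have : D ^ 18 = D ^ 2 * D ^ 16 := by ring
      have := mul_le_mul hD2 h1 (by positivity) (by positivity)
      linarith
    have h3 := Real.log_le_log (by positivity) h2
    rw [Real.log_pow, ← hl] at h3
    push_cast at h3
    rw [hA]; linarith
  have hγ : 0 < A / l := by positivity
  have hγ9 : A / l ≤ 9 := by rw [div_le_iff₀ hl0]; exact hA9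
  have hev := eventual l (A / l) _ hl0 hγ hγ9 rfl
  have hev2 := (Real.tendsto_log_atTop.comp
    (tendsto_natCast_atTop_atTop (R := ℝ))).eventually hev
  obtain ⟨p₀, hp₀⟩ := eventually_atTop.1 hev2
  refine ⟨max p₀ 3, ?_⟩
  intro p _ hp f hf
  obtain ⟨c1, c2, c3, c4, c5, c6, c7⟩ := hp₀ p ((le_max_left _ _).trans hp)
  have hp3 : 3 ≤ p := (le_max_right _ _).trans hp
  have h2 : (2 : ZMod p) ≠ 0 := by
    intro h
    have h' : ((2 : ℕ) : ZMod p) = 0 := by exact_mod_cast h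
    rw [ZMod.natCast_eq_zero_iff] at h'
    have := Nat.le_of_dvd (by norm_num) h'
    omega
  have hpp : (0 : ℝ) < p := by
    have : 0 < p := by omega
    exact_mod_cast this
  exact core hsym hfree hcard D l A (A / l) _ (Real.log p) (by linarith) hD (by linarith) hl hl34
    hA (by field_simp) hγ hγ9 rfl (Real.exp_log hpp).symm h2 c1 c2 c3 c4 c5 c6 c7 f hf
end BG

/-- **Explicit expansion for `SL₂` (Theorem `th-bg-bis`, Bourgain–Gamburd, explicit form).**
Let `S ⊆ SL₂(ℤ)` be a finite symmetric set, `|S| ≥ 4`, freely generating a free group of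
rank `|S|/2` (i.e. no nonempty reduced word in `S` equals `1`). With
`Δ = max_{s∈S} ‖s‖` and `γ = log((2/√3)√|S|)/log Δ`, there is `p₀` such that for every
prime `p ≥ p₀` for which `S mod p` generates `SL₂(𝔽_p)`, the spectral gap of the normalized
Laplacian of the Cayley graph of `SL₂(𝔽_p)` with respect to `S mod p` is at least
`2^(−2^35·γ⁻¹)`: for every mean-zero `f : SL₂(𝔽_p) → ℝ`,
`∑_g ∑_{s∈S} f(g)(f(g) − f(g·s̄)) ≥ 2^(−2^35·γ⁻¹)·|S|·∑_g f(g)²`. -/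
theorem stmt_2 (S : Finset (Matrix.SpecialLinearGroup (Fin 2) ℤ))
    (hcard : 4 ≤ S.card)
    (hsym : ∀ s ∈ S, s⁻¹ ∈ S)
    (hfree : ∀ l : List (Matrix.SpecialLinearGroup (Fin 2) ℤ),
      l ≠ [] → (∀ x ∈ l, x ∈ S) →
      l.Chain' (fun a b => a * b ≠ 1) → l.prod ≠ 1) :
    ∃ p₀ : ℕ, ∀ (p : ℕ) [Fact p.Prime], p₀ ≤ p →
      Subgroup.closure
          ((S.image (Matrix.SpecialLinearGroup.map (Int.castRingHom (ZMod p))) :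
            Finset (Matrix.SpecialLinearGroup (Fin 2) (ZMod p))) :
            Set (Matrix.SpecialLinearGroup (Fin 2) (ZMod p))) = ⊤ →
      ∀ f : Matrix.SpecialLinearGroup (Fin 2) (ZMod p) → ℝ,
        ∑ g, f g = 0 →
        (2 : ℝ) ^ (-(2 : ℝ) ^ (35 : ℕ) /
            (Real.log (2 / Real.sqrt 3 * Real.sqrt (S.card : ℝ)) /
              Real.log (S.sup' (Finset.card_pos.mp (by omega)) sl2zOpNorm))) *
          (S.card : ℝ) * ∑ g, (f g) ^ 2 ≤
        ∑ g, ∑ s ∈ S, f g *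
          (f g - f (g * Matrix.SpecialLinearGroup.map (Int.castRingHom (ZMod p)) s)) := by
  obtain ⟨p₀, h⟩ := BG.main S hcard hsym (fun l hl hr => hfree l hl hr.1 hr.2)
    (S.sup' (Finset.card_pos.mp (by omega)) sl2zOpNorm)
    (fun s hs => Finset.le_sup' sl2zOpNorm hs)
  exact ⟨p₀, fun p _ hp _ f hf => h p hp f hf⟩
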